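/- (Inhomogeneous/retarded Strichartz estimate for the half-wave propagator in d = 3.) Let (p,q) and (p̃,q̃) be wave-admissible pairs (each in [2,∞] × [2,∞) with the reciprocals of the first and second exponents summing to at most 1/2), and set γ = 1/p + 3/q − 1/2 and γ̃ = 1/p̃ + 3/q̃ − 1/2. There is a constant C = C(p,q,p̃,q̃) such that for every smooth compactly supported (in time) map F : ℝ → 𝒮(ℝ³), every interval J ⊆ ℝ containing 0, and either choice of sign, ‖ ∫₀^t e^{±i(t−s)|∇|} F(s) ds ‖_{L_t^p L_x^q(J×ℝ³)} ≤ C ‖ |∇|^{2−γ−γ̃} F ‖_{L_t^{p̃'} L_x^{q̃'}(J×ℝ³)}, where p̃' and q̃' denote the Hölder conjugates of p̃ and q̃. -/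

import Mathlib

open MeasureTheory SchwartzMap Metric Set
open scoped ENNReal NNReal FourierTransform RealInnerProductSpace

noncomputable section

abbrev E3 := EuclideanSpace ℝ (Fin 3)

/-- Fourier multiplier with symbol `m`. -/
def fmul3 (m : E3 → ℂ) (f : E3 → ℂ) : E3 → ℂ :=
  𝓕⁻ (fun ξ => m ξ * 𝓕 f ξ)

/-- The fractional derivative `|∇|^s`. -/
def absGrad3 (s : ℝ) (f : E3 → ℂ) : E3 → ℂ :=
  fmul3 (fun ξ => (((2 * Real.pi * ‖ξ‖) ^ s : ℝ) : ℂ)) f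

/-- The half-wave propagator `e^{σ i t |∇|}`. -/
def halfWave3 (σ t : ℝ) (f : E3 → ℂ) : E3 → ℂ :=
  fmul3 (fun ξ => Complex.exp (Complex.I * (σ * (2 * Real.pi * t * ‖ξ‖)))) f

/-- The propagator `cos(t|∇|)`. -/
def cosProp3 (t : ℝ) (f : E3 → ℂ) : E3 → ℂ :=
  fmul3 (fun ξ => ((Real.cos (2 * Real.pi * t * ‖ξ‖) : ℝ) : ℂ)) f

/-- The propagator `sin(t|∇|)/|∇|`. -/
def sinProp3 (t : ℝ) (g : E3 → ℂ) : E3 → ℂ :=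
  fmul3 (fun ξ => ((Real.sin (2 * Real.pi * t * ‖ξ‖) / (2 * Real.pi * ‖ξ‖) : ℝ) : ℂ)) g

/-- A Littlewood–Paley bump function. -/
structure IsLPBump3 (φ : E3 → ℝ) : Prop where
  smooth : ContDiff ℝ (⊤ : ℕ∞) φ
  mem_Icc : ∀ ξ, φ ξ ∈ Icc (0:ℝ) 1
  eq_one : ∀ ξ : E3, ‖ξ‖ ≤ 1 → φ ξ = 1
  eq_zero : ∀ ξ : E3, 2 ≤ ‖ξ‖ → φ ξ = 0

/-- The Littlewood–Paley projection `P_N`. -/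
def LP3 (φ : E3 → ℝ) (N : ℝ) (f : E3 → ℂ) : E3 → ℂ :=
  fmul3 (fun ξ => ((φ (N⁻¹ • ξ) - φ ((2 / N) • ξ) : ℝ) : ℂ)) f

/-- The homogeneous Besov norm `Ḃ^s_{p,1}`. -/
def besov3 (φ : E3 → ℝ) (s : ℝ) (p : ℝ≥0∞) (f : E3 → ℂ) : ℝ≥0∞ :=
  ∑' n : ℤ, ENNReal.ofReal (((2:ℝ) ^ n) ^ s) * eLpNorm (LP3 φ ((2:ℝ) ^ n) f) p volume

/-- The mixed spacetime norm `L_t^p L_x^q (J × ℝ³)`. -/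
def mixedNorm3 (p q : ℝ≥0∞) (J : Set ℝ) (F : ℝ → E3 → ℂ) : ℝ≥0∞ :=
  if p = ∞ then essSup (fun t => eLpNorm (F t) q volume) (volume.restrict J)
  else (∫⁻ t in J, (eLpNorm (F t) q volume) ^ p.toReal) ^ (1 / p.toReal)

/-- Time derivative `∂ₜ u`. -/
def dt (u : ℝ → E3 → ℝ) (t : ℝ) (x : E3) : ℝ := deriv (fun s => u s x) t

/-- Second time derivative `∂ₜ² u`. -/
def dtt (u : ℝ → E3 → ℝ) (t : ℝ) (x : E3) : ℝ := deriv (fun s => dt u s x) t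

/-- The spatial Laplacian: sum of second partial derivatives. -/
def lap3 (f : E3 → ℝ) (x : E3) : ℝ :=
  ∑ i : Fin 3,
    fderiv ℝ (fun y => fderiv ℝ f y (EuclideanSpace.single i (1:ℝ))) x
      (EuclideanSpace.single i (1:ℝ))

/-- A Schwartz solution of the energy-critical NLW `∂ₜ²u - Δu + ε u⁵ = 0` on `ℝ × ℝ³`:
a jointly smooth function, all of whose time derivatives are Schwartz in space at each time,
solving the equation pointwise. -/
structure IsNLWSolution (ε : ℝ) (u : ℝ → E3 → ℝ) : Prop where
  smooth : ContDiff ℝ (⊤ : ℕ∞) (fun p : ℝ × E3 => u p.1 p.2)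
  schwartz : ∀ (k : ℕ) (t : ℝ), ∃ g : 𝓢(E3, ℝ), ∀ x,
    iteratedDeriv k (fun s => u s x) t = g x
  eqn : ∀ t x, dtt u t x - lap3 (u t) x + ε * (u t x) ^ 5 = 0

/-- `‖∇f‖_{L²}`. -/
def gradL2 (f : E3 → ℝ) : ℝ≥0∞ := eLpNorm (fun x => ‖fderiv ℝ f x‖) 2 volume

/-- `‖(f,g)‖_{Ḣ¹ × L²} = ‖∇f‖_{L²} + ‖g‖_{L²}`. -/
def H1L2 (f g : E3 → ℝ) : ℝ≥0∞ := gradL2 f + eLpNorm g 2 volume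

/-- The ground state `W(x) = (1 + |x|²/3)^{-1/2}`. -/
def Wfn : E3 → ℝ := fun x => (1 + ‖x‖ ^ 2 / 3) ^ (-(1/2) : ℝ)

/-- The (focusing-sign) energy `E(f,g) = ∫ ½|∇f|² + ½g² - ⅙f⁶`. -/
def energyKM (f g : E3 → ℝ) : ℝ :=
  ∫ x, ((1/2) * ‖fderiv ℝ f x‖ ^ 2 + (1/2) * g x ^ 2 - (1/6) * f x ^ 6)

/-- The Kenig–Merle condition: `E(u₀,u₁) < E(W,0)` and `‖∇u₀‖₂ < ‖∇W‖₂`. -/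
def KenigMerle (f g : E3 → ℝ) : Prop :=
  energyKM f g < energyKM Wfn (fun _ => 0) ∧ gradL2 f < gradL2 Wfn

/-- Coercion of a real-valued function to a complex-valued one. -/
def rc (f : E3 → ℝ) : E3 → ℂ := fun x => (f x : ℂ)

lemma continuous_fourierInv3 {h : E3 → ℂ} (hh : Integrable h) : Continuous (𝓕⁻ h) := by
  have : Continuous (VectorFourier.fourierIntegral Real.fourierChar volume (-innerₗ E3) h) :=
    VectorFourier.fourierIntegral_continuous Real.continuous_fourierChar
      (by
        have : Continuous fun p : E3 × E3 => -⟪p.1, p.2⟫ := by fun_prop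
        simpa using this) hh
  exact this

lemma norm_fourierInv_le3 (h : E3 → ℂ) (x : E3) : ‖𝓕⁻ h x‖ ≤ ∫ ξ, ‖h ξ‖ := by
  rw [Real.fourierInv_eq]
  exact (norm_integral_le_integral_norm _).trans (le_of_eq (by simp))

lemma integral_fourierInv_mul {h k : E3 → ℂ} (hh : Integrable h) (hk : Integrable k) :
    ∫ x, 𝓕⁻ h x * k x = ∫ ξ, h ξ * 𝓕⁻ k ξ := by
  have := VectorFourier.integral_fourierIntegral_smul_eq_flip (L := -innerₗ E3)
    (μ := volume) (ν := volume) Real.continuous_fourierChar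
      (by
        have : Continuous fun p : E3 × E3 => -⟪p.1, p.2⟫ := by fun_prop
        simpa using this) hh hk
  simp only [smul_eq_mul] at this
  rw [show (-innerₗ E3).flip = -innerₗ E3 by
    ext x y; simp [real_inner_comm]] at this
  exact this

lemma fourierInv_ae_eq_lp {h : E3 → ℂ} (hh : Integrable h) (h2 : MemLp h 2) :
    𝓕⁻ h =ᵐ[volume] (𝓕⁻ (h2.toLp h) : Lp ℂ 2 (volume : Measure E3)) := by
  apply ae_eq_of_integral_contDiff_smul_eq
  · exact (continuous_fourierInv3 hh).locallyIntegrable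
  · exact (Lp.memLp _).locallyIntegrable (by norm_num)
  · intro g hg hc
    have hg₁ : HasCompactSupport (Complex.ofRealCLM ∘ g) := hc.comp_left rfl
    have hg₂ : ContDiff ℝ (⊤ : ℕ∞) (Complex.ofRealCLM ∘ g) := by fun_prop
    set G : 𝓢(E3, ℂ) := hg₁.toSchwartzMap hg₂ with hG
    have hGg : ∀ x, G x = (g x : ℂ) := fun x => rfl
    have e1 := congrArg (fun T => T G)
      (MeasureTheory.Lp.fourierInv_toTemperedDistribution_eq (h2.toLp h))
    simp only [TemperedDistribution.fourierInv_apply, Lp.toTemperedDistribution_apply,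
      smul_eq_mul] at e1
    have e2 : ∫ x, g x • 𝓕⁻ h x = ∫ x, 𝓕⁻ h x * G x := by
      congr 1; ext x; rw [hGg, mul_comm]; simp
    have e3 : ∫ x, g x • (𝓕⁻ (h2.toLp h) : Lp ℂ 2 (volume : Measure E3)) x
        = ∫ x, G x * (𝓕⁻ (h2.toLp h) : Lp ℂ 2 (volume : Measure E3)) x := by
      congr 1
    rw [e2, e3, ← e1, integral_fourierInv_mul hh G.integrable]
    apply integral_congr_ae
    filter_upwards [h2.coeFn_toLp] with x hx
    rw [hx, mul_comm, SchwartzMap.fourierInv_coe]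

lemma memLp_fourierInv {h : E3 → ℂ} (hh : Integrable h) (h2 : MemLp h 2) :
    MemLp (𝓕⁻ h) 2 :=
  (memLp_congr_ae (fourierInv_ae_eq_lp hh h2)).2 (Lp.memLp _)

lemma eLpNorm_fourierInv {h : E3 → ℂ} (hh : Integrable h) (h2 : MemLp h 2) :
    eLpNorm (𝓕⁻ h) 2 volume = eLpNorm h 2 volume := by
  rw [eLpNorm_congr_ae (fourierInv_ae_eq_lp hh h2)]
  have : ‖(𝓕⁻ (h2.toLp h) : Lp ℂ 2 (volume : Measure E3))‖ = ‖h2.toLp h‖ :=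
    (Lp.fourierTransformₗᵢ E3 ℂ).symm.norm_map _
  rw [Lp.norm_def, Lp.norm_toLp] at this
  exact (ENNReal.toReal_eq_toReal_iff' (Lp.eLpNorm_ne_top _) h2.eLpNorm_ne_top).1 this

open ComplexConjugate in
lemma integral_fourierInv_mul_conj {h k : E3 → ℂ} (hh : Integrable h) (h2 : MemLp h 2)
    (hk : Integrable k) (k2 : MemLp k 2) :
    ∫ x, 𝓕⁻ h x * conj (𝓕⁻ k x) = ∫ ξ, h ξ * conj (k ξ) := by
  have : inner ℂ (𝓕⁻ (k2.toLp k) : Lp ℂ 2 (volume : Measure E3)) (𝓕⁻ (h2.toLp h))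
      = inner ℂ (k2.toLp k) (h2.toLp h) :=
    (Lp.fourierTransformₗᵢ E3 ℂ).symm.inner_map_map _ _
  rw [L2.inner_def, L2.inner_def] at this
  have e1 : ∫ x, 𝓕⁻ h x * conj (𝓕⁻ k x) = ∫ a, inner ℂ
      ((𝓕⁻ (k2.toLp k) : Lp ℂ 2 (volume : Measure E3)) a)
      ((𝓕⁻ (h2.toLp h) : Lp ℂ 2 (volume : Measure E3)) a) := by
    apply integral_congr_ae
    filter_upwards [fourierInv_ae_eq_lp hh h2, fourierInv_ae_eq_lp hk k2] with x hx hx'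
    rw [← hx, ← hx']; simp
  rw [e1, this]
  apply integral_congr_ae
  filter_upwards [h2.coeFn_toLp, k2.coeFn_toLp] with x hx hx'
  rw [hx, hx']; simp

lemma sum_geom_indicator_le {ρ : ℝ} (hρ : 1 < ρ) (x : ℝ) (hx : 0 < x) (L : ℝ) (P : ℕ → Prop)
    [DecidablePred P] (hP : ∀ i, P i → x * ρ ^ i ≤ L) (hL : 0 ≤ L) (m : ℕ) :
    ∑ i ∈ Finset.range m, (if P i then x * ρ ^ i else 0) ≤ ρ / (ρ - 1) * L := by
  have h1 : ∀ m : ℕ, ∑ i ∈ Finset.range m, (if P i then x * ρ ^ i else 0)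
      ≤ 1 / (ρ - 1) * (x * ρ ^ m) := by
    intro m
    induction m with
    | zero => simp; have : 0 < ρ - 1 := by linarith
              positivity
    | succ n ih =>
      rw [Finset.sum_range_succ]
      have h3 : (if P n then x * ρ ^ n else 0) ≤ x * ρ ^ n := by
        split_ifs
        · exact le_rfl
        · positivity
      have h4 : 1 / (ρ - 1) * (x * ρ ^ (n+1)) = 1 / (ρ - 1) * (x * ρ ^ n) + x * ρ ^ n := by
        have : ρ - 1 ≠ 0 := by linarith
        field_simp
        ring
      linarith
  induction m with
  | zero => simp; have : 0 < ρ - 1 := by linarith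
            positivity
  | succ n ih =>
    by_cases hn : P n
    · refine (h1 (n+1)).trans ?_
      have := hP n hn
      have h5 : 0 < ρ - 1 := by linarith
      have h6 : 1 / (ρ - 1) * (x * ρ ^ (n + 1)) = ρ / (ρ - 1) * (x * ρ ^ n) := by
        rw [pow_succ]; field_simp
      rw [h6]
      gcongr
    · rw [Finset.sum_range_succ]; simpa [hn] using ih

section
variable {α : Type*} [MeasurableSpace α] {μ : Measure α}

lemma integrable_norm_rpow_of_bdd {a : α → ℂ} (ham : Measurable a) (hai : Integrable a μ) {K : ℝ}
    (hK : ∀ x, ‖a x‖ ≤ K) {r : ℝ} (hr : 1 ≤ r) : Integrable (fun x => ‖a x‖ ^ r) μ := by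
  refine Integrable.mono' (hai.norm.const_mul (K ^ (r - 1)))
    (ham.norm.pow_const r).aestronglyMeasurable ?_
  filter_upwards with x
  rw [Real.norm_of_nonneg (by positivity)]
  rcases eq_or_ne (‖a x‖) 0 with h | h
  · rw [h, Real.zero_rpow (by linarith)]; simp
  · have h0 : 0 < ‖a x‖ := lt_of_le_of_ne (norm_nonneg _) h.symm
    calc ‖a x‖ ^ r = ‖a x‖ ^ (r - 1) * ‖a x‖ := by
          rw [← Real.rpow_add_one h]; simp
      _ ≤ K ^ (r - 1) * ‖a x‖ := by
          exact mul_le_mul_of_nonneg_right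
            (Real.rpow_le_rpow h0.le (hK x) (by linarith)) h0.le

lemma setIntegral_norm_le_of_le {a : α → ℂ} (ham : Measurable a) (hai : Integrable a μ) {K : ℝ}
    (hK : ∀ x, ‖a x‖ ≤ K) {r : ℝ} (hr : 1 < r) {S : Set α} (hS : MeasurableSet S) {c : ℝ}
    (hc : 0 < c) (hcS : ∀ x ∈ S, c ≤ ‖a x‖) :
    ∫ x, ‖S.indicator a x‖ ∂μ ≤ c ^ (1 - r) * ∫ x in S, ‖a x‖ ^ r ∂μ := by
  have e : ∀ x, ‖S.indicator a x‖ = S.indicator (fun x => ‖a x‖) x := fun x => by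
    rw [norm_indicator_eq_indicator_norm]
  simp_rw [e]
  rw [integral_indicator hS, ← integral_const_mul]
  refine setIntegral_mono_on hai.norm.integrableOn
    ((integrable_norm_rpow_of_bdd ham hai hK hr.le).const_mul _).integrableOn hS ?_
  intro x hx
  have h0 : 0 < ‖a x‖ := hc.trans_le (hcS x hx)
  have : ‖a x‖ = ‖a x‖ ^ (1 - r) * ‖a x‖ ^ r := by
    rw [← Real.rpow_add h0]; simp
  calc ‖a x‖ = ‖a x‖ ^ (1 - r) * ‖a x‖ ^ r := this
    _ ≤ _ := by
      gcongr ?_ * _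
      exact Real.rpow_le_rpow_of_nonpos hc (hcS x hx) (by linarith)

lemma setIntegral_sq_le_of_le {a : α → ℂ} (ham : Measurable a) (hai : Integrable a μ) {K : ℝ}
    (hK : ∀ x, ‖a x‖ ≤ K) {r : ℝ} (hr : 1 < r) (hr2 : r < 2) {S : Set α} (hS : MeasurableSet S)
    {c : ℝ} (hcS : ∀ x ∈ S, ‖a x‖ ≤ c) :
    ∫ x, ‖S.indicator a x‖ ^ 2 ∂μ ≤ c ^ (2 - r) * ∫ x in S, ‖a x‖ ^ r ∂μ := by
  have e : ∀ x, ‖S.indicator a x‖ ^ 2 = S.indicator (fun x => ‖a x‖ ^ (2:ℝ)) x := fun x => by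
    by_cases h : x ∈ S <;> simp [h]
  simp_rw [e]
  rw [integral_indicator hS, ← integral_const_mul]
  refine setIntegral_mono_on (integrable_norm_rpow_of_bdd ham hai hK (by norm_num)).integrableOn
    ((integrable_norm_rpow_of_bdd ham hai hK hr.le).const_mul _).integrableOn hS ?_
  intro x hx
  have : ‖a x‖ ^ (2:ℝ) = ‖a x‖ ^ (2 - r) * ‖a x‖ ^ r := by
    rw [← Real.rpow_add' (norm_nonneg _) (by norm_num)]; simp
  rw [this]
  gcongr ?_ * _
  exact Real.rpow_le_rpow (norm_nonneg _) (hcS x hx) (by linarith)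

/-- Bounded integrable measurable functions. -/
def BddInt (μ : Measure α) (a : α → ℂ) : Prop :=
  Measurable a ∧ Integrable a μ ∧ ∃ K, ∀ x, ‖a x‖ ≤ K

lemma BddInt.indicator {a : α → ℂ} (h : BddInt μ a) {S : Set α} (hS : MeasurableSet S) :
    BddInt μ (S.indicator a) := by
  obtain ⟨h1, h2, K, hK⟩ := h
  exact ⟨h1.indicator hS, h2.indicator hS, K, fun x =>
    (norm_indicator_le_norm_self _ _).trans (hK x)⟩

lemma interp_aux {r : ℝ} (hr : 1 < r) (hr2 : r < 2) {B : (α → ℂ) → (α → ℂ) → ℂ} {A : ℝ}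
    (hA : 0 < A)
    (hl : ∀ a a' b, BddInt μ a → BddInt μ a' → BddInt μ b → B (a + a') b = B a b + B a' b)
    (hrr : ∀ a b b', BddInt μ a → BddInt μ b → BddInt μ b' → B a (b + b') = B a b + B a b')
    (h1 : ∀ a b, BddInt μ a → BddInt μ b → ‖B a b‖ ≤ A * (∫ x, ‖a x‖ ∂μ) * ∫ x, ‖b x‖ ∂μ)
    (h2 : ∀ a b, BddInt μ a → BddInt μ b →
      ‖B a b‖ ≤ √(∫ x, ‖a x‖ ^ 2 ∂μ) * √(∫ x, ‖b x‖ ^ 2 ∂μ))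
    {a b : α → ℂ} (ha : BddInt μ a) (hb : BddInt μ b) {l w x0 : ℝ} (hl0 : 0 < l) (hw : 0 < w)
    (hx0 : 0 < x0) :
    ‖B a b‖ ≤ A * l ^ (1 - r) * (∫ x, ‖a x‖ ^ r ∂μ) * (∫ x, ‖b x‖ ^ r ∂μ)
      + (w * 2 ^ (2 - r) * (∫ x, ‖a x‖ ^ r ∂μ) + w⁻¹ * (2 ^ (2 - r) / (2 ^ (2 - r) - 1) *
        (l ^ (2 - r) * ∫ x, ‖b x‖ ^ r ∂μ))) / 2
      + √(x0 ^ (2 - r) * ∫ x, ‖a x‖ ^ r ∂μ) * √(∫ x, ‖b x‖ ^ 2 ∂μ) := by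
  have hab := ha
  have hbb := hb
  obtain ⟨ham, hai, K, hK⟩ := ha
  obtain ⟨hbm, hbi, K', hK'⟩ := hb
  set M := ∫ x, ‖a x‖ ^ r ∂μ with hM
  set N := ∫ x, ‖b x‖ ^ r ∂μ with hN
  have hM0 : 0 ≤ M := integral_nonneg fun x => by positivity
  have hN0 : 0 ≤ N := integral_nonneg fun x => by positivity
  set c : ℕ → ℝ := fun i => x0 * 2 ^ i with hc
  have hc0 : ∀ i, 0 < c i := fun i => by positivity
  have hcs : ∀ i, c (i + 1) = 2 * c i := fun i => by simp only [hc, pow_succ]; ring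
  set low : ℕ → Set α := fun i => {x | ‖a x‖ < c i} with hlow
  set S : ℕ → Set α := fun i => {x | c i ≤ ‖a x‖ ∧ ‖a x‖ < c (i + 1)} with hS
  have mlow : ∀ i, MeasurableSet (low i) := fun i => measurableSet_lt ham.norm measurable_const
  have mS : ∀ i, MeasurableSet (S i) := fun i =>
    (measurableSet_le measurable_const ham.norm).inter (measurableSet_lt ham.norm measurable_const)
  set T : ℕ → Set α := fun i => {x | ‖b x‖ ≤ l / c i} with hT
  have mT : ∀ i, MeasurableSet (T i) := fun i => measurableSet_le hbm.norm measurable_const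
  have step : ∀ m, ‖B ((low m).indicator a) b‖ ≤
      ∑ i ∈ Finset.range m, ‖B ((S i).indicator a) b‖ + ‖B ((low 0).indicator a) b‖ := by
    intro m
    induction m with
    | zero => simp
    | succ m ih =>
      have : (low (m+1)).indicator a = (low m).indicator a + (S m).indicator a := by
        ext x
        have := hcs m
        have := hc0 m
        simp only [hlow, hS, Set.indicator, mem_ofPred_eq, Pi.add_apply]
        by_cases h1 : ‖a x‖ < c m
        · have h2 : ‖a x‖ < c (m+1) := by linarith
          simp [h1, h2]
        · by_cases h2 : ‖a x‖ < c (m+1)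
          · simp [h1, h2, not_lt.1 h1]
          · simp [h1, h2]
      rw [this, hl _ _ _ (hab.indicator (mlow m)) (hab.indicator (mS m)) hbb,
        Finset.sum_range_succ]
      have := norm_add_le (B ((low m).indicator a) b) (B ((S m).indicator a) b)
      linarith
  have hsm : ∃ m, (low m).indicator a = a := by
    obtain ⟨m, hm⟩ := pow_unbounded_of_one_lt (K / x0) (by norm_num : (1:ℝ) < 2)
    refine ⟨m, Set.indicator_eq_self.2 fun x _ => ?_⟩
    rw [div_lt_iff₀ hx0] at hm
    simp only [hlow, hc, mem_ofPred_eq]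
    have := hK x
    linarith
  obtain ⟨m, hm⟩ := hsm
  have key := step m
  rw [hm] at key
  have Ilow : ‖B ((low 0).indicator a) b‖ ≤ √(x0 ^ (2 - r) * M) * √(∫ x, ‖b x‖ ^ 2 ∂μ) := by
    refine (h2 _ _ (hab.indicator (mlow 0)) hbb).trans ?_
    gcongr
    refine (setIntegral_sq_le_of_le ham hai hK hr hr2 (mlow 0) (c := x0) ?_).trans ?_
    · intro x hx
      simp only [hlow, hc, mem_ofPred_eq, pow_zero, mul_one] at hx
      exact hx.le
    · gcongr
      exact setIntegral_le_integral (integrable_norm_rpow_of_bdd ham hai hK hr.le)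
        (Filter.Eventually.of_forall fun x => by positivity)
  set Mi : ℕ → ℝ := fun i => ∫ x in S i, ‖a x‖ ^ r ∂μ with hMi
  set β : ℕ → ℝ := fun i => ∫ x, ‖(T i).indicator b x‖ ^ 2 ∂μ with hβ
  have hMi0 : ∀ i, 0 ≤ Mi i := fun i => integral_nonneg fun x => by positivity
  have hβ0 : ∀ i, 0 ≤ β i := fun i => integral_nonneg fun x => by positivity
  have Ii : ∀ i, ‖B ((S i).indicator a) b‖ ≤ A * l ^ (1 - r) * Mi i * N
      + (w * 2 ^ (2 - r) * Mi i + w⁻¹ * ((c i) ^ (2 - r) * β i)) / 2 := by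
    intro i
    have hci := hc0 i
    have e : b = (T i).indicator b + (T i)ᶜ.indicator b := by
      rw [Set.indicator_self_add_compl]
    have e1 : ‖B ((S i).indicator a) b‖ ≤ ‖B ((S i).indicator a) ((T i).indicator b)‖ +
        ‖B ((S i).indicator a) ((T i)ᶜ.indicator b)‖ := by
      conv_lhs => rw [e]
      rw [hrr _ _ _ (hab.indicator (mS i)) (hbb.indicator (mT i)) (hbb.indicator (mT i).compl)]
      exact norm_add_le _ _
    have e2 : ‖B ((S i).indicator a) ((T i)ᶜ.indicator b)‖ ≤ A * l ^ (1 - r) * Mi i * N := by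
      refine (h1 _ _ (hab.indicator (mS i)) (hbb.indicator (mT i).compl)).trans ?_
      have f1 := setIntegral_norm_le_of_le ham hai hK hr (mS i) hci (fun x hx => hx.1)
      have f2 := setIntegral_norm_le_of_le hbm hbi hK' hr (mT i).compl
        (c := l / c i) (by positivity) (fun x hx => by
          simp only [hT, mem_compl_iff, mem_ofPred_eq, not_le] at hx; exact hx.le)
      have f3 : ∫ x in (T i)ᶜ, ‖b x‖ ^ r ∂μ ≤ N :=
        setIntegral_le_integral (integrable_norm_rpow_of_bdd hbm hbi hK' hr.le)
          (Filter.Eventually.of_forall fun x => by positivity)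
      have f4 : l ^ (1 - r) = c i ^ (1 - r) * (l / c i) ^ (1 - r) := by
        rw [← Real.mul_rpow hci.le (by positivity)]; congr 1; field_simp
      calc A * (∫ x, ‖(S i).indicator a x‖ ∂μ) * ∫ x, ‖(T i)ᶜ.indicator b x‖ ∂μ
          ≤ A * (c i ^ (1 - r) * Mi i) * ((l / c i) ^ (1 - r) * N) := by
            have := hMi0 i
            exact mul_le_mul (mul_le_mul_of_nonneg_left f1 hA.le) (f2.trans (by gcongr))
              (integral_nonneg fun x => norm_nonneg _) (by positivity)
        _ = _ := by rw [f4]; ring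
    have e3 : ‖B ((S i).indicator a) ((T i).indicator b)‖ ≤
        (w * 2 ^ (2 - r) * Mi i + w⁻¹ * ((c i) ^ (2 - r) * β i)) / 2 := by
      refine (h2 _ _ (hab.indicator (mS i)) (hbb.indicator (mT i))).trans ?_
      have f1 := setIntegral_sq_le_of_le ham hai hK hr hr2 (mS i) (c := 2 * c i)
        (fun x hx => by rw [← hcs]; exact hx.2.le)
      have hX : 0 ≤ w * 2 ^ (2 - r) * Mi i := by have := hMi0 i; positivity
      have hY : 0 ≤ w⁻¹ * ((c i) ^ (2 - r) * β i) := by have := hβ0 i; positivity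
      calc √(∫ x, ‖(S i).indicator a x‖ ^ 2 ∂μ) * √(β i)
          ≤ √((2 * c i) ^ (2 - r) * Mi i) * √(β i) := by gcongr
        _ = √(w * 2 ^ (2 - r) * Mi i) * √(w⁻¹ * ((c i) ^ (2 - r) * β i)) := by
          rw [← Real.sqrt_mul (by have := hMi0 i; positivity), ← Real.sqrt_mul hX,
            Real.mul_rpow (by norm_num) hci.le]
          congr 1; field_simp
        _ ≤ _ := by
          have := two_mul_le_add_sq (√(w * 2 ^ (2 - r) * Mi i))
            (√(w⁻¹ * ((c i) ^ (2 - r) * β i)))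
          rw [Real.sq_sqrt hX, Real.sq_sqrt hY] at this
          linarith
    linarith
  have hMsum : ∑ i ∈ Finset.range m, Mi i ≤ M := by
    rw [hMi, ← integral_biUnion_finset]
    · exact setIntegral_le_integral (integrable_norm_rpow_of_bdd ham hai hK hr.le)
        (Filter.Eventually.of_forall fun x => by positivity)
    · exact fun i _ => mS i
    · intro i _ j _ hij
      have hmono : ∀ i j, i < j → Disjoint (S i) (S j) := by
        intro i j hij
        rw [Set.disjoint_left]
        intro x hx hx'
        have h6 : c (i+1) ≤ c j := by
          simp only [hc]; gcongr
          · norm_num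
          · exact hij
        have := hx.2
        have := hx'.1
        linarith
      rcases lt_or_gt_of_ne hij with h | h
      · exact hmono _ _ h
      · exact (hmono _ _ h).symm
    · exact fun i _ => (integrable_norm_rpow_of_bdd ham hai hK hr.le).integrableOn
  have hβsum : ∑ i ∈ Finset.range m, c i ^ (2 - r) * β i ≤
      2 ^ (2 - r) / (2 ^ (2 - r) - 1) * (l ^ (2 - r) * N) := by
    have i2 : ∀ i, Integrable (fun x => ‖(T i).indicator b x‖ ^ 2) μ := fun i => by
      obtain ⟨q1, q2, K2, q3⟩ := hbb.indicator (mT i)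
      simpa using integrable_norm_rpow_of_bdd q1 q2 q3 (r := 2) (by norm_num)
    simp only [hβ, hN]
    simp_rw [← integral_const_mul]
    rw [← integral_finsetSum _ (fun i _ => (i2 i).const_mul _)]
    refine integral_mono (integrable_finsetSum _ fun i _ => (i2 i).const_mul _)
      (((integrable_norm_rpow_of_bdd hbm hbi hK' hr.le).const_mul _).const_mul _) fun x => ?_
    simp only
    rcases eq_or_ne (b x) 0 with h | h
    · have : ∀ i, (T i).indicator b x = 0 := fun i => by simp [Set.indicator, h]
      simp only [this, norm_zero]
      simp [h, Real.zero_rpow (by linarith : r ≠ 0)]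
    have hbx : 0 < ‖b x‖ := norm_pos_iff.2 h
    have g := sum_geom_indicator_le (ρ := 2 ^ (2 - r))
      (Real.one_lt_rpow (by norm_num) (by linarith)) (x0 ^ (2 - r)) (by positivity)
      ((l / ‖b x‖) ^ (2 - r)) (fun i => x ∈ T i) ?_ (by positivity) m
    · have hp : ∀ i : ℕ, c i ^ (2 - r) = x0 ^ (2 - r) * (2 ^ (2 - r)) ^ i := fun i => by
        simp only [hc]
        rw [Real.mul_rpow hx0.le (by positivity), ← Real.rpow_natCast, ← Real.rpow_natCast,
          ← Real.rpow_mul (by norm_num), ← Real.rpow_mul (by norm_num), mul_comm (i:ℝ)]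
      have hq : ∀ i : ℕ, c i ^ (2 - r) * ‖(T i).indicator b x‖ ^ 2 =
          (if x ∈ T i then x0 ^ (2 - r) * (2 ^ (2 - r)) ^ i else 0) * ‖b x‖ ^ 2 := fun i => by
        rw [← hp]
        by_cases hx : x ∈ T i <;> simp [hx]
      simp_rw [hq, ← Finset.sum_mul]
      have hz : (l / ‖b x‖) ^ (2 - r) * ‖b x‖ ^ 2 = l ^ (2 - r) * ‖b x‖ ^ r := by
        rw [Real.div_rpow hl0.le hbx.le, div_mul_eq_mul_div, mul_div_assoc]
        congr 1
        rw [← Real.rpow_natCast, ← Real.rpow_sub hbx]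
        norm_num
      rw [← hz, ← mul_assoc]
      gcongr
    · intro i hi
      have : x0 ^ (2 - r) * (2 ^ (2 - r)) ^ i = (c i) ^ (2 - r) := by
        simp only [hc]
        rw [Real.mul_rpow hx0.le (by positivity), ← Real.rpow_natCast, ← Real.rpow_natCast,
          ← Real.rpow_mul (by norm_num), ← Real.rpow_mul (by norm_num), mul_comm (i:ℝ)]
      rw [this]
      have hci := hc0 i
      apply Real.rpow_le_rpow hci.le _ (by linarith)
      have hi' : ‖b x‖ ≤ l / c i := hi
      rw [le_div_iff₀ hci] at hi'
      rw [le_div_iff₀ hbx]; linarith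
  have hsum : ∑ i ∈ Finset.range m, ‖B ((S i).indicator a) b‖ ≤
      A * l ^ (1 - r) * M * N + (w * 2 ^ (2 - r) * M + w⁻¹ * (2 ^ (2 - r) / (2 ^ (2 - r) - 1) *
        (l ^ (2 - r) * N))) / 2 := by
    refine (Finset.sum_le_sum fun i _ => Ii i).trans ?_
    rw [Finset.sum_add_distrib, ← Finset.sum_mul, ← Finset.mul_sum, ← Finset.sum_div,
      Finset.sum_add_distrib, ← Finset.mul_sum, ← Finset.mul_sum]
    gcongr
  linarith

lemma interp {r : ℝ} (hr : 1 < r) (hr2 : r < 2) {B : (α → ℂ) → (α → ℂ) → ℂ} {A : ℝ}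
    (hA : 0 < A)
    (hl : ∀ a a' b, BddInt μ a → BddInt μ a' → BddInt μ b → B (a + a') b = B a b + B a' b)
    (hrr : ∀ a b b', BddInt μ a → BddInt μ b → BddInt μ b' → B a (b + b') = B a b + B a b')
    (h1 : ∀ a b, BddInt μ a → BddInt μ b → ‖B a b‖ ≤ A * (∫ x, ‖a x‖ ∂μ) * ∫ x, ‖b x‖ ∂μ)
    (h2 : ∀ a b, BddInt μ a → BddInt μ b →
      ‖B a b‖ ≤ √(∫ x, ‖a x‖ ^ 2 ∂μ) * √(∫ x, ‖b x‖ ^ 2 ∂μ))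
    {a b : α → ℂ} (ha : BddInt μ a) (hb : BddInt μ b) :
    ‖B a b‖ ≤ (1 + (2 ^ (2 - r) + 2 ^ (2 - r) / (2 ^ (2 - r) - 1)) / 2) * A ^ (2 / r - 1) *
      (∫ x, ‖a x‖ ^ r ∂μ) ^ (1 / r) * (∫ x, ‖b x‖ ^ r ∂μ) ^ (1 / r) := by
  set M := ∫ x, ‖a x‖ ^ r ∂μ with hM
  set N := ∫ x, ‖b x‖ ^ r ∂μ with hN
  have hM0 : 0 ≤ M := integral_nonneg fun x => by positivity
  have hN0 : 0 ≤ N := integral_nonneg fun x => by positivity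
  have h1r : 1 < (2:ℝ) ^ (2 - r) := Real.one_lt_rpow (by norm_num) (by linarith)
  have zero : ∀ a : α → ℂ, BddInt μ a → ∫ x, ‖a x‖ ^ r ∂μ = 0 → ∫ x, ‖a x‖ ∂μ = 0 := by
    intro a ha h
    obtain ⟨q1, q2, K, q3⟩ := ha
    rw [integral_eq_zero_iff_of_nonneg (fun x => by positivity)
      (integrable_norm_rpow_of_bdd q1 q2 q3 hr.le)] at h
    rw [← integral_zero α ℝ]
    apply integral_congr_ae
    filter_upwards [h] with x hx
    simp only [Pi.zero_apply] at hx
    rwa [Real.rpow_eq_zero (norm_nonneg _) (by linarith)] at hx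
  have hpos : 0 ≤ (1 + (2 ^ (2 - r) + 2 ^ (2 - r) / (2 ^ (2 - r) - 1)) / 2) * A ^ (2 / r - 1) *
      M ^ (1 / r) * N ^ (1 / r) := by
    have : 0 < (2:ℝ) ^ (2 - r) - 1 := by linarith
    positivity
  rcases hM0.eq_or_lt with h | hMp
  · refine (h1 a b ha hb).trans ?_
    rw [zero a ha h.symm]
    simpa using hpos
  rcases hN0.eq_or_lt with h | hNp
  · refine (h1 a b ha hb).trans ?_
    rw [zero b hb h.symm]
    simpa using hpos
  set l : ℝ := (A ^ 2 * (M * N)) ^ (1 / r) with hl'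
  have hl0 : 0 < l := by positivity
  set w : ℝ := l ^ ((2 - r) / 2) * (N / M) ^ ((1:ℝ) / 2) with hw'
  have hw0 : 0 < w := by positivity
  have lim := fun x0 hx0 => interp_aux hr hr2 hA hl hrr h1 h2 ha hb hl0 hw0 (x0 := x0) hx0
  rw [← hM, ← hN] at lim
  have t1 : Filter.Tendsto (fun x0 : ℝ => A * l ^ (1 - r) * M * N
      + (w * 2 ^ (2 - r) * M + w⁻¹ * (2 ^ (2 - r) / (2 ^ (2 - r) - 1) *
        (l ^ (2 - r) * N))) / 2
      + √(x0 ^ (2 - r) * M) * √(∫ x, ‖b x‖ ^ 2 ∂μ)) (nhdsWithin 0 (Ioi 0))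
      (nhds (A * l ^ (1 - r) * M * N
      + (w * 2 ^ (2 - r) * M + w⁻¹ * (2 ^ (2 - r) / (2 ^ (2 - r) - 1) *
        (l ^ (2 - r) * N))) / 2
      + √((0:ℝ) ^ (2 - r) * M) * √(∫ x, ‖b x‖ ^ 2 ∂μ))) := by
    apply Filter.Tendsto.mono_left _ nhdsWithin_le_nhds
    have : Continuous fun x0 : ℝ => x0 ^ (2 - r) := Real.continuous_rpow_const (by linarith)
    exact Continuous.tendsto (by fun_prop) 0
  have t2 := ge_of_tendsto t1 (Filter.eventually_of_mem self_mem_nhdsWithin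
    (fun x0 hx0 => lim x0 hx0))
  rw [Real.zero_rpow (by linarith : 2 - r ≠ 0), zero_mul, Real.sqrt_zero, zero_mul, add_zero] at t2
  refine t2.trans (le_of_eq ?_)
  set X := A ^ (2 / r - 1) * M ^ (1 / r) * N ^ (1 / r) with hX
  have hr0 : (0:ℝ) < r := by linarith
  have lp : ∀ e : ℝ, l ^ e = A ^ (2 * (e / r)) * M ^ (e / r) * N ^ (e / r) := by
    intro e
    rw [hl', ← Real.rpow_mul (by positivity), show 1 / r * e = e / r by ring,
      Real.mul_rpow (by positivity) (by positivity), Real.mul_rpow hMp.le hNp.le,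
      ← Real.rpow_natCast, ← Real.rpow_mul hA.le]
    push_cast; ring
  have i1 : 1 + 2 * ((1 - r) / r) = 2 / r - 1 := by field_simp; ring
  have i2 : (1 - r) / r + 1 = 1 / r := by field_simp; ring
  have i4 : 2 * ((2 - r) / 2 / r) = 2 / r - 1 := by field_simp
  have i5 : (2 - r) / 2 / r + -(1 / 2) + 1 = 1 / r := by field_simp; ring
  have i6 : (2 - r) / 2 / r + 1 / 2 = 1 / r := by field_simp; ring
  have q1 : A * l ^ (1 - r) * M * N = X := by
    rw [lp, hX]
    calc _ = (A ^ (1:ℝ) * A ^ (2 * ((1 - r) / r))) * (M ^ ((1 - r) / r) * M ^ (1:ℝ)) *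
          (N ^ ((1 - r) / r) * N ^ (1:ℝ)) := by simp only [Real.rpow_one]; ring
      _ = _ := by
        rw [← Real.rpow_add hA, ← Real.rpow_add hMp, ← Real.rpow_add hNp, i1, i2]
  have q2 : w * M = X := by
    rw [hw', lp, hX, Real.div_rpow hNp.le hMp.le,
      div_eq_mul_inv (N ^ _), ← Real.rpow_neg hMp.le]
    calc _ = A ^ (2 * ((2 - r) / 2 / r)) * (M ^ ((2 - r) / 2 / r) * M ^ (-((1:ℝ) / 2)) * M ^ (1:ℝ)) *
          (N ^ ((2 - r) / 2 / r) * N ^ ((1:ℝ) / 2)) := by simp only [Real.rpow_one]; ring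
      _ = _ := by
        rw [← Real.rpow_add hMp, ← Real.rpow_add hMp, ← Real.rpow_add hNp, i4, i5, i6]
  have q3 : w⁻¹ * (l ^ (2 - r) * N) = X := by
    have e2 : w * w * M = l ^ (2 - r) * N := by
      rw [hw']
      calc _ = (l ^ ((2 - r) / 2) * l ^ ((2 - r) / 2)) *
            ((N / M) ^ ((1:ℝ) / 2) * (N / M) ^ ((1:ℝ) / 2)) * M := by ring
        _ = _ := by
          rw [← Real.rpow_add hl0, ← Real.rpow_add (by positivity)]
          norm_num
          field_simp
    rw [← e2, ← q2]; field_simp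
  have e3 : A * l ^ (1 - r) * M * N + (w * 2 ^ (2 - r) * M + w⁻¹ * (2 ^ (2 - r) /
      (2 ^ (2 - r) - 1) * (l ^ (2 - r) * N))) / 2
      = A * l ^ (1 - r) * M * N + (2 ^ (2 - r) * (w * M) + (2 ^ (2 - r) /
      (2 ^ (2 - r) - 1)) * (w⁻¹ * (l ^ (2 - r) * N))) / 2 := by ring
  rw [e3, q1, q2, q3, hX]
  ring
end

lemma integrableOn_pow_mul_exp_neg (n : ℕ) {b : ℝ} (hb : 0 < b) :
    IntegrableOn (fun r : ℝ => r ^ n * Real.exp (-b * r)) (Ioi 0) := by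
  have := integrableOn_rpow_mul_exp_neg_mul_rpow (p := 1) (s := n) (b := b)
    (by have : (0:ℝ) ≤ n := n.cast_nonneg
        linarith) one_pos hb
  simpa using this

abbrev E2 := EuclideanSpace ℝ (Fin 2)

lemma planar_integral {c : ℂ} (hc : 0 < c.re) {a : ℝ} (ha : a ≠ 0) :
    ∫ v : E2, Complex.exp (-c * (√(a ^ 2 + ‖v‖ ^ 2) : ℝ)) =
      2 * (volume.real (ball (0 : E2) 1)) * ((|a| / c + 1 / c ^ 2) * Complex.exp (-c * |a|)) := by
  have h := integral_fun_norm_addHaar (volume : Measure E2)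
    (fun r : ℝ => Complex.exp (-c * (√(a ^ 2 + r ^ 2) : ℝ)))
  simp only [finrank_euclideanSpace, Fintype.card_fin] at h
  rw [h]
  have hc0 : c ≠ 0 := by rintro rfl; simp at hc
  have key : ∫ y in Ioi (0:ℝ), y ^ (2 - 1) • Complex.exp (-c * (√(a ^ 2 + y ^ 2) : ℝ)) =
      0 - (-((√(a ^ 2 + (0:ℝ) ^ 2) : ℝ) / c + 1 / c ^ 2) *
        Complex.exp (-c * (√(a ^ 2 + (0:ℝ) ^ 2) : ℝ))) := by
    apply integral_Ioi_of_hasDerivAt_of_tendsto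
      (f := fun y : ℝ => -((√(a ^ 2 + y ^ 2) : ℝ) / c + 1 / c ^ 2) *
        Complex.exp (-c * (√(a ^ 2 + y ^ 2) : ℝ)))
    · apply Continuous.continuousWithinAt
      fun_prop
    · intro y _
      have hr0 : 0 < a ^ 2 + y ^ 2 := by positivity
      have h1 : HasDerivAt (fun y : ℝ => √(a ^ 2 + y ^ 2)) (y / √(a ^ 2 + y ^ 2)) y := by
        have h0 : HasDerivAt (fun y : ℝ => a ^ 2 + y ^ 2) (2 * y) y := by
          simpa using (hasDerivAt_pow 2 y).const_add (a ^ 2)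
        refine (h0.sqrt hr0.ne').congr_deriv ?_
        field_simp
      have h2 := h1.ofReal_comp
      set r := √(a ^ 2 + y ^ 2) with hr
      have hrp : 0 < r := Real.sqrt_pos.2 hr0
      have hrc : (r : ℂ) ≠ 0 := by exact_mod_cast hrp.ne'
      have h3 : HasDerivAt (fun y : ℝ => -((√(a ^ 2 + y ^ 2) : ℝ) / c + 1 / c ^ 2) *
          Complex.exp (-c * (√(a ^ 2 + y ^ 2) : ℝ))) _ y :=
        (((h2.div_const c).add_const (1 / c ^ 2)).fun_neg).fun_mul ((h2.const_mul (-c)).cexp)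
      refine h3.congr_deriv ?_
      simp only [pow_one, Complex.real_smul, Nat.add_one_sub_one]
      rw [← hr]
      push_cast
      field_simp
      ring
    · refine Integrable.mono' (integrableOn_pow_mul_exp_neg 1 hc)
        (by fun_prop) ?_
      filter_upwards [ae_restrict_mem measurableSet_Ioi] with y hy
      have hy' : (0:ℝ) < y := hy
      rw [norm_smul, Complex.norm_exp]
      simp only [Nat.add_one_sub_one, pow_one, Real.norm_eq_abs, abs_of_pos hy']
      gcongr
      have : y ≤ √(a ^ 2 + y ^ 2) := by
        apply Real.le_sqrt_of_sq_le; nlinarith [sq_nonneg a]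
      simp
      gcongr
    · have ht : Filter.Tendsto (fun y : ℝ => √(a ^ 2 + y ^ 2)) Filter.atTop Filter.atTop := by
        apply Filter.tendsto_atTop_mono (f := fun y => y) _ Filter.tendsto_id
        intro y
        apply Real.le_sqrt_of_sq_le; nlinarith [sq_nonneg a]
      have hs : Filter.Tendsto (fun r : ℝ => -((r : ℂ) / c + 1 / c ^ 2) * Complex.exp (-c * r))
          Filter.atTop (nhds 0) := by
        rw [tendsto_zero_iff_norm_tendsto_zero]
        have e0 : Filter.Tendsto (fun r : ℝ => c.re * r) Filter.atTop Filter.atTop :=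
          Filter.Tendsto.const_mul_atTop hc Filter.tendsto_id
        have e1 := (Real.tendsto_pow_mul_exp_neg_atTop_nhds_zero 1).comp e0
        have e2 := (Real.tendsto_pow_mul_exp_neg_atTop_nhds_zero 0).comp e0
        have e3 := (e1.const_mul (1 / (c.re * ‖c‖))).add (e2.const_mul (1 / ‖c‖ ^ 2))
        simp only [mul_zero, add_zero] at e3
        refine squeeze_zero' (Filter.Eventually.of_forall fun r => norm_nonneg _) ?_ e3
        filter_upwards [Filter.eventually_ge_atTop 0] with r hr
        rw [norm_mul, norm_neg, Complex.norm_exp]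
        have : (-c * (r:ℂ)).re = -(c.re * r) := by simp
        rw [this]
        have h9 : ‖(r:ℂ) / c + 1 / c ^ 2‖ ≤ r / ‖c‖ + 1 / ‖c‖ ^ 2 := by
          refine (norm_add_le _ _).trans (le_of_eq ?_)
          simp [abs_of_nonneg hr]
        refine (mul_le_mul_of_nonneg_right h9 (Real.exp_nonneg _)).trans (le_of_eq ?_)
        simp only [Function.comp_apply]
        have : ‖c‖ ≠ 0 := norm_ne_zero_iff.2 hc0
        field_simp
      exact hs.comp ht
  rw [key]
  have : √(a ^ 2 + 0 ^ 2) = |a| := by simp [Real.sqrt_sq_eq_abs]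
  rw [this]
  simp
  ring

lemma integrable_exp_norm {c : ℂ} (hc : 0 < c.re) :
    Integrable (fun ξ : E3 => Complex.exp (-c * (‖ξ‖ : ℝ))) := by
  rw [integrable_fun_norm_addHaar (volume : Measure E3)
    (f := fun r : ℝ => Complex.exp (-c * (r : ℝ)))]
  simp only [finrank_euclideanSpace, Fintype.card_fin]
  refine Integrable.mono' (integrableOn_pow_mul_exp_neg 2 hc) (by fun_prop) ?_
  filter_upwards [ae_restrict_mem measurableSet_Ioi] with y hy
  rw [norm_smul, Complex.norm_exp]
  simp

/-- Splitting off the first coordinate. -/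
def splitE3 (p : ℝ × E2) : E3 :=
  WithLp.toLp 2 ((MeasurableEquiv.piFinSuccAbove (fun _ => ℝ) (0 : Fin 3)).symm
    (p.1, WithLp.ofLp p.2))

lemma norm_splitE3 (p : ℝ × E2) : ‖splitE3 p‖ = √(p.1 ^ 2 + ‖p.2‖ ^ 2) := by
  rw [splitE3, EuclideanSpace.norm_eq, EuclideanSpace.norm_eq, Real.sq_sqrt (by positivity),
    Fin.sum_univ_succ]
  simp [MeasurableEquiv.piFinSuccAbove]

lemma splitE3_zero (p : ℝ × E2) : splitE3 p 0 = p.1 := by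
  simp [splitE3, MeasurableEquiv.piFinSuccAbove]

lemma measurePreserving_splitE3 : MeasurePreserving splitE3 volume volume := by
  have h1 := (volume_preserving_piFinSuccAbove (fun _ : Fin 3 => ℝ) 0).symm
  have h2 := PiLp.volume_preserving_toLp (Fin 3)
  have h3 := (MeasurePreserving.id (volume : Measure ℝ)).prod (PiLp.volume_preserving_ofLp (Fin 2))
  exact h2.comp (h1.comp h3)

lemma measurableEmbedding_splitE3 : MeasurableEmbedding splitE3 := by
  have h1 := (MeasurableEquiv.piFinSuccAbove (fun _ : Fin 3 => ℝ) 0).symm.measurableEmbedding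
  have h2 := (MeasurableEquiv.toLp 2 (Fin 3 → ℝ)).measurableEmbedding
  have h3 := ((MeasurableEquiv.refl ℝ).prodCongr
    (MeasurableEquiv.toLp 2 (Fin 2 → ℝ)).symm).measurableEmbedding
  exact h2.comp (h1.comp h3)

lemma norm_fourierInv_exp_le {c : ℂ} (hc : 0 < c.re) (x : E3) :
    ‖𝓕⁻ (fun ξ : E3 => Complex.exp (-c * (‖ξ‖ : ℝ))) x‖ ≤
      8 * volume.real (ball (0 : E2) 1) / (‖c‖ * c.re ^ 2) := by
  set e : E3 := EuclideanSpace.single 0 ‖x‖ with he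
  have hn : ‖e‖ = ‖x‖ := by simp [he]
  have hrot : 𝓕⁻ (fun ξ : E3 => Complex.exp (-c * (‖ξ‖ : ℝ))) x =
      𝓕⁻ (fun ξ : E3 => Complex.exp (-c * (‖ξ‖ : ℝ))) e := by
    have := Real.fourierInv_comp_linearIsometry (Submodule.reflection (ℝ ∙ (e - x))ᗮ)
      (fun ξ : E3 => Complex.exp (-c * (‖ξ‖ : ℝ))) e
    rw [Submodule.reflection_sub hn] at this
    have hf : (fun ξ : E3 => Complex.exp (-c * (‖ξ‖ : ℝ))) ∘
        (Submodule.reflection (ℝ ∙ (e - x))ᗮ) = fun ξ : E3 => Complex.exp (-c * (‖ξ‖ : ℝ)) := by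
      funext ξ; simp
    rw [hf] at this
    exact this.symm
  have hi := integrable_exp_norm hc
  rw [hrot, Real.fourierInv_eq', ← measurePreserving_splitE3.integral_comp
    measurableEmbedding_splitE3]
  have hInt : Integrable (fun p : ℝ × E2 => Complex.exp ((2 * Real.pi * ⟪splitE3 p, e⟫ : ℝ) *
      Complex.I) • Complex.exp (-c * (‖splitE3 p‖ : ℝ))) (volume.prod volume) := by
    have h1 : Integrable (fun ξ : E3 => Complex.exp ((2 * Real.pi * ⟪ξ, e⟫ : ℝ) *
      Complex.I) • Complex.exp (-c * (‖ξ‖ : ℝ))) := by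
      refine hi.mono (by fun_prop) ?_
      filter_upwards with ξ
      rw [norm_smul, Complex.norm_exp_ofReal_mul_I, one_mul]
    exact (measurePreserving_splitE3.integrable_comp h1.aestronglyMeasurable).2 h1
  have e1 : ∫ p : ℝ × E2, Complex.exp ((2 * Real.pi * ⟪splitE3 p, e⟫ : ℝ) *
      Complex.I) • Complex.exp (-c * (‖splitE3 p‖ : ℝ)) = ∫ a : ℝ, Complex.exp ((2 * Real.pi *
        (‖x‖ * a) : ℝ) * Complex.I) * ∫ v : E2, Complex.exp (-c * (√(a ^ 2 + ‖v‖ ^ 2) : ℝ)) := by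
    rw [Measure.volume_eq_prod, integral_prod _ hInt]
    congr 1; ext a
    rw [← integral_const_mul]
    congr 1; ext v
    rw [norm_splitE3, he, EuclideanSpace.inner_single_right, splitE3_zero]
    simp
  rw [e1]
  set κ := volume.real (ball (0 : E2) 1) with hκ
  have hκ0 : 0 ≤ κ := measureReal_nonneg
  have hc0 : 0 < ‖c‖ := hc.trans_le (Complex.re_le_norm c)
  have hb1 : IntegrableOn (fun r : ℝ => 2 * κ * ((r / ‖c‖ + 1 / ‖c‖ ^ 2) *
      Real.exp (-c.re * r))) (Ioi 0) := by
    have h0 := (integrableOn_pow_mul_exp_neg 0 hc).const_mul (2 * κ / ‖c‖ ^ 2)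
    have h1 := (integrableOn_pow_mul_exp_neg 1 hc).const_mul (2 * κ / ‖c‖)
    refine IntegrableOn.congr_fun (Integrable.add h0 h1) (fun r _ => ?_) measurableSet_Ioi
    simp only [Pi.add_apply]
    field_simp
    ring
  have hb2 : Integrable (fun a : ℝ => (fun r : ℝ => 2 * κ * ((r / ‖c‖ + 1 / ‖c‖ ^ 2) *
      Real.exp (-c.re * r))) ‖a‖) := by
    rw [integrable_fun_norm_addHaar (volume : Measure ℝ)
      (f := fun r : ℝ => 2 * κ * ((r / ‖c‖ + 1 / ‖c‖ ^ 2) * Real.exp (-c.re * r)))]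
    simpa using hb1
  have hle : ∀ᵐ a : ℝ, ‖Complex.exp ((2 * Real.pi *
        (‖x‖ * a) : ℝ) * Complex.I) * ∫ v : E2, Complex.exp (-c * (√(a ^ 2 + ‖v‖ ^ 2) : ℝ))‖ ≤
      2 * κ * ((‖a‖ / ‖c‖ + 1 / ‖c‖ ^ 2) * Real.exp (-c.re * ‖a‖)) := by
    have : ∀ᵐ a : ℝ, a ≠ 0 := by simp [ae_iff]
    filter_upwards [this] with a ha
    rw [norm_mul, Complex.norm_exp_ofReal_mul_I, one_mul, planar_integral hc ha, norm_mul, norm_mul]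
    have h9 : ‖((|a| : ℝ):ℂ) / c + 1 / c ^ 2‖ ≤ |a| / ‖c‖ + 1 / ‖c‖ ^ 2 := by
      refine (norm_add_le _ _).trans (le_of_eq ?_)
      simp
    rw [norm_mul, Complex.norm_exp, ← hκ]
    have e3 : ‖(2:ℂ)‖ * ‖(κ:ℂ)‖ = 2 * κ := by simp [abs_of_nonneg hκ0]
    have e4 : (-c * (|a| : ℝ)).re = -c.re * ‖a‖ := by simp
    rw [e3, e4]
    gcongr
    exact h9
  refine (norm_integral_le_of_norm_le hb2 hle).trans ?_
  have e5 : ∫ a : ℝ, 2 * κ * ((‖a‖ / ‖c‖ + 1 / ‖c‖ ^ 2) * Real.exp (-c.re * ‖a‖)) =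
      2 * ∫ r in Ioi (0:ℝ), 2 * κ * ((r / ‖c‖ + 1 / ‖c‖ ^ 2) * Real.exp (-c.re * r)) :=
    integral_comp_abs (f := fun r => 2 * κ * ((r / ‖c‖ + 1 / ‖c‖ ^ 2) * Real.exp (-c.re * r)))
  rw [e5]
  have i0 := Real.integral_rpow_mul_exp_neg_mul_Ioi (a := 1) (r := c.re) one_pos hc
  have i1 := Real.integral_rpow_mul_exp_neg_mul_Ioi (a := 2) (r := c.re) two_pos hc
  have e6 : ∫ r in Ioi (0:ℝ), 2 * κ * ((r / ‖c‖ + 1 / ‖c‖ ^ 2) * Real.exp (-c.re * r)) =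
      2 * κ / ‖c‖ ^ 2 * (1 / c.re) + 2 * κ / ‖c‖ * (1 / c.re ^ 2) := by
    have h0 := (integrableOn_pow_mul_exp_neg 0 hc).const_mul (2 * κ / ‖c‖ ^ 2)
    have h1 := (integrableOn_pow_mul_exp_neg 1 hc).const_mul (2 * κ / ‖c‖)
    have : ∫ r in Ioi (0:ℝ), 2 * κ * ((r / ‖c‖ + 1 / ‖c‖ ^ 2) * Real.exp (-c.re * r)) =
      ∫ r in Ioi (0:ℝ), (2 * κ / ‖c‖ ^ 2 * (r ^ 0 * Real.exp (-c.re * r)) +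
        2 * κ / ‖c‖ * (r ^ 1 * Real.exp (-c.re * r))) := by
      congr 1; ext r; field_simp; ring
    rw [this, integral_add h0 h1, integral_const_mul, integral_const_mul]
    congr 2
    · simpa using i0
    · norm_num at i1; simpa [Real.Gamma_two] using i1
  rw [e6]
  have h7 : c.re ≤ ‖c‖ := Complex.re_le_norm c
  have h8 : 2 * κ / ‖c‖ ^ 2 * (1 / c.re) ≤ 2 * κ / (‖c‖ * c.re ^ 2) := by
    rw [div_mul_div_comm, mul_one]
    have h8' : ‖c‖ * c.re ^ 2 ≤ ‖c‖ ^ 2 * c.re := by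
      have := mul_pos hc0 hc
      nlinarith
    exact div_le_div_of_nonneg_left (by positivity) (by positivity) h8'
  have h9 : 2 * κ / ‖c‖ * (1 / c.re ^ 2) = 2 * κ / (‖c‖ * c.re ^ 2) := by
    rw [div_mul_div_comm, mul_one]
  rw [h9]
  have : 8 * κ / (‖c‖ * c.re ^ 2) = 4 * (2 * κ / (‖c‖ * c.re ^ 2)) := by ring
  linarith

lemma lintegral_comp_abs_le (f : ℝ → ℝ≥0∞) (hf : Measurable f) :
    ∫⁻ u : ℝ, f |u| = 2 * ∫⁻ u in Ioi (0:ℝ), f u := by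
  have h1 : ∫⁻ u in Ioi (0:ℝ), f |u| = ∫⁻ u in Ioi (0:ℝ), f u :=
    setLIntegral_congr_fun measurableSet_Ioi fun u hu => by simp only [abs_of_pos (mem_Ioi.1 hu)]
  have h2 : ∫⁻ u in Iic (0:ℝ), f |u| = ∫⁻ u in Ioi (0:ℝ), f u := by
    rw [← setLIntegral_congr (μ := volume) (Iio_ae_eq_Iic (a := (0:ℝ))), ← h1]
    have := (Measure.measurePreserving_neg (volume : Measure ℝ)).setLIntegral_comp_preimage
      (s := Iio (0:ℝ)) measurableSet_Iio (f := fun u => f |u|) (by fun_prop)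
    rw [← this]
    simp
  rw [← lintegral_add_compl _ (measurableSet_Ioi (a := (0:ℝ))), compl_Ioi, h1, h2, two_mul]

lemma lintegral_abs_rpow_near {α δ : ℝ} (hα1 : α < 1) (hδ : 0 < δ) :
    ∫⁻ u in {u : ℝ | |u| < δ}, ENNReal.ofReal |u| ^ (-α) =
      ENNReal.ofReal (2 * (δ ^ (1 - α) / (1 - α))) := by
  have hm : MeasurableSet {u : ℝ | |u| < δ} := measurableSet_lt (by fun_prop) measurable_const
  have h0 := lintegral_comp_abs_le
    ((Iio δ).indicator fun u => ENNReal.ofReal u ^ (-α))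
    (Measurable.indicator (by fun_prop) measurableSet_Iio)
  rw [← lintegral_indicator hm]
  have e : (fun u : ℝ => (Iio δ).indicator (fun u => ENNReal.ofReal u ^ (-α)) |u|) =
      {u : ℝ | |u| < δ}.indicator fun u => ENNReal.ofReal |u| ^ (-α) := by
    ext u; simp [indicator]
  rw [e] at h0
  rw [h0, lintegral_indicator measurableSet_Iio, Measure.restrict_restrict measurableSet_Iio,
    Iio_inter_Ioi]
  have h1 : ∫⁻ u in Ioo 0 δ, ENNReal.ofReal u ^ (-α) =
      ∫⁻ u in Ioc 0 δ, ENNReal.ofReal (u ^ (-α)) := by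
    rw [← setLIntegral_congr (μ := volume) (Ioo_ae_eq_Ioc (a := (0:ℝ)) (b := δ))]
    exact setLIntegral_congr_fun measurableSet_Ioo fun u hu =>
      ENNReal.ofReal_rpow_of_pos hu.1
  have h2 : IntegrableOn (fun u : ℝ => u ^ (-α)) (Ioc 0 δ) :=
    (intervalIntegrable_iff_integrableOn_Ioc_of_le hδ.le).1
      (intervalIntegral.intervalIntegrable_rpow' (by linarith))
  rw [h1, ← ofReal_integral_eq_lintegral_ofReal h2 (by
      filter_upwards [ae_restrict_mem measurableSet_Ioc] with u hu
      exact Real.rpow_nonneg hu.1.le _), ← intervalIntegral.integral_of_le hδ.le,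
    integral_rpow (Or.inl (by linarith)), ENNReal.ofReal_mul (by norm_num)]
  rw [Real.zero_rpow (by linarith), neg_add_eq_sub, sub_zero]
  simp

lemma lintegral_abs_rpow_far {δ : ℝ} (hδ : 0 < δ) :
    ∫⁻ u in {u : ℝ | δ < |u|}, ENNReal.ofReal |u| ^ (-2 : ℝ) =
      ENNReal.ofReal (2 / δ) := by
  have hm : MeasurableSet {u : ℝ | δ < |u|} := measurableSet_lt measurable_const (by fun_prop)
  have h0 := lintegral_comp_abs_le
    ((Ioi δ).indicator fun u => ENNReal.ofReal u ^ (-2 : ℝ))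
    (Measurable.indicator (by fun_prop) measurableSet_Ioi)
  rw [← lintegral_indicator hm]
  have e : (fun u : ℝ => (Ioi δ).indicator (fun u => ENNReal.ofReal u ^ (-2 : ℝ)) |u|) =
      {u : ℝ | δ < |u|}.indicator fun u => ENNReal.ofReal |u| ^ (-2 : ℝ) := by
    ext u; simp [indicator]
  rw [e] at h0
  rw [h0, lintegral_indicator measurableSet_Ioi, Measure.restrict_restrict measurableSet_Ioi,
    inter_eq_left.2 (Ioi_subset_Ioi hδ.le)]
  have h1 : ∫⁻ u in Ioi δ, ENNReal.ofReal u ^ (-2 : ℝ) =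
      ∫⁻ u in Ioi δ, ENNReal.ofReal (u ^ (-2 : ℝ)) :=
    setLIntegral_congr_fun measurableSet_Ioi fun u hu =>
      ENNReal.ofReal_rpow_of_pos (hδ.trans hu)
  have h2 : IntegrableOn (fun u : ℝ => u ^ (-2 : ℝ)) (Ioi δ) :=
    integrableOn_Ioi_rpow_of_lt (by norm_num) hδ
  rw [h1, ← ofReal_integral_eq_lintegral_ofReal h2 (by
      filter_upwards [ae_restrict_mem measurableSet_Ioi] with u hu
      exact Real.rpow_nonneg (hδ.trans hu).le _),
    integral_Ioi_rpow_of_lt (by norm_num) hδ]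
  norm_num
  rw [Real.rpow_neg_one, show 2 / δ = 2 * δ⁻¹ by ring, ENNReal.ofReal_mul (by norm_num)]
  simp

lemma hls_real {p p' v i δ : ℝ} (hp : 2 < p) (hpp : p.HolderConjugate p') (hv : 0 < v) (hi : 0 < i)
    (hδ : δ = i * v ^ (-p')) :
    v * (v * (2 * (δ ^ (1 - 2 / p) / (1 - 2 / p))) + (2 / δ) ^ (1 / p) * i ^ (1 / p')) =
      (2 / (1 - 2 / p) + 2 ^ (1 / p)) * (i ^ (1 - 2 / p) * v ^ p') := by
  have hp0 : p ≠ 0 := by linarith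
  have hp'0 : p' ≠ 0 := hpp.symm.ne_zero
  have hc : 1 / p + 1 / p' = 1 := by simpa using hpp.inv_add_inv_eq_one
  have hc2 : p + p' = p * p' := by field_simp at hc; linarith
  have e1 : δ ^ (1 - 2 / p) = i ^ (1 - 2 / p) * v ^ (-p' * (1 - 2 / p)) := by
    rw [hδ, Real.mul_rpow hi.le (by positivity), ← Real.rpow_mul hv.le]
  have e2 : (2 / δ) ^ (1 / p) = 2 ^ (1 / p) * i ^ (-(1 / p)) * v ^ (p' / p) := by
    have : 2 / δ = 2 * (i ^ (-1 : ℝ) * v ^ p') := by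
      rw [hδ, Real.rpow_neg hv.le, Real.rpow_neg_one]; field_simp
    rw [this, Real.mul_rpow (by norm_num) (by positivity), Real.mul_rpow (by positivity)
      (by positivity), ← Real.rpow_mul hi.le, ← Real.rpow_mul hv.le]
    ring_nf
  have e3 : v * (v * v ^ (-p' * (1 - 2 / p))) = v ^ p' := by
    nth_rewrite 1 [← Real.rpow_one v]
    nth_rewrite 2 [← Real.rpow_one v]
    rw [← Real.rpow_add hv, ← Real.rpow_add hv]
    congr 1; field_simp; linarith
  have e4 : v * v ^ (p' / p) = v ^ p' := by
    nth_rewrite 1 [← Real.rpow_one v]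
    rw [← Real.rpow_add hv]
    congr 1; field_simp; linarith
  have e5 : i ^ (-(1 / p)) * i ^ (1 / p') = i ^ (1 - 2 / p) := by
    rw [← Real.rpow_add hi]; congr 1; linear_combination hc
  rw [e1, e2]
  calc _ = 2 / (1 - 2 / p) * (i ^ (1 - 2 / p) * (v * (v * v ^ (-p' * (1 - 2 / p))))) +
      2 ^ (1 / p) * ((i ^ (-(1 / p)) * i ^ (1 / p')) * (v * v ^ (p' / p))) := by ring
    _ = _ := by rw [e3, e4, e5]; ring

lemma hls_pointwise {p p' : ℝ} (hp : 2 < p) (hpp : p.HolderConjugate p') {φ : ℝ → ℝ≥0∞}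
    (hφ : Measurable φ) (h0 : ∫⁻ t, φ t ^ p' ≠ 0) (hT : ∫⁻ t, φ t ^ p' ≠ ∞) {t : ℝ}
    (ht : φ t ≠ ∞) :
    φ t * ∫⁻ s in {s | φ s ≤ φ t}, ENNReal.ofReal |t - s| ^ (-(2 / p)) * φ s ≤
      ENNReal.ofReal (2 / (1 - 2 / p) + 2 ^ (1 / p)) *
        ((∫⁻ t, φ t ^ p') ^ (1 - 2 / p) * φ t ^ p') := by
  rcases eq_or_ne (φ t) 0 with hz | hz
  · simp [hz]
  set I := ∫⁻ t, φ t ^ p' with hI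
  have hi : 0 < I.toReal := ENNReal.toReal_pos h0 hT
  have hv : 0 < (φ t).toReal := ENNReal.toReal_pos hz ht
  have h2p : 2 / p < 1 := by rw [div_lt_one (by linarith)]; exact hp
  have h2p0 : 0 < 2 / p := by positivity
  have h2p1 : 0 < 1 - 2 / p := by linarith
  obtain ⟨δ, hδ⟩ : ∃ δ, δ = I.toReal * (φ t).toReal ^ (-p') := ⟨_, rfl⟩
  have hδ0 : 0 < δ := by rw [hδ]; positivity
  have key := hls_real hp hpp hv hi hδ
  have hmp := (Measure.measurePreserving_sub_left (volume : Measure ℝ) t)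
  have hmn : MeasurableSet {u : ℝ | |u| < δ} := measurableSet_lt (by fun_prop) measurable_const
  have hmf : MeasurableSet {u : ℝ | δ < |u|} := measurableSet_lt measurable_const (by fun_prop)
  have hml : MeasurableSet {s | φ s ≤ φ t} := measurableSet_le hφ measurable_const
  have hae : ∀ᵐ s : ℝ, s ≠ t - δ ∧ s ≠ t + δ := by
    have h1 : ∀ᵐ s : ℝ, s ≠ t - δ := by simp [ae_iff]
    have h2 : ∀ᵐ s : ℝ, s ≠ t + δ := by simp [ae_iff]
    filter_upwards [h1, h2] with s a b using ⟨a, b⟩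
  have hsplit : ∫⁻ s in {s | φ s ≤ φ t}, ENNReal.ofReal |t - s| ^ (-(2 / p)) * φ s ≤
      (∫⁻ s, {u : ℝ | |u| < δ}.indicator (fun u => ENNReal.ofReal |u| ^ (-(2 / p))) (t - s) * φ t) +
      ∫⁻ s, {u : ℝ | δ < |u|}.indicator (fun u => ENNReal.ofReal |u| ^ (-(2 / p))) (t - s) * φ s := by
    rw [← lintegral_indicator hml, ← lintegral_add_left]
    · refine lintegral_mono_ae ?_
      filter_upwards [hae] with s hs
      by_cases hs1 : φ s ≤ φ t
      · rw [indicator_of_mem (by exact hs1)]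
        rcases lt_trichotomy |t - s| δ with h | h | h
        · rw [indicator_of_mem (by exact h)]
          exact le_add_right (by gcongr)
        · exfalso
          rcases abs_eq hδ0.le |>.1 h with h | h
          · exact hs.1 (by linarith)
          · exact hs.2 (by linarith)
        · rw [indicator_of_mem (s := {u : ℝ | δ < |u|}) (by exact h)]
          exact le_add_left le_rfl
      · rw [indicator_of_notMem (by exact hs1)]; exact zero_le
    · refine Measurable.mul_const ?_ _
      exact (Measurable.indicator (by fun_prop) hmn).comp (by fun_prop)
  have hnear : ∫⁻ s, {u : ℝ | |u| < δ}.indicator (fun u => ENNReal.ofReal |u| ^ (-(2 / p)))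
      (t - s) * φ t = ENNReal.ofReal ((φ t).toReal * (2 * (δ ^ (1 - 2 / p) / (1 - 2 / p)))) := by
    have hmg : Measurable fun s : ℝ => {u : ℝ | |u| < δ}.indicator
        (fun u => ENNReal.ofReal |u| ^ (-(2 / p))) (t - s) :=
      (Measurable.indicator (by fun_prop) hmn).comp (by fun_prop : Measurable fun s : ℝ => t - s)
    rw [lintegral_mul_const _ hmg, hmp.lintegral_comp (f := {u : ℝ | |u| < δ}.indicator
        (fun u => ENNReal.ofReal |u| ^ (-(2 / p)))) (Measurable.indicator (by fun_prop) hmn),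
      lintegral_indicator hmn, lintegral_abs_rpow_near h2p hδ0, mul_comm,
      ENNReal.ofReal_mul hv.le, ENNReal.ofReal_toReal ht]
  have hfar : ∫⁻ s, {u : ℝ | δ < |u|}.indicator (fun u => ENNReal.ofReal |u| ^ (-(2 / p)))
      (t - s) * φ s ≤ ENNReal.ofReal ((2 / δ) ^ (1 / p) * I.toReal ^ (1 / p')) := by
    refine (ENNReal.lintegral_mul_le_Lp_mul_Lq volume hpp
      ((Measurable.indicator (by fun_prop) hmf).comp (by fun_prop)).aemeasurable
      hφ.aemeasurable).trans (le_of_eq ?_)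
    rw [ENNReal.ofReal_mul (by positivity), ← ENNReal.ofReal_rpow_of_pos (by positivity),
      ← ENNReal.ofReal_rpow_of_pos hi, ENNReal.ofReal_toReal hT, ← lintegral_abs_rpow_far hδ0,
      ← lintegral_indicator hmf, ← hmp.lintegral_comp (Measurable.indicator (by fun_prop) hmf)]
    congr 3
    ext s
    rw [Function.comp_apply]
    by_cases h : δ < |t - s|
    · rw [indicator_of_mem (by exact h), indicator_of_mem (by exact h), ← ENNReal.rpow_mul]
      congr 1; field_simp
    · rw [indicator_of_notMem (by exact h), indicator_of_notMem (by exact h),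
        ENNReal.zero_rpow_of_pos (by linarith)]
  calc _ ≤ φ t * (ENNReal.ofReal ((φ t).toReal * (2 * (δ ^ (1 - 2 / p) / (1 - 2 / p)))) +
        ENNReal.ofReal ((2 / δ) ^ (1 / p) * I.toReal ^ (1 / p'))) := by
        gcongr
        exact hsplit.trans (add_le_add hnear.le hfar)
    _ = ENNReal.ofReal ((φ t).toReal * ((φ t).toReal * (2 * (δ ^ (1 - 2 / p) / (1 - 2 / p)))
        + (2 / δ) ^ (1 / p) * I.toReal ^ (1 / p'))) := by
        rw [ENNReal.ofReal_mul (p := (φ t).toReal) (q := _ + _) hv.le,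
          ENNReal.ofReal_toReal ht, ENNReal.ofReal_add (by positivity) (by positivity)]
    _ = _ := by
        rw [key, ENNReal.ofReal_mul (by positivity), ENNReal.ofReal_mul (by positivity),
          ← ENNReal.ofReal_rpow_of_pos hi, ← ENNReal.ofReal_rpow_of_pos hv,
          ENNReal.ofReal_toReal hT, ENNReal.ofReal_toReal ht]

theorem hls {p p' : ℝ} (hp : 2 < p) (hpp : p.HolderConjugate p') {φ : ℝ → ℝ≥0∞}
    (hφ : Measurable φ) :
    ∫⁻ t, ∫⁻ s, ENNReal.ofReal |t - s| ^ (-(2 / p)) * φ s * φ t ≤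
      2 * ENNReal.ofReal (2 / (1 - 2 / p) + 2 ^ (1 / p)) * (∫⁻ t, φ t ^ p') ^ (2 / p') := by
  have hp'0 : 0 < p' := hpp.symm.pos
  have h2p : 2 / p < 1 := by rw [div_lt_one (by linarith)]; exact hp
  have hexp : 1 - 2 / p + 1 = 2 / p' := by
    have : 1 / p + 1 / p' = 1 := by simpa using hpp.inv_add_inv_eq_one
    linear_combination (-2) * this
  set k : ℝ → ℝ → ℝ≥0∞ := fun t s => ENNReal.ofReal |t - s| ^ (-(2 / p)) with hk
  rcases eq_or_ne (∫⁻ t, φ t ^ p') 0 with h0 | h0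
  · rw [lintegral_eq_zero_iff (by fun_prop)] at h0
    have hz : ∀ᵐ t, φ t = 0 := by
      filter_upwards [h0] with t ht
      simpa [ENNReal.rpow_eq_zero_iff, hp'0, hp'0.not_gt] using ht
    have : ∫⁻ t, ∫⁻ s, ENNReal.ofReal |t - s| ^ (-(2 / p)) * φ s * φ t = 0 := by
      rw [← lintegral_zero (μ := (volume : Measure ℝ))]
      refine lintegral_congr_ae ?_
      filter_upwards [hz] with t ht
      simp [ht]
    rw [this]; exact zero_le
  rcases eq_or_ne (∫⁻ t, φ t ^ p') ∞ with hT | hT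
  · rw [hT, ENNReal.top_rpow_of_pos (by positivity), ENNReal.mul_top]
    · exact le_top
    · have : 0 < 2 / (1 - 2 / p) + 2 ^ (1 / p) := by
        have : 0 < 1 - 2 / p := by linarith
        positivity
      simpa using this
  have hfin : ∀ᵐ t, φ t ≠ ∞ := by
    filter_upwards [ae_lt_top (by fun_prop) hT] with t ht h
    rw [h, ENNReal.top_rpow_of_pos hp'0] at ht
    exact lt_irrefl _ ht
  have hk_meas : Measurable (fun z : ℝ × ℝ => k z.1 z.2 * φ z.2 * φ z.1) := by
    simp only [hk]; fun_prop
  have hsym : ∀ t s, k t s = k s t := fun t s => by simp only [hk]; rw [abs_sub_comm]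
  have hS : MeasurableSet {z : ℝ × ℝ | φ z.2 ≤ φ z.1} :=
    measurableSet_le (by fun_prop) (by fun_prop)
  set H : ℝ × ℝ → ℝ≥0∞ :=
    {z : ℝ × ℝ | φ z.2 ≤ φ z.1}.indicator fun z => k z.1 z.2 * φ z.2 * φ z.1 with hH
  have hHm : Measurable H := hk_meas.indicator hS
  have hle : ∀ t s, k t s * φ s * φ t ≤ H (t, s) + H (s, t) := by
    intro t s
    rcases le_total (φ s) (φ t) with h | h
    · refine le_add_right ?_
      rw [hH, indicator_of_mem (by exact h)]
    · refine le_add_left ?_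
      rw [hH, indicator_of_mem (by exact h)]
      dsimp only
      rw [hsym t s, mul_right_comm]
  have h1 : ∫⁻ t, ∫⁻ s, H (t, s) ≤
      ENNReal.ofReal (2 / (1 - 2 / p) + 2 ^ (1 / p)) * (∫⁻ t, φ t ^ p') ^ (2 / p') := by
    calc ∫⁻ t, ∫⁻ s, H (t, s) ≤ ∫⁻ t, ENNReal.ofReal (2 / (1 - 2 / p) + 2 ^ (1 / p)) *
        ((∫⁻ t, φ t ^ p') ^ (1 - 2 / p) * φ t ^ p') := by
          refine lintegral_mono_ae ?_
          filter_upwards [hfin] with t ht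
          refine le_trans (le_of_eq ?_) (hls_pointwise hp hpp hφ h0 hT ht)
          rw [← lintegral_const_mul _ (by fun_prop), ← lintegral_indicator
            (measurableSet_le hφ measurable_const)]
          congr 1; ext s
          simp only [hH, hk, indicator, mem_ofPred_eq]
          split_ifs
          · ring
          · rfl
      _ = _ := by
          rw [lintegral_const_mul _ (by fun_prop), lintegral_const_mul _ (by fun_prop)]
          nth_rewrite 2 [← ENNReal.rpow_one (∫⁻ t, φ t ^ p')]
          rw [← ENNReal.rpow_add _ _ h0 hT, hexp]
  calc _ ≤ ∫⁻ t, ∫⁻ s, (H (t, s) + H (s, t)) := by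
        gcongr with t s; exact hle t s
    _ = (∫⁻ t, ∫⁻ s, H (t, s)) + ∫⁻ t, ∫⁻ s, H (s, t) := by
        rw [← lintegral_add_left (by fun_prop)]
        congr 1; ext t
        rw [lintegral_add_left (by fun_prop)]
    _ = 2 * ∫⁻ t, ∫⁻ s, H (t, s) := by
        rw [lintegral_lintegral_swap (f := fun t s => H (s, t)) (by fun_prop), two_mul]
    _ ≤ _ := by rw [mul_assoc]; gcongr

section

open ComplexConjugate

lemma fourierInv_add3 {a b : E3 → ℂ} (ha : Integrable a) (hb : Integrable b) :
    𝓕⁻ (a + b) = 𝓕⁻ a + 𝓕⁻ b := by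
  have h2 : Continuous fun p : E3 × E3 => (-innerₗ E3) p.1 p.2 := by
    have : Continuous fun p : E3 × E3 => -⟪p.1, p.2⟫ := by fun_prop
    simpa using this
  exact VectorFourier.fourierIntegral_add Real.continuous_fourierChar h2 ha hb

lemma memLp_rpow_of_bdd {α : Type*} [MeasurableSpace α] {μ : Measure α} {a : α → ℂ}
    (h : BddInt μ a) {r : ℝ} (hr : 1 ≤ r) : MemLp a (ENNReal.ofReal r) μ := by
  obtain ⟨h1, h2, K, hK⟩ := h
  have h0 : ENNReal.ofReal r ≠ 0 := by simpa using (by linarith : 0 < r)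
  rw [← integrable_norm_rpow_iff h1.aestronglyMeasurable h0 ENNReal.ofReal_ne_top,
    ENNReal.toReal_ofReal (by linarith)]
  exact integrable_norm_rpow_of_bdd h1 h2 hK hr

lemma memLp_two_of_bdd {α : Type*} [MeasurableSpace α] {μ : Measure α} {a : α → ℂ}
    (h : BddInt μ a) : MemLp a 2 μ := by
  simpa using memLp_rpow_of_bdd h (r := 2) (by norm_num)

lemma norm_cexp_neg_mul_le {c : ℂ} (hc : 0 ≤ c.re) (ξ : E3) :
    ‖Complex.exp (-c * (‖ξ‖ : ℝ))‖ ≤ 1 := by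
  rw [Complex.norm_exp]
  simp only [Complex.mul_re, Complex.neg_re, Complex.ofReal_re, Complex.neg_im, Complex.ofReal_im,
    mul_zero, sub_zero]
  rw [Real.exp_le_one_iff]
  nlinarith [norm_nonneg ξ]

/-- The sesquilinear form of the damped half-wave multiplier. -/
def waveForm (c : ℂ) (a b : E3 → ℂ) : ℂ :=
  ∫ ξ, Complex.exp (-c * (‖ξ‖ : ℝ)) * 𝓕⁻ a ξ * conj (𝓕⁻ b ξ)

lemma integrable_waveForm {c : ℂ} (hc : 0 < c.re) {a b : E3 → ℂ} (ha : Integrable a)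
    (hb : Integrable b) :
    Integrable fun ξ => Complex.exp (-c * (‖ξ‖ : ℝ)) * 𝓕⁻ a ξ * conj (𝓕⁻ b ξ) := by
  have h1 := (integrable_exp_norm hc).mul_bdd (c := ∫ ξ, ‖a ξ‖)
    (continuous_fourierInv3 ha).aestronglyMeasurable (by filter_upwards with x; exact norm_fourierInv_le3 a x)
  refine h1.mul_bdd (c := ∫ ξ, ‖b ξ‖)
    (Complex.continuous_conj.comp (continuous_fourierInv3 hb)).aestronglyMeasurable ?_
  filter_upwards with x
  simpa using norm_fourierInv_le3 b x

lemma waveForm_add_left {c : ℂ} (hc : 0 < c.re) {a a' b : E3 → ℂ} (ha : Integrable a)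
    (ha' : Integrable a') (hb : Integrable b) :
    waveForm c (a + a') b = waveForm c a b + waveForm c a' b := by
  rw [waveForm, waveForm, waveForm, ← integral_add (integrable_waveForm hc ha hb)
    (integrable_waveForm hc ha' hb), fourierInv_add3 ha ha']
  congr 1; ext ξ; simp only [Pi.add_apply]; ring

lemma waveForm_add_right {c : ℂ} (hc : 0 < c.re) {a b b' : E3 → ℂ} (ha : Integrable a)
    (hb : Integrable b) (hb' : Integrable b') :
    waveForm c a (b + b') = waveForm c a b + waveForm c a b' := by
  rw [waveForm, waveForm, waveForm, ← integral_add (integrable_waveForm hc ha hb)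
    (integrable_waveForm hc ha hb'), fourierInv_add3 hb hb']
  congr 1; ext ξ; simp only [Pi.add_apply, map_add]; ring

lemma fourierInv_modulate (m : E3 → ℂ) (x y : E3) :
    𝓕⁻ (fun ξ => Complex.exp ((2 * Real.pi * ⟪ξ, -x⟫ : ℝ) * Complex.I) * m ξ) y =
      𝓕⁻ m (y - x) := by
  rw [Real.fourierInv_eq', Real.fourierInv_eq']
  congr 1; ext ξ
  rw [smul_eq_mul, smul_eq_mul, ← mul_assoc, ← Complex.exp_add]
  congr 2
  rw [inner_sub_right, inner_neg_right]
  push_cast; ring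

lemma norm_waveForm_le_L1 {c : ℂ} (hc : 0 < c.re) {a b : E3 → ℂ} (ha : Integrable a)
    (hb : Integrable b) :
    ‖waveForm c a b‖ ≤ 8 * volume.real (ball (0 : E2) 1) / (‖c‖ * c.re ^ 2) *
      (∫ x, ‖a x‖) * ∫ x, ‖b x‖ := by
  set D := 8 * volume.real (ball (0 : E2) 1) / (‖c‖ * c.re ^ 2) with hD
  have hm := integrable_exp_norm hc
  set k : E3 → ℂ := fun ξ => Complex.exp (-c * (‖ξ‖ : ℝ)) * conj (𝓕⁻ b ξ) with hk
  have hki : Integrable k := by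
    refine hm.mul_bdd (c := ∫ ξ, ‖b ξ‖)
      (Complex.continuous_conj.comp (continuous_fourierInv3 hb)).aestronglyMeasurable ?_
    filter_upwards with x
    simpa using norm_fourierInv_le3 b x
  have e1 : waveForm c a b = ∫ x, a x * 𝓕⁻ k x := by
    rw [← integral_fourierInv_mul ha hki, waveForm]
    congr 1; ext ξ; simp only [hk]; ring
  have hcc : 0 < (conj c).re := by simpa using hc
  have hkb : ∀ x, ‖𝓕⁻ k x‖ ≤ D * ∫ y, ‖b y‖ := by
    intro x
    set m : E3 → ℂ := fun ξ => Complex.exp ((2 * Real.pi * ⟪ξ, -x⟫ : ℝ) * Complex.I) *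
      Complex.exp (-(conj c) * (‖ξ‖ : ℝ)) with hmdef
    have hmi : Integrable m := by
      refine (integrable_exp_norm hcc).mono (by fun_prop) ?_
      filter_upwards with ξ
      rw [hmdef, norm_mul, Complex.norm_exp_ofReal_mul_I, one_mul]
    have e2 : 𝓕⁻ k x = conj (∫ y, 𝓕⁻ m y * b y) := by
      rw [integral_fourierInv_mul hmi hb, ← integral_conj, Real.fourierInv_eq']
      congr 1; ext ξ
      simp only [hk, hmdef, smul_eq_mul, map_mul, ← Complex.exp_conj, map_neg, Complex.conj_conj,
        Complex.conj_ofReal, Complex.conj_I, inner_neg_right]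
      push_cast
      ring_nf
    rw [e2, Complex.norm_conj, ← integral_const_mul]
    refine norm_integral_le_of_norm_le (hb.norm.const_mul _) ?_
    filter_upwards with y
    rw [norm_mul, hmdef, fourierInv_modulate]
    have := norm_fourierInv_exp_le hcc (y - x)
    rw [Complex.norm_conj, Complex.conj_re] at this
    exact mul_le_mul_of_nonneg_right this (norm_nonneg _)
  rw [e1, mul_right_comm, ← integral_const_mul]
  refine norm_integral_le_of_norm_le (ha.norm.const_mul _) ?_
  filter_upwards with x
  rw [norm_mul, mul_comm]
  exact mul_le_mul_of_nonneg_right (hkb x) (norm_nonneg _)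

lemma integral_norm_sq_fourierInv {a : E3 → ℂ} (ha : BddInt volume a) :
    ∫ x, ‖𝓕⁻ a x‖ ^ 2 = ∫ x, ‖a x‖ ^ 2 := by
  have := integral_fourierInv_mul_conj ha.2.1 (memLp_two_of_bdd ha) ha.2.1 (memLp_two_of_bdd ha)
  simp only [Complex.mul_conj'] at this
  exact_mod_cast this

lemma integral_norm_mul_norm_le {α : Type*} [MeasurableSpace α] {μ : Measure α} {f g : α → ℂ}
    (hf : MemLp f 2 μ) (hg : MemLp g 2 μ) :
    ∫ x, ‖f x‖ * ‖g x‖ ∂μ ≤ √(∫ x, ‖f x‖ ^ 2 ∂μ) * √(∫ x, ‖g x‖ ^ 2 ∂μ) := by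
  have := integral_mul_norm_le_Lp_mul_Lq (μ := μ) (f := f) (g := g) Real.HolderConjugate.two_two
    (by simpa using hf) (by simpa using hg)
  simpa [Real.sqrt_eq_rpow] using this

lemma norm_waveForm_le_L2 {c : ℂ} (hc : 0 < c.re) {a b : E3 → ℂ} (ha : BddInt volume a)
    (hb : BddInt volume b) :
    ‖waveForm c a b‖ ≤ √(∫ x, ‖a x‖ ^ 2) * √(∫ x, ‖b x‖ ^ 2) := by
  have h2a := memLp_fourierInv ha.2.1 (memLp_two_of_bdd ha)
  have h2b := memLp_fourierInv hb.2.1 (memLp_two_of_bdd hb)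
  rw [← integral_norm_sq_fourierInv ha, ← integral_norm_sq_fourierInv hb]
  refine le_trans ?_ (integral_norm_mul_norm_le h2a h2b)
  refine norm_integral_le_of_norm_le ?_ ?_
  · exact MemLp.integrable_mul (p := 2) (q := 2) h2a.norm h2b.norm
  · filter_upwards with ξ
    rw [norm_mul, norm_mul, Complex.norm_conj]
    gcongr
    exact mul_le_of_le_one_left (norm_nonneg _) (norm_cexp_neg_mul_le hc.le ξ)

lemma norm_waveForm_le {r : ℝ} (hr : 1 < r) (hr2 : r < 2) {c : ℂ} (hc : 0 < c.re) {a b : E3 → ℂ}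
    (ha : BddInt volume a) (hb : BddInt volume b) :
    ‖waveForm c a b‖ ≤ (1 + (2 ^ (2 - r) + 2 ^ (2 - r) / (2 ^ (2 - r) - 1)) / 2) *
      (8 * volume.real (ball (0 : E2) 1) / (‖c‖ * c.re ^ 2)) ^ (2 / r - 1) *
      (∫ x, ‖a x‖ ^ r) ^ (1 / r) * (∫ x, ‖b x‖ ^ r) ^ (1 / r) := by
  have hc0 : 0 < ‖c‖ := hc.trans_le (Complex.re_le_norm c)
  have hκ : 0 < volume.real (ball (0 : E2) 1) :=
    ENNReal.toReal_pos (measure_ball_pos _ _ one_pos).ne' measure_ball_lt_top.ne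
  refine interp hr hr2 (B := waveForm c) (by positivity)
    (fun a a' b h h' hb => waveForm_add_left hc h.2.1 h'.2.1 hb.2.1)
    (fun a b b' h hb hb' => waveForm_add_right hc h.2.1 hb.2.1 hb'.2.1)
    (fun a b h hb => norm_waveForm_le_L1 hc h.2.1 hb.2.1)
    (fun a b h hb => norm_waveForm_le_L2 hc h hb) ha hb

end

section

open ComplexConjugate

/-- The complex damping parameter of the wave `e^{(iσt - y)|∇|}`. -/
def waveC (σ y t : ℝ) : ℂ := 2 * Real.pi * (y - Complex.I * (σ * t))

lemma waveC_re (σ y t : ℝ) : (waveC σ y t).re = 2 * Real.pi * y := by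
  simp [waveC]

lemma waveC_add_conj (σ y t s : ℝ) :
    waveC σ y t + conj (waveC σ y s) = waveC σ (2 * y) (t - s) := by
  simp only [waveC, map_mul, map_sub, Complex.conj_ofReal, Complex.conj_I, map_ofNat]
  push_cast; ring

lemma continuous_waveC (σ y : ℝ) : Continuous (waveC σ y) := by
  unfold waveC; fun_prop

/-- The dispersive majorant `(y²(y+|m|))^{-θ}`. -/
def waveKer (θ y m : ℝ) : ℝ := (1 / (y ^ 2 * (y + |m|))) ^ θ

lemma waveC_kernel_le {σ y m κ θ : ℝ} (hσ : |σ| = 1) (hy : 0 < y) (hκ : 0 < κ) (hθ : 0 ≤ θ) :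
    (κ / (‖waveC σ (2 * y) m‖ * (waveC σ (2 * y) m).re ^ 2)) ^ θ ≤ κ ^ θ * waveKer θ y m := by
  have hpi := Real.pi_gt_three
  have hre := waveC_re σ (2 * y) m
  have him : |(waveC σ (2 * y) m).im| = 2 * Real.pi * |m| := by
    simp [waveC, abs_mul, hσ, abs_of_pos Real.pi_pos]
  have h1 : y + |m| ≤ ‖waveC σ (2 * y) m‖ := by
    have a := Complex.abs_re_le_norm (waveC σ (2 * y) m)
    have b := Complex.abs_im_le_norm (waveC σ (2 * y) m)
    rw [him] at b
    rw [hre, abs_of_pos (by positivity)] at a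
    nlinarith [abs_nonneg m]
  have h2 : y ^ 2 ≤ (waveC σ (2 * y) m).re ^ 2 := by
    rw [hre]
    gcongr
    nlinarith
  rw [waveKer, ← Real.mul_rpow hκ.le (by positivity)]
  refine Real.rpow_le_rpow (by positivity) ?_ hθ
  rw [mul_one_div, mul_comm (y ^ 2)]
  gcongr

variable {ν : Measure ℝ} [IsFiniteMeasure ν]

lemma measurable_fourierInv_param {α : Type*} [MeasurableSpace α] {K : α → E3 → ℂ} (hK : Measurable (Function.uncurry K)) :
    Measurable fun p : α × E3 => 𝓕⁻ (K p.1) p.2 := by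
  simp only [Real.fourierInv_eq']
  refine StronglyMeasurable.measurable ?_
  refine StronglyMeasurable.integral_prod_right
    (f := fun (p : α × E3) (v : E3) =>
      Complex.exp ((2 * Real.pi * ⟪v, p.2⟫ : ℝ) * Complex.I) • K p.1 v) ?_
  refine Measurable.stronglyMeasurable ?_
  have h1 : Measurable fun z : (α × E3) × E3 => K z.1.1 z.2 :=
    hK.comp (by fun_prop : Measurable fun z : (α × E3) × E3 => (z.1.1, z.2))
  have h2 : Measurable fun z : (α × E3) × E3 =>
      Complex.exp ((2 * Real.pi * ⟪z.2, z.1.2⟫ : ℝ) * Complex.I) := by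
    have h3 : Measurable fun z : (α × E3) × E3 => (z.2, z.1.2) := by fun_prop
    have h4 : Measurable fun z : (α × E3) × E3 => (2 * Real.pi * ⟪z.2, z.1.2⟫ : ℝ) :=
      (continuous_inner.measurable.comp h3).const_mul _
    exact Complex.measurable_exp.comp ((Complex.measurable_ofReal.comp h4).mul_const _)
  exact h2.smul h1

/-- The dual (superposed) wave profile on the frequency side. -/
def dualWave (ν : Measure ℝ) (σ y : ℝ) (K : ℝ → E3 → ℂ) (ξ : E3) : ℂ :=
  ∫ t, Complex.exp (-waveC σ y t * (‖ξ‖ : ℝ)) * 𝓕⁻ (K t) ξ ∂ν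

lemma measurable_dualWave_integrand (σ y : ℝ) {K : ℝ → E3 → ℂ}
    (hK : Measurable (Function.uncurry K)) :
    Measurable fun p : ℝ × E3 =>
      Complex.exp (-waveC σ y p.1 * (‖p.2‖ : ℝ)) * 𝓕⁻ (K p.1) p.2 := by
  refine Measurable.mul ?_ (measurable_fourierInv_param hK)
  have := continuous_waveC σ y
  exact Continuous.measurable (by fun_prop)

lemma norm_exp_waveC (σ y t : ℝ) (ξ : E3) :
    ‖Complex.exp (-waveC σ y t * (‖ξ‖ : ℝ))‖ = Real.exp (-(2 * Real.pi * y) * ‖ξ‖) := by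
  rw [Complex.norm_exp]
  congr 1
  simp [waveC_re]

lemma norm_dualWave_integrand_le {σ y M : ℝ} {K : ℝ → E3 → ℂ} (hM : ∀ t, ∫ x, ‖K t x‖ ≤ M)
    (t : ℝ) (ξ : E3) :
    ‖Complex.exp (-waveC σ y t * (‖ξ‖ : ℝ)) * 𝓕⁻ (K t) ξ‖ ≤
      Real.exp (-(2 * Real.pi * y) * ‖ξ‖) * M := by
  rw [norm_mul, norm_exp_waveC]
  gcongr
  exact (norm_fourierInv_le3 _ _).trans (hM t)

lemma integrable_real_exp_norm {a : ℝ} (ha : 0 < a) :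
    Integrable fun ξ : E3 => Real.exp (-a * ‖ξ‖) := by
  have := (integrable_exp_norm (c := (a : ℂ)) (by simpa using ha)).norm
  refine this.congr ?_
  filter_upwards with ξ
  rw [Complex.norm_exp]; simp

lemma bddInt_dualWave {σ y M : ℝ} (hy : 0 < y) {K : ℝ → E3 → ℂ}
    (hK : Measurable (Function.uncurry K)) (hM : ∀ t, ∫ x, ‖K t x‖ ≤ M) :
    BddInt volume (dualWave ν σ y K) := by
  have hM0 : 0 ≤ M := le_trans (integral_nonneg fun x => norm_nonneg _) (hM 0)
  have hm : Measurable (dualWave ν σ y K) := by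
    refine StronglyMeasurable.measurable ?_
    refine StronglyMeasurable.integral_prod_right
      (f := fun ξ t => Complex.exp (-waveC σ y t * (‖ξ‖ : ℝ)) * 𝓕⁻ (K t) ξ) ?_
    exact ((measurable_dualWave_integrand σ y hK).comp measurable_swap).stronglyMeasurable
  have hb : ∀ ξ, ‖dualWave ν σ y K ξ‖ ≤ Real.exp (-(2 * Real.pi * y) * ‖ξ‖) * (M * ν.real univ) := by
    intro ξ
    refine (norm_integral_le_of_norm_le_const (μ := ν)
      (ae_of_all _ fun t => norm_dualWave_integrand_le hM t ξ)).trans (le_of_eq (by ring))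
  refine ⟨hm, ?_, M * ν.real univ, fun ξ => (hb ξ).trans ?_⟩
  · exact ((integrable_real_exp_norm (by positivity)).mul_const _).mono' hm.aestronglyMeasurable
      (ae_of_all _ hb)
  · refine mul_le_of_le_one_left (by positivity) ?_
    rw [Real.exp_le_one_iff]
    have : 0 ≤ 2 * Real.pi * y * ‖ξ‖ := by positivity
    linarith

lemma dualWave_sq_le {σ y M : ℝ} (hy : 0 < y) {K : ℝ → E3 → ℂ}
    (hK : Measurable (Function.uncurry K)) (hM : ∀ t, ∫ x, ‖K t x‖ ≤ M) :
    ENNReal.ofReal (∫ ξ, ‖dualWave ν σ y K ξ‖ ^ 2) ≤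
      ∫⁻ z, ‖waveForm (waveC σ (2 * y) (z.1 - z.2)) (K z.1) (K z.2)‖ₑ ∂(ν.prod ν) := by
  have hM0 : 0 ≤ M := le_trans (integral_nonneg fun x => norm_nonneg _) (hM 0)
  obtain ⟨f, hf⟩ : ∃ f : ℝ → E3 → ℂ,
      f = fun t ξ => Complex.exp (-waveC σ y t * (‖ξ‖ : ℝ)) * 𝓕⁻ (K t) ξ := ⟨_, rfl⟩
  have hfm : Measurable (Function.uncurry f) := hf ▸ measurable_dualWave_integrand σ y hK
  have hfb : ∀ t ξ, ‖f t ξ‖ ≤ Real.exp (-(2 * Real.pi * y) * ‖ξ‖) * M := fun t ξ =>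
    hf ▸ norm_dualWave_integrand_le hM t ξ
  have hfd : ∀ ξ, dualWave ν σ y K ξ = ∫ t, f t ξ ∂ν := fun ξ => hf ▸ rfl
  have e1 : ((∫ ξ, ‖dualWave ν σ y K ξ‖ ^ 2 : ℝ) : ℂ) =
      ∫ ξ, ∫ z : ℝ × ℝ, f z.1 ξ * conj (f z.2 ξ) ∂(ν.prod ν) := by
    rw [← integral_complex_ofReal]
    congr 1; ext ξ
    rw [integral_prod_mul (fun t => f t ξ) (fun t => conj (f t ξ)), integral_conj]
    push_cast
    rw [hfd]
    exact (Complex.mul_conj' _).symm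
  have hInt : Integrable (Function.uncurry fun (ξ : E3) (z : ℝ × ℝ) =>
      f z.1 ξ * conj (f z.2 ξ)) (volume.prod (ν.prod ν)) := by
    have h0 : Integrable (fun p : E3 × (ℝ × ℝ) =>
        Real.exp (-(2 * Real.pi * y) * ‖p.1‖) * (M * M)) (volume.prod (ν.prod ν)) :=
      Integrable.mul_prod (integrable_real_exp_norm (by positivity)) (integrable_const (M * M))
    refine h0.mono' ?_ (ae_of_all _ fun p => ?_)
    · have hA : Measurable fun p : E3 × (ℝ × ℝ) => Function.uncurry f (p.2.1, p.1) :=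
        hfm.comp (by fun_prop)
      have hB : Measurable fun p : E3 × (ℝ × ℝ) => Function.uncurry f (p.2.2, p.1) :=
        hfm.comp (by fun_prop)
      exact (hA.mul (Complex.continuous_conj.measurable.comp hB)).aestronglyMeasurable
    · have h1 := hfb p.2.1 p.1
      have h2 := hfb p.2.2 p.1
      have h3 : Real.exp (-(2 * Real.pi * y) * ‖p.1‖) ≤ 1 := by
        rw [Real.exp_le_one_iff]
        have : 0 ≤ 2 * Real.pi * y * ‖p.1‖ := by positivity
        linarith
      have h4 : ‖f p.2.2 p.1‖ ≤ M := h2.trans (mul_le_of_le_one_left hM0 h3)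
      simp only [Function.uncurry, norm_mul, Complex.norm_conj]
      rw [← mul_assoc]
      exact mul_le_mul h1 h4 (norm_nonneg _) (by positivity)
  have e2 : ∀ z : ℝ × ℝ, ∫ ξ, f z.1 ξ * conj (f z.2 ξ) =
      waveForm (waveC σ (2 * y) (z.1 - z.2)) (K z.1) (K z.2) := by
    intro z
    rw [waveForm, ← waveC_add_conj]
    congr 1; ext ξ
    simp only [hf, map_mul, ← Complex.exp_conj, map_neg, Complex.conj_ofReal]
    rw [mul_mul_mul_comm, ← Complex.exp_add, mul_assoc]
    congr 2; ring
  rw [integral_integral_swap hInt] at e1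
  simp only [e2] at e1
  have h5 : 0 ≤ ∫ ξ, ‖dualWave ν σ y K ξ‖ ^ 2 := integral_nonneg fun _ => by positivity
  calc ENNReal.ofReal (∫ ξ, ‖dualWave ν σ y K ξ‖ ^ 2) =
      ‖((∫ ξ, ‖dualWave ν σ y K ξ‖ ^ 2 : ℝ) : ℂ)‖ₑ := by
        rw [← ofReal_norm, Complex.norm_real, Real.norm_of_nonneg h5]
    _ ≤ _ := by rw [e1]; exact enorm_integral_le_lintegral_enorm _

lemma wave_pairing {σ y M : ℝ} (hy : 0 ≤ y) {K : ℝ → E3 → ℂ}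
    (hK : Measurable (Function.uncurry K)) (hKi : ∀ t, Integrable (K t))
    (hM : ∀ t, ∫ x, ‖K t x‖ ≤ M) {h : E3 → ℂ} (hh : Integrable h) :
    ∫ t, (∫ x, 𝓕⁻ (fun ξ => Complex.exp (-waveC σ y t * (‖ξ‖ : ℝ)) * h ξ) x * K t x) ∂ν =
      ∫ ξ, h ξ * dualWave ν σ y K ξ := by
  have e1 : ∀ t, ∫ x, 𝓕⁻ (fun ξ => Complex.exp (-waveC σ y t * (‖ξ‖ : ℝ)) * h ξ) x * K t x =
      ∫ ξ, h ξ * (Complex.exp (-waveC σ y t * (‖ξ‖ : ℝ)) * 𝓕⁻ (K t) ξ) := by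
    intro t
    have hi : Integrable fun ξ : E3 => Complex.exp (-waveC σ y t * (‖ξ‖ : ℝ)) * h ξ := by
      refine hh.bdd_mul (c := 1) (by fun_prop) (ae_of_all _ fun ξ => ?_)
      refine norm_cexp_neg_mul_le ?_ ξ
      rw [waveC_re]; positivity
    rw [integral_fourierInv_mul hi (hKi t)]
    congr 1; ext ξ; ring
  simp only [e1]
  rw [integral_integral_swap]
  · congr 1; ext ξ
    rw [integral_const_mul, dualWave]
  · have h0 : Integrable (fun p : ℝ × E3 => M * ‖h p.2‖) (ν.prod volume) :=
      Integrable.mul_prod (integrable_const M) hh.norm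
    refine h0.mono' ?_ (ae_of_all _ fun p => ?_)
    · exact hh.aestronglyMeasurable.comp_snd.mul
        (measurable_dualWave_integrand σ y hK).aestronglyMeasurable
    · simp only [Function.uncurry]
      rw [norm_mul, mul_comm]
      gcongr
      refine (norm_dualWave_integrand_le hM p.1 p.2).trans ?_
      have hM0 : 0 ≤ M := le_trans (integral_nonneg fun x => norm_nonneg _) (hM 0)
      refine mul_le_of_le_one_left hM0 ?_
      rw [Real.exp_le_one_iff]
      have : 0 ≤ 2 * Real.pi * y * ‖p.2‖ := by positivity
      linarith

/-- The constant in the bilinear dispersive estimate. -/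
def dispC (r : ℝ) : ℝ := (1 + (2 ^ (2 - r) + 2 ^ (2 - r) / (2 ^ (2 - r) - 1)) / 2) *
  (8 * volume.real (ball (0 : E2) 1)) ^ (2 / r - 1)

lemma dispC_pos {r : ℝ} (hr2 : r < 2) : 0 < dispC r := by
  have hκ : 0 < volume.real (ball (0 : E2) 1) :=
    ENNReal.toReal_pos (measure_ball_pos _ _ one_pos).ne' measure_ball_lt_top.ne
  have h1r : 1 < (2:ℝ) ^ (2 - r) := Real.one_lt_rpow (by norm_num) (by linarith)
  have : 0 < (2:ℝ) ^ (2 - r) - 1 := by linarith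
  unfold dispC; positivity

lemma wave_pairing_le {σ y M r : ℝ} (hσ : |σ| = 1) (hy : 0 < y) (hr : 1 < r) (hr2 : r < 2)
    {K : ℝ → E3 → ℂ} (hK : Measurable (Function.uncurry K)) (hKi : ∀ t, BddInt volume (K t))
    (hM : ∀ t, ∫ x, ‖K t x‖ ≤ M) {h : E3 → ℂ} (hh : Integrable h) (h2 : MemLp h 2) :
    ENNReal.ofReal (‖∫ t, (∫ x, 𝓕⁻ (fun ξ => Complex.exp (-waveC σ y t * (‖ξ‖ : ℝ)) * h ξ) x *
        K t x) ∂ν‖ ^ 2) ≤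
      ENNReal.ofReal ((∫ ξ, ‖h ξ‖ ^ 2) * dispC r) *
        ∫⁻ z, ENNReal.ofReal (waveKer (2 / r - 1) y (z.1 - z.2)) *
          ENNReal.ofReal ((∫ x, ‖K z.1 x‖ ^ r) ^ (1 / r)) *
          ENNReal.ofReal ((∫ x, ‖K z.2 x‖ ^ r) ^ (1 / r)) ∂(ν.prod ν) := by
  have hκ : 0 < volume.real (ball (0 : E2) 1) :=
    ENNReal.toReal_pos (measure_ball_pos _ _ one_pos).ne' measure_ball_lt_top.ne
  rw [wave_pairing hy.le hK (fun t => (hKi t).2.1) hM hh]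
  have hD := bddInt_dualWave (ν := ν) (σ := σ) hy hK hM
  have h3 : ‖∫ ξ, h ξ * dualWave ν σ y K ξ‖ ^ 2 ≤
      (∫ ξ, ‖h ξ‖ ^ 2) * ∫ ξ, ‖dualWave ν σ y K ξ‖ ^ 2 := by
    have h4 : ‖∫ ξ, h ξ * dualWave ν σ y K ξ‖ ≤
        √(∫ ξ, ‖h ξ‖ ^ 2) * √(∫ ξ, ‖dualWave ν σ y K ξ‖ ^ 2) := by
      refine le_trans ?_ (integral_norm_mul_norm_le h2 (memLp_two_of_bdd hD))
      refine (norm_integral_le_integral_norm _).trans (le_of_eq ?_)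
      simp only [norm_mul]
    calc _ ≤ (√(∫ ξ, ‖h ξ‖ ^ 2) * √(∫ ξ, ‖dualWave ν σ y K ξ‖ ^ 2)) ^ 2 := by gcongr
      _ = _ := by
        rw [mul_pow, Real.sq_sqrt (integral_nonneg fun _ => by positivity),
          Real.sq_sqrt (integral_nonneg fun _ => by positivity)]
  have hh0 : 0 ≤ ∫ ξ, ‖h ξ‖ ^ 2 := integral_nonneg fun _ => by positivity
  refine (ENNReal.ofReal_le_ofReal h3).trans ?_
  rw [ENNReal.ofReal_mul hh0, ENNReal.ofReal_mul hh0, mul_assoc]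
  gcongr
  refine (dualWave_sq_le hy hK hM).trans ?_
  rw [← lintegral_const_mul']
  swap
  · exact ENNReal.ofReal_ne_top
  refine lintegral_mono fun z => ?_
  have hwk : 0 ≤ waveKer (2 / r - 1) y (z.1 - z.2) := by unfold waveKer; positivity
  have hI : ∀ t, 0 ≤ (∫ x, ‖K t x‖ ^ r) ^ (1 / r) := fun t =>
    Real.rpow_nonneg (integral_nonneg fun _ => by positivity) _
  rw [← ENNReal.ofReal_mul hwk, ← ENNReal.ofReal_mul (mul_nonneg hwk (hI _)),
    ← ENNReal.ofReal_mul (dispC_pos hr2).le, ← ofReal_norm]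
  refine ENNReal.ofReal_le_ofReal ?_
  have hθ : 0 ≤ 2 / r - 1 := by
    rw [sub_nonneg, le_div_iff₀ (by linarith)]; linarith
  refine (norm_waveForm_le hr hr2 (by rw [waveC_re]; positivity) (hKi z.1) (hKi z.2)).trans ?_
  have h1r : 1 < (2:ℝ) ^ (2 - r) := Real.one_lt_rpow (by norm_num) (by linarith)
  have h1r' : 0 < (2:ℝ) ^ (2 - r) - 1 := by linarith
  rw [dispC, mul_assoc (_ * _), mul_assoc (waveKer _ _ _), mul_assoc (1 + _), mul_assoc (1 + _),
    ← mul_assoc (_ ^ _) (waveKer _ _ _)]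
  have := waveC_kernel_le (σ := σ) (m := z.1 - z.2) hσ hy (κ := 8 * volume.real (ball (0 : E2) 1))
    (by positivity) hθ
  have hI1 := hI z.1
  have hI2 := hI z.2
  gcongr

end

section

open ComplexConjugate
variable {ν : Measure ℝ} [IsFiniteMeasure ν]

/-- The damped half-wave `e^{(iσt - y)|∇|}` with frequency profile `h`. -/
def dampedWave (σ y : ℝ) (h : E3 → ℂ) (t : ℝ) : E3 → ℂ :=
  𝓕⁻ (fun ξ => Complex.exp (-waveC σ y t * (‖ξ‖ : ℝ)) * h ξ)

lemma integrable_damped {σ y : ℝ} (hy : 0 ≤ y) {h : E3 → ℂ} (hh : Integrable h) (t : ℝ) :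
    Integrable fun ξ : E3 => Complex.exp (-waveC σ y t * (‖ξ‖ : ℝ)) * h ξ := by
  refine hh.bdd_mul (c := 1) (by fun_prop) (ae_of_all _ fun ξ => ?_)
  refine norm_cexp_neg_mul_le ?_ ξ
  rw [waveC_re]; positivity

lemma norm_dampedWave_le {σ y : ℝ} (hy : 0 ≤ y) {h : E3 → ℂ} (hh : Integrable h) (t : ℝ) (x : E3) :
    ‖dampedWave σ y h t x‖ ≤ ∫ ξ, ‖h ξ‖ := by
  refine (norm_fourierInv_le3 _ _).trans ?_
  refine integral_mono (integrable_damped hy hh t).norm hh.norm fun ξ => ?_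
  rw [norm_mul]
  refine mul_le_of_le_one_left (norm_nonneg _) (norm_cexp_neg_mul_le ?_ ξ)
  rw [waveC_re]; positivity

lemma measurable_dampedWave (σ y : ℝ) {h : E3 → ℂ} (hh : Measurable h) :
    Measurable fun p : ℝ × E3 => dampedWave σ y h p.1 p.2 := by
  refine measurable_fourierInv_param
    (K := fun t ξ => Complex.exp (-waveC σ y t * (‖ξ‖ : ℝ)) * h ξ) ?_
  have h1 : Measurable fun p : ℝ × E3 => Complex.exp (-waveC σ y p.1 * (‖p.2‖ : ℝ)) := by
    have := continuous_waveC σ y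
    exact Continuous.measurable (by fun_prop)
  exact h1.mul (hh.comp measurable_snd)

lemma rpow_test_mul {n P q : ℝ} (hn : 0 ≤ n) (hP : 0 < P) (hq : 0 < q) :
    n ^ (P - q) * n ^ q = n ^ P := by
  rcases hn.eq_or_lt with rfl | hn
  · rw [Real.zero_rpow hq.ne', Real.zero_rpow hP.ne', mul_zero]
  · rw [← Real.rpow_add hn]; ring_nf

lemma rpow_test_norm {n P q r : ℝ} (hn : 0 ≤ n) (hP : 1 < P) (hqr : q.HolderConjugate r) :
    ((n ^ (P - q)) ^ r * n ^ q) ^ (1 / r) = n ^ (P - 1) := by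
  have hr := hqr.symm.pos
  have hq := hqr.pos
  rcases hn.eq_or_lt with rfl | hn
  · rw [Real.zero_rpow hq.ne', mul_zero, Real.zero_rpow (by positivity),
      Real.zero_rpow (by linarith)]
  · rw [← Real.rpow_mul hn.le, ← Real.rpow_add hn, ← Real.rpow_mul hn.le]
    congr 1
    have : 1 / q + 1 / r = 1 := by simpa using hqr.inv_add_inv_eq_one
    field_simp at this ⊢
    linarith

set_option maxHeartbeats 1000000 in
lemma strichartz_ball {σ y P P' q r : ℝ} (hσ : |σ| = 1) (hy : 0 < y) (hq : 2 < q)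
    (hqr : q.HolderConjugate r) (hP : 1 < P) (hPP : P.HolderConjugate P') {Q : ℝ≥0∞}
    (hQ : ∀ φ : ℝ → ℝ≥0∞, Measurable φ →
      ∫⁻ z, ENNReal.ofReal (waveKer (1 - 2 / q) y (z.1 - z.2)) * φ z.1 * φ z.2 ∂(ν.prod ν) ≤
        Q * (∫⁻ t, φ t ^ P' ∂ν) ^ (2 / P'))
    {h : E3 → ℂ} (hm : Measurable h) (hh : Integrable h) (h2 : MemLp h 2) (R : ℕ) :
    (∫⁻ t, (∫⁻ x in ball 0 R, ‖dampedWave σ y h t x‖ₑ ^ q) ^ (P / q) ∂ν) ^ (2 / P) ≤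
      ENNReal.ofReal ((∫ ξ, ‖h ξ‖ ^ 2) * dispC r) * Q := by
  have hq0 : 0 < q := by linarith
  have hr0 : 0 < r := hqr.symm.pos
  have hP0 : 0 < P := by linarith
  have hP'0 : 0 < P' := hPP.symm.pos
  have hqr1 : 1 / q + 1 / r = 1 := by simpa using hqr.inv_add_inv_eq_one
  have hPP1 : 1 / P + 1 / P' = 1 := by simpa using hPP.inv_add_inv_eq_one
  have hr1 : 1 < r := hqr.symm.lt
  have hr2 : r < 2 := by
    by_contra hc
    push Not at hc
    have a : 1 / r ≤ 1 / 2 := by gcongr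
    have b : 1 / q < 1 / 2 := by gcongr
    linarith
  have hq1r : (q - 1) * r = q := by field_simp at hqr1; linarith
  have hP1 : (P - 1) * P' = P := by field_simp at hPP1; linarith
  have hθ : 2 / r - 1 = 1 - 2 / q := by
    linear_combination 2 * hqr1
  obtain ⟨u, hu⟩ : ∃ u, u = dampedWave σ y h := ⟨_, rfl⟩
  have hum : Measurable fun p : ℝ × E3 => u p.1 p.2 := hu ▸ measurable_dampedWave σ y hm
  obtain ⟨H, hH⟩ : ∃ H : ℝ, H = ∫ ξ, ‖h ξ‖ := ⟨_, rfl⟩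
  have hH0 : 0 ≤ H := hH ▸ integral_nonneg fun _ => norm_nonneg _
  have hub : ∀ t x, ‖u t x‖ ≤ H := fun t x => by
    rw [hu, hH]; exact norm_dampedWave_le hy.le hh t x
  have humt : ∀ t, Measurable (u t) := fun t => hum.comp measurable_prodMk_left
  set B : Set E3 := ball 0 R with hB
  have hBm : MeasurableSet B := measurableSet_ball
  have hBf : volume B ≠ ∞ := measure_ball_lt_top.ne
  set n : ℝ → ℝ := fun t => (∫ x in B, ‖u t x‖ ^ q) ^ (1 / q) with hn
  have hI0 : ∀ t, 0 ≤ ∫ x in B, ‖u t x‖ ^ q := fun t => integral_nonneg fun _ => by positivity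
  have hn0 : ∀ t, 0 ≤ n t := fun t => Real.rpow_nonneg (hI0 t) _
  have hnq : ∀ t, n t ^ q = ∫ x in B, ‖u t x‖ ^ q := fun t => by
    rw [hn]; dsimp only
    rw [← Real.rpow_mul (hI0 t), one_div_mul_cancel hq0.ne', Real.rpow_one]
  have hnm : Measurable n := by
    refine Measurable.pow_const (StronglyMeasurable.measurable ?_) _
    refine StronglyMeasurable.integral_prod_right (f := fun t x => ‖u t x‖ ^ q) ?_
    exact (hum.norm.pow_const q).stronglyMeasurable
  have huI : ∀ t, IntegrableOn (fun x => ‖u t x‖ ^ q) B := fun t =>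
    Measure.integrableOn_of_bounded hBf ((humt t).norm.pow_const q).aestronglyMeasurable
      (M := H ^ q) (ae_of_all _ fun x => by
        rw [Real.norm_of_nonneg (by positivity)]
        exact Real.rpow_le_rpow (norm_nonneg _) (hub t x) hq0.le)
  obtain ⟨n0, hn0'⟩ : ∃ n0 : ℝ, ∀ t, n t ≤ n0 := by
    refine ⟨(H ^ q * volume.real B) ^ (1 / q), fun t => ?_⟩
    refine Real.rpow_le_rpow (hI0 t) ?_ (by positivity)
    refine (Real.le_norm_self _).trans (norm_setIntegral_le_of_norm_le_const hBf.lt_top fun x _ => ?_)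
    rw [Real.norm_of_nonneg (by positivity)]
    exact Real.rpow_le_rpow (norm_nonneg _) (hub t x) hq0.le
  have hn00 : 0 ≤ n0 := (hn0 0).trans (hn0' 0)
  set K : ℝ → E3 → ℂ := fun t => B.indicator fun x =>
    ((n t ^ (P - q) * ‖u t x‖ ^ (q - 2) : ℝ) : ℂ) * conj (u t x) with hK
  have hKm : Measurable (Function.uncurry K) := by
    have h1 : Measurable fun p : ℝ × E3 =>
        ((n p.1 ^ (P - q) * ‖u p.1 p.2‖ ^ (q - 2) : ℝ) : ℂ) * conj (u p.1 p.2) := by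
      refine Measurable.mul (Complex.measurable_ofReal.comp ?_)
        (Complex.continuous_conj.measurable.comp hum)
      exact ((hnm.comp measurable_fst).pow_const _).mul (hum.norm.pow_const _)
    exact h1.indicator (measurable_snd hBm)
  have hKn : ∀ t x, ‖K t x‖ = B.indicator (fun x => n t ^ (P - q) * ‖u t x‖ ^ (q - 1)) x := by
    intro t x
    by_cases hx : x ∈ B
    · simp only [hK, indicator_of_mem hx, norm_mul, Complex.norm_conj, Complex.norm_real]
      rw [Real.norm_of_nonneg (Real.rpow_nonneg (hn0 t) _), Real.norm_of_nonneg (by positivity),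
        mul_assoc]
      congr 1
      have := rpow_test_mul (norm_nonneg (u t x)) (P := q - 1) (q := 1) (by linarith) one_pos
      rw [Real.rpow_one] at this
      rw [← this]; ring_nf
    · simp [hK, indicator_of_notMem hx]
  have huK : ∀ t x, u t x * K t x =
      ((B.indicator (fun x => n t ^ (P - q) * ‖u t x‖ ^ q) x : ℝ) : ℂ) := by
    intro t x
    by_cases hx : x ∈ B
    · simp only [hK, indicator_of_mem hx]
      rw [mul_left_comm, Complex.mul_conj']
      have := rpow_test_mul (norm_nonneg (u t x)) (P := q) (q := 2) (by linarith) two_pos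
      rw [← this, Real.rpow_two]
      push_cast; ring
    · simp [hK, indicator_of_notMem hx]
  have hKr : ∀ t x, ‖K t x‖ ^ r =
      B.indicator (fun x => (n t ^ (P - q)) ^ r * ‖u t x‖ ^ q) x := by
    intro t x
    rw [hKn]
    by_cases hx : x ∈ B
    · simp only [indicator_of_mem hx]
      rw [Real.mul_rpow (Real.rpow_nonneg (hn0 t) _) (by positivity),
        ← Real.rpow_mul (norm_nonneg _), hq1r]
    · simp [indicator_of_notMem hx, Real.zero_rpow hr0.ne']
  have hKint : ∀ t, (∫ x, ‖K t x‖ ^ r) ^ (1 / r) = n t ^ (P - 1) := by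
    intro t
    simp only [hKr]
    rw [integral_indicator hBm, integral_const_mul, ← hnq, rpow_test_norm (hn0 t) hP hqr]
  have hKb : ∀ t, BddInt volume (K t) := by
    intro t
    have hb : ∀ x, ‖K t x‖ ≤ n t ^ (P - q) * H ^ (q - 1) := by
      intro x
      rw [hKn]
      refine indicator_le_self' (fun _ _ => by have := hn0 t; positivity) x |>.trans ?_
      have := Real.rpow_le_rpow (norm_nonneg _) (hub t x) (by linarith : 0 ≤ q - 1)
      have h0 := Real.rpow_nonneg (hn0 t) (P - q)
      gcongr
    have hKtm : Measurable (K t) := by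
      have h3 : Measurable fun x => ((n t ^ (P - q) * ‖u t x‖ ^ (q - 2) : ℝ) : ℂ) * conj (u t x) :=
        (Complex.measurable_ofReal.comp (((humt t).norm.pow_const _).const_mul _)).mul
          (Complex.continuous_conj.measurable.comp (humt t))
      rw [hK]
      exact h3.indicator hBm
    refine ⟨hKtm, ?_, _, hb⟩
    have h1 : IntegrableOn (K t) B := Measure.integrableOn_of_bounded hBf
      hKtm.aestronglyMeasurable (M := n t ^ (P - q) * H ^ (q - 1)) (ae_of_all _ hb)
    refine (integrableOn_iff_integrable_of_support_subset ?_).1 h1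
    intro x hx
    by_contra hxB
    exact hx (by simp [hK, indicator_of_notMem hxB])
  have hone : BddInt volume (B.indicator fun _ => (1 : ℂ)) :=
    ⟨measurable_const.indicator hBm, (integrable_indicator_iff hBm).2 (integrableOn_const hBf), 1,
      fun x => by by_cases hx : x ∈ B <;> simp [hx]⟩
  have hKM : ∀ t, ∫ x, ‖K t x‖ ≤
      n0 ^ (P - 1) * (∫ x, ‖B.indicator (fun _ => (1 : ℂ)) x‖ ^ q) ^ (1 / q) := by
    intro t
    have h1 := integral_mul_norm_le_Lp_mul_Lq hqr.symm (memLp_rpow_of_bdd (hKb t) hr1.le)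
      (memLp_rpow_of_bdd hone (by linarith : 1 ≤ q))
    have h2 : ∫ x, ‖K t x‖ = ∫ x, ‖K t x‖ * ‖B.indicator (fun _ => (1 : ℂ)) x‖ := by
      congr 1; ext x
      by_cases hx : x ∈ B
      · simp [hx]
      · simp [hKn, hx]
    rw [h2]
    refine h1.trans ?_
    rw [hKint]
    exact mul_le_mul_of_nonneg_right (Real.rpow_le_rpow (hn0 t) (hn0' t) (by linarith))
      (Real.rpow_nonneg (integral_nonneg fun _ => by positivity) _)
  have key := wave_pairing_le (ν := ν) hσ hy hr1 hr2 hKm hKb hKM hh h2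
  rw [hθ] at key
  simp only [hKint] at key
  have hnPm : Measurable fun t => ENNReal.ofReal (n t ^ (P - 1)) :=
    (hnm.pow_const _).ennreal_ofReal
  have key2 := key.trans (mul_le_mul_right (hQ _ hnPm) _)
  have hXe : ∀ t, ENNReal.ofReal (n t ^ (P - 1)) ^ P' = ENNReal.ofReal (n t ^ P) := by
    intro t
    rw [ENNReal.ofReal_rpow_of_nonneg (Real.rpow_nonneg (hn0 t) _) hP'0.le,
      ← Real.rpow_mul (hn0 t), hP1]
  simp only [hXe] at key2
  have hnP : Integrable (fun t => n t ^ P) ν := by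
    refine Integrable.of_bound (hnm.pow_const _).aestronglyMeasurable (n0 ^ P)
      (ae_of_all _ fun t => ?_)
    rw [Real.norm_of_nonneg (Real.rpow_nonneg (hn0 t) _)]
    exact Real.rpow_le_rpow (hn0 t) (hn0' t) hP0.le
  have hpair : ∫ t, (∫ x, 𝓕⁻ (fun ξ => Complex.exp (-waveC σ y t * (‖ξ‖ : ℝ)) * h ξ) x *
      K t x) ∂ν = ((∫ t, n t ^ P ∂ν : ℝ) : ℂ) := by
    rw [← integral_complex_ofReal]
    congr 1; ext t
    have e : (fun x => 𝓕⁻ (fun ξ => Complex.exp (-waveC σ y t * (‖ξ‖ : ℝ)) * h ξ) x * K t x) =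
        fun x => ((B.indicator (fun x => n t ^ (P - q) * ‖u t x‖ ^ q) x : ℝ) : ℂ) := by
      ext x; rw [← huK, hu]; rfl
    rw [e, integral_complex_ofReal, integral_indicator hBm, integral_const_mul, ← hnq,
      rpow_test_mul (hn0 t) hP0 hq0]
  have hX0 : 0 ≤ ∫ t, n t ^ P ∂ν := integral_nonneg fun t => Real.rpow_nonneg (hn0 t) _
  set X := ∫⁻ t, ENNReal.ofReal (n t ^ P) ∂ν with hX
  have hXr : ENNReal.ofReal (∫ t, n t ^ P ∂ν) = X :=
    ofReal_integral_eq_lintegral_ofReal hnP (ae_of_all _ fun t => Real.rpow_nonneg (hn0 t) _)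
  rw [hpair, Complex.norm_real, Real.norm_of_nonneg hX0, ENNReal.ofReal_pow hX0, hXr,
    ← ENNReal.rpow_two] at key2
  have hgoal : ∫⁻ t, (∫⁻ x in B, ‖dampedWave σ y h t x‖ₑ ^ q) ^ (P / q) ∂ν = X := by
    rw [hX]
    congr 1; ext t
    have e1 : ∫⁻ x in B, ‖dampedWave σ y h t x‖ₑ ^ q = ENNReal.ofReal (n t ^ q) := by
      rw [hnq, ofReal_integral_eq_lintegral_ofReal (huI t) (ae_of_all _ fun _ => by positivity), hu]
      congr 1; ext x
      rw [← ENNReal.ofReal_rpow_of_nonneg (norm_nonneg _) hq0.le, ofReal_norm]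
    rw [e1, ENNReal.ofReal_rpow_of_nonneg (Real.rpow_nonneg (hn0 t) _) (by positivity),
      ← Real.rpow_mul (hn0 t), mul_div_cancel₀ _ hq0.ne']
  rw [hgoal]
  rcases eq_or_ne X 0 with hX00 | hX00
  · rw [hX00, ENNReal.zero_rpow_of_pos (by positivity)]; exact zero_le
  have hXT : X ≠ ∞ := by rw [← hXr]; exact ENNReal.ofReal_ne_top
  have hsplit : X ^ (2 : ℝ) = X ^ (2 / P) * X ^ (2 / P') := by
    rw [← ENNReal.rpow_add _ _ hX00 hXT]; congr 1; linear_combination (-2) * hPP1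
  rw [hsplit, ← mul_assoc] at key2
  exact (ENNReal.mul_le_mul_iff_left (by simp [hX00, hXT]) (by simp [hX00, hXT])).1 key2

theorem strichartz_damped {σ y P P' q r : ℝ} (hσ : |σ| = 1) (hy : 0 < y) (hq : 2 < q)
    (hqr : q.HolderConjugate r) (hP : 1 < P) (hPP : P.HolderConjugate P') {Q : ℝ≥0∞}
    (hQ : ∀ φ : ℝ → ℝ≥0∞, Measurable φ →
      ∫⁻ z, ENNReal.ofReal (waveKer (1 - 2 / q) y (z.1 - z.2)) * φ z.1 * φ z.2 ∂(ν.prod ν) ≤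
        Q * (∫⁻ t, φ t ^ P' ∂ν) ^ (2 / P'))
    {h : E3 → ℂ} (hm : Measurable h) (hh : Integrable h) (h2 : MemLp h 2) :
    (∫⁻ t, eLpNorm' (dampedWave σ y h t) q volume ^ P ∂ν) ^ (2 / P) ≤
      ENNReal.ofReal (dispC r) * Q * ∫⁻ ξ, ‖h ξ‖ₑ ^ 2 := by
  have hq0 : 0 < q := by linarith
  have hP0 : 0 < P := by linarith
  have hum := measurable_dampedWave σ y hm
  have e0 : ENNReal.ofReal ((∫ ξ, ‖h ξ‖ ^ 2) * dispC r) * Q =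
      ENNReal.ofReal (dispC r) * Q * ∫⁻ ξ, ‖h ξ‖ₑ ^ 2 := by
    rw [ENNReal.ofReal_mul (integral_nonneg fun _ => by positivity),
      ofReal_integral_eq_lintegral_ofReal (h2.integrable_norm_pow two_ne_zero) (ae_of_all _ fun _ => by positivity)]
    simp only [ENNReal.ofReal_pow (norm_nonneg _), ofReal_norm]
    ring
  rw [← e0]
  have hball := strichartz_ball hσ hy hq hqr hP hPP hQ hm hh h2
  set D := ENNReal.ofReal ((∫ ξ, ‖h ξ‖ ^ 2) * dispC r) * Q
  have hball' : ∀ R : ℕ, ∫⁻ t, (∫⁻ x in ball 0 R, ‖dampedWave σ y h t x‖ₑ ^ q) ^ (P / q) ∂ν ≤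
      D ^ (P / 2) := by
    intro R
    have := ENNReal.rpow_le_rpow (hball R) (by positivity : 0 ≤ P / 2)
    rwa [← ENNReal.rpow_mul, show 2 / P * (P / 2) = 1 by field_simp, ENNReal.rpow_one] at this
  have hmeas : ∀ R : ℕ, Measurable fun t =>
      (∫⁻ x in ball 0 R, ‖dampedWave σ y h t x‖ₑ ^ q) ^ (P / q) := fun R => by
    refine Measurable.pow_const ?_ _
    exact Measurable.lintegral_prod_right' (hum.enorm.pow_const q)
  have hmono : ∀ t, Monotone fun R : ℕ =>
      (∫⁻ x in ball (0:E3) R, ‖dampedWave σ y h t x‖ₑ ^ q) ^ (P / q) := fun t R R' hRR => by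
    refine ENNReal.rpow_le_rpow (lintegral_mono_set (ball_subset_ball ?_)) (by positivity)
    exact_mod_cast hRR
  have hlim : ∀ t, Filter.Tendsto (fun R : ℕ =>
      (∫⁻ x in ball (0:E3) R, ‖dampedWave σ y h t x‖ₑ ^ q) ^ (P / q)) Filter.atTop
      (nhds (eLpNorm' (dampedWave σ y h t) q volume ^ P)) := fun t => by
    rw [eLpNorm', ← ENNReal.rpow_mul, one_div_mul_eq_div]
    refine Filter.Tendsto.ennrpow_const _ ?_
    simp only [← lintegral_indicator measurableSet_ball]
    refine lintegral_tendsto_of_tendsto_of_monotone (fun R => ?_) (ae_of_all _ fun x => ?_)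
      (ae_of_all _ fun x => ?_)
    · refine (Measurable.indicator ?_ measurableSet_ball).aemeasurable
      exact (hum.comp measurable_prodMk_left).enorm.pow_const q
    · intro R R' hRR
      refine indicator_le_indicator_of_subset (ball_subset_ball ?_) (fun _ => zero_le) x
      exact_mod_cast hRR
    · refine tendsto_const_nhds.congr' ?_
      filter_upwards [Filter.eventually_gt_atTop ⌈‖x‖⌉₊] with R hR
      rw [indicator_of_mem]
      rw [mem_ball_zero_iff]
      exact (Nat.le_ceil _).trans_lt (by exact_mod_cast hR)
  have := lintegral_tendsto_of_tendsto_of_monotone (μ := ν) (fun R => (hmeas R).aemeasurable)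
    (ae_of_all _ hmono) (ae_of_all _ hlim)
  have h3 := le_of_tendsto' this hball'
  have h4 := ENNReal.rpow_le_rpow h3 (by positivity : 0 ≤ 2 / P)
  rwa [← ENNReal.rpow_mul, show P / 2 * (2 / P) = 1 by field_simp, ENNReal.rpow_one] at h4

end

/-- If `X = ∫ S^r` is finite and bounded by `D * X^(1/r')`, then `X^(1/r) ≤ D`. -/
lemma rpow_le_of_le_mul_rpow {X D : ℝ≥0∞} {r r' : ℝ} (h : r.HolderConjugate r')
    (hX : X ≠ ∞) (hXD : X ≤ D * X ^ (1 / r')) : X ^ (1 / r) ≤ D := by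
  have hr := h.pos
  rcases eq_or_ne X 0 with rfl | h0
  · rw [ENNReal.zero_rpow_of_pos (by positivity)]; exact zero_le
  have h1 : 1 / r + 1 / r' = 1 := by simpa using h.inv_add_inv_eq_one
  have h2 : X ^ (1 / r) * X ^ (1 / r') ≤ D * X ^ (1 / r') := by
    rwa [← ENNReal.rpow_add _ _ h0 hX, h1, ENNReal.rpow_one]
  exact (ENNReal.mul_le_mul_iff_left (by simp [h0, hX]) (by simp [h0, hX])).1 h2

/-- Minkowski's integral inequality. -/
lemma lintegral_minkowski {α β : Type*} [MeasurableSpace α] [MeasurableSpace β] {μ : Measure α}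
    {ν : Measure β} [SigmaFinite μ] [SFinite ν] {r : ℝ} (hr : 1 ≤ r) {Φ : α × β → ℝ≥0∞}
    (hΦ : Measurable Φ) :
    (∫⁻ a, (∫⁻ b, Φ (a, b) ∂ν) ^ r ∂μ) ^ (1 / r) ≤
      ∫⁻ b, (∫⁻ a, Φ (a, b) ^ r ∂μ) ^ (1 / r) ∂ν := by
  rcases hr.eq_or_lt with rfl | hr1
  · simp only [ENNReal.rpow_one, div_one]
    exact (lintegral_lintegral_swap (f := fun a b => Φ (a, b)) hΦ.aemeasurable).le
  have hconj := Real.HolderConjugate.conjExponent hr1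
  obtain ⟨r', hr'⟩ : ∃ r', r' = r.conjExponent := ⟨_, rfl⟩
  rw [← hr'] at hconj
  have hr0 : 0 < r := by linarith
  have hrr : (r - 1) * r' = r := by
    have h1 : 1 / r + 1 / r' = 1 := by simpa using hconj.inv_add_inv_eq_one
    have := hconj.symm.pos
    field_simp at h1; linarith
  obtain ⟨S, hS⟩ : ∃ S : α → ℝ≥0∞, S = fun a => ∫⁻ b, Φ (a, b) ∂ν := ⟨_, rfl⟩
  have hSm : Measurable S := hS ▸ hΦ.lintegral_prod_right'
  obtain ⟨T, hT⟩ : ∃ T : ℕ → α → ℝ≥0∞,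
    T = fun n => (spanningSets μ n).indicator fun a => min (S a) n := ⟨_, rfl⟩
  have hTm : ∀ n, Measurable (T n) := fun n => by
    rw [hT]; exact (hSm.min measurable_const).indicator (measurableSet_spanningSets μ n)
  have hTS : ∀ n a, T n a ≤ S a := fun n a => by
    rw [hT]; exact indicator_le (fun _ _ => min_le_left _ _) a
  have hbound : ∀ n, (∫⁻ a, T n a ^ r ∂μ) ^ (1 / r) ≤
      ∫⁻ b, (∫⁻ a, Φ (a, b) ^ r ∂μ) ^ (1 / r) ∂ν := by
    intro n
    refine rpow_le_of_le_mul_rpow hconj ?_ ?_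
    · refine ne_top_of_le_ne_top (b := (n : ℝ≥0∞) ^ r * μ (spanningSets μ n)) ?_ ?_
      · exact ENNReal.mul_ne_top (ENNReal.rpow_ne_top_of_nonneg hr0.le (by simp))
          (measure_spanningSets_lt_top μ n).ne
      · rw [← lintegral_indicator_const (measurableSet_spanningSets μ n)]
        refine lintegral_mono fun a => ?_
        by_cases ha : a ∈ spanningSets μ n
        · simp only [hT, indicator_of_mem ha]
          exact ENNReal.rpow_le_rpow (min_le_right _ _) hr0.le
        · simp [hT, indicator_of_notMem ha, hr0]
    · calc ∫⁻ a, T n a ^ r ∂μ ≤ ∫⁻ a, S a * T n a ^ (r - 1) ∂μ := by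
            refine lintegral_mono fun a => ?_
            have : T n a ^ r = T n a * T n a ^ (r - 1) := by
              conv_lhs => rw [show r = 1 + (r - 1) by ring]
              rw [ENNReal.rpow_add_of_nonneg _ _ zero_le_one (by linarith), ENNReal.rpow_one]
            rw [this]
            gcongr
            exact hTS n a
        _ = ∫⁻ a, ∫⁻ b, Φ (a, b) * T n a ^ (r - 1) ∂ν ∂μ := by
            refine lintegral_congr fun a => ?_
            have h3 : Measurable fun b => Φ (a, b) := hΦ.comp measurable_prodMk_left
            rw [lintegral_mul_const _ h3, hS]
        _ = ∫⁻ b, ∫⁻ a, Φ (a, b) * T n a ^ (r - 1) ∂μ ∂ν := by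
            refine lintegral_lintegral_swap (Measurable.aemeasurable ?_)
            exact hΦ.mul (((hTm n).comp measurable_fst).pow_const _)
        _ ≤ ∫⁻ b, (∫⁻ a, Φ (a, b) ^ r ∂μ) ^ (1 / r) * (∫⁻ a, T n a ^ r ∂μ) ^ (1 / r') ∂ν := by
            refine lintegral_mono fun b => ?_
            refine (ENNReal.lintegral_mul_le_Lp_mul_Lq μ hconj
              (hΦ.comp measurable_prodMk_right).aemeasurable
              ((hTm n).pow_const _).aemeasurable).trans_eq ?_
            simp only [← ENNReal.rpow_mul, hrr]
            rfl
        _ = _ := by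
            rw [lintegral_mul_const]
            exact ((hΦ.pow_const r).lintegral_prod_left').pow_const _
  have hmono : ∀ a, Monotone fun n => T n a ^ r := fun a n m hnm => by
    refine ENNReal.rpow_le_rpow ?_ hr0.le
    simp only [hT]
    refine (indicator_le_indicator_of_subset (monotone_spanningSets μ hnm) (fun _ => zero_le) a).trans
      (indicator_le_indicator (min_le_min le_rfl (by exact_mod_cast hnm)))
  have hlim : ∀ a, Filter.Tendsto (fun n => T n a ^ r) Filter.atTop (nhds (S a ^ r)) := fun a => by
    refine Filter.Tendsto.ennrpow_const _ ?_
    have h1 : Filter.Tendsto (fun n : ℕ => min (S a) n) Filter.atTop (nhds (min (S a) ∞)) :=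
      tendsto_const_nhds.min ENNReal.tendsto_nat_nhds_top
    rw [min_eq_left le_top] at h1
    refine h1.congr' ?_
    filter_upwards [Filter.eventually_ge_atTop (spanningSetsIndex μ a)] with n hn
    simp only [hT]
    rw [indicator_of_mem (monotone_spanningSets μ hn (mem_spanningSetsIndex μ a))]
  have h1 := lintegral_tendsto_of_tendsto_of_monotone (μ := μ)
    (fun n => ((hTm n).pow_const r).aemeasurable) (ae_of_all _ hmono) (ae_of_all _ hlim)
  have h2 := le_of_tendsto' (h1.ennrpow_const (1 / r)) hbound
  rw [hS] at h2
  exact h2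

lemma minkowski_finset {α ι : Type*} [MeasurableSpace α] [Fintype ι] {μ : Measure α} [SigmaFinite μ]
    {r : ℝ} (hr : 1 ≤ r) {Φ : ι → α → ℝ≥0∞} (hΦ : ∀ i, Measurable (Φ i)) :
    (∫⁻ a, (∑ i, Φ i a) ^ r ∂μ) ^ (1 / r) ≤ ∑ i, (∫⁻ a, Φ i a ^ r ∂μ) ^ (1 / r) := by
  let _ : MeasurableSpace ι := ⊤
  have _ : MeasurableSingletonClass ι := ⟨fun _ => trivial⟩
  have := lintegral_minkowski (μ := μ) (ν := (Measure.count : Measure ι)) hr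
    (Φ := fun p => Φ p.2 p.1) (measurable_from_prod_countable_left fun i => hΦ i)
  simpa only [lintegral_count, tsum_fintype] using this

/-- A weighted Hardy inequality. -/
lemma lintegral_hardy {g : ℝ → ℝ≥0∞} (hg : Measurable g) :
    ∫⁻ τ in Ioi (0:ℝ), (∫⁻ w in Ioi τ, g w) ^ 2 ≤
      4 * ∫⁻ w in Ioi (0:ℝ), ENNReal.ofReal (w ^ 2) * g w ^ 2 := by
  have hcs : ∀ τ ∈ Ioi (0:ℝ), (∫⁻ w in Ioi τ, g w) ^ 2 ≤
      ENNReal.ofReal (2 * τ ^ (-(1/2) : ℝ)) *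
        ∫⁻ w in Ioi τ, ENNReal.ofReal (w ^ (3/2 : ℝ)) * g w ^ 2 := by
    intro τ hτ
    have hτ0 : 0 < τ := hτ
    have h1 := ENNReal.lintegral_mul_le_Lp_mul_Lq (volume.restrict (Ioi τ))
      Real.HolderConjugate.two_two (f := fun w => ENNReal.ofReal (w ^ (-(3/4) : ℝ)))
      (g := fun w => ENNReal.ofReal (w ^ (3/4 : ℝ)) * g w) (by fun_prop)
      (Measurable.aemeasurable (by fun_prop))
    have e1 : ∫⁻ w in Ioi τ, g w = ∫⁻ w in Ioi τ, ((fun w => ENNReal.ofReal (w ^ (-(3/4) : ℝ))) *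
        fun w => ENNReal.ofReal (w ^ (3/4 : ℝ)) * g w) w := by
      refine setLIntegral_congr_fun measurableSet_Ioi fun w hw => ?_
      have hw0 : 0 < w := hτ0.trans hw
      simp only [Pi.mul_apply]
      rw [← mul_assoc, ← ENNReal.ofReal_mul (by positivity), ← Real.rpow_add hw0]
      norm_num
    have e2 : ∫⁻ w in Ioi τ, ENNReal.ofReal (w ^ (-(3/4) : ℝ)) ^ (2:ℝ) =
        ENNReal.ofReal (2 * τ ^ (-(1/2) : ℝ)) := by
      have : ∀ w ∈ Ioi τ, ENNReal.ofReal (w ^ (-(3/4) : ℝ)) ^ (2:ℝ) =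
          ENNReal.ofReal (w ^ (-(3/2) : ℝ)) := fun w hw => by
        have hw0 : 0 < w := hτ0.trans hw
        rw [ENNReal.ofReal_rpow_of_nonneg (by positivity) (by norm_num), ← Real.rpow_mul hw0.le]
        norm_num
      rw [setLIntegral_congr_fun measurableSet_Ioi this, ← ofReal_integral_eq_lintegral_ofReal
        (integrableOn_Ioi_rpow_of_lt (by norm_num) hτ0)
        ((ae_restrict_mem measurableSet_Ioi).mono fun w hw => by
          have hw0 : 0 < w := hτ0.trans hw
          positivity), integral_Ioi_rpow_of_lt (by norm_num) hτ0]
      congr 1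
      rw [show (-(3/2) : ℝ) + 1 = -(1/2) by norm_num]; ring
    have e3 : ∫⁻ w in Ioi τ, (ENNReal.ofReal (w ^ (3/4 : ℝ)) * g w) ^ (2:ℝ) =
        ∫⁻ w in Ioi τ, ENNReal.ofReal (w ^ (3/2 : ℝ)) * g w ^ 2 := by
      refine setLIntegral_congr_fun measurableSet_Ioi fun w hw => ?_
      have hw0 : 0 < w := hτ0.trans hw
      rw [ENNReal.rpow_two, mul_pow, ← ENNReal.ofReal_pow (by positivity), ← Real.rpow_natCast,
        ← Real.rpow_mul hw0.le]
      norm_num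
    rw [e2, e3, ← e1, ← ENNReal.mul_rpow_of_nonneg _ _ (by norm_num)] at h1
    have h2 := ENNReal.rpow_le_rpow h1 (zero_le_two (α := ℝ))
    rw [← ENNReal.rpow_mul] at h2
    rwa [show (1 / 2 * 2 : ℝ) = 1 by norm_num, ENNReal.rpow_one, ENNReal.rpow_two] at h2
  calc _ ≤ ∫⁻ τ in Ioi (0:ℝ), ENNReal.ofReal (2 * τ ^ (-(1/2) : ℝ)) *
        ∫⁻ w in Ioi τ, ENNReal.ofReal (w ^ (3/2 : ℝ)) * g w ^ 2 :=
        setLIntegral_mono' measurableSet_Ioi hcs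
    _ = ∫⁻ τ in Ioi (0:ℝ), ∫⁻ w in Ioi (0:ℝ), (Ioi τ).indicator (fun w =>
          ENNReal.ofReal (2 * τ ^ (-(1/2) : ℝ)) * (ENNReal.ofReal (w ^ (3/2 : ℝ)) * g w ^ 2)) w := by
        refine setLIntegral_congr_fun measurableSet_Ioi fun τ hτ => ?_
        rw [← lintegral_const_mul _ (by fun_prop), lintegral_indicator measurableSet_Ioi,
          Measure.restrict_restrict measurableSet_Ioi,
          inter_eq_left.2 (Ioi_subset_Ioi (le_of_lt hτ))]
    _ = ∫⁻ w in Ioi (0:ℝ), ∫⁻ τ in Ioi (0:ℝ), (Ioi τ).indicator (fun w =>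
          ENNReal.ofReal (2 * τ ^ (-(1/2) : ℝ)) * (ENNReal.ofReal (w ^ (3/2 : ℝ)) * g w ^ 2)) w := by
        refine lintegral_lintegral_swap (Measurable.aemeasurable ?_)
        have : Measurable fun p : ℝ × ℝ => {p : ℝ × ℝ | p.1 < p.2}.indicator (fun p =>
          ENNReal.ofReal (2 * p.1 ^ (-(1/2) : ℝ)) *
            (ENNReal.ofReal (p.2 ^ (3/2 : ℝ)) * g p.2 ^ 2)) p :=
          Measurable.indicator (by fun_prop) (measurableSet_lt measurable_fst measurable_snd)
        exact this
    _ = ∫⁻ w in Ioi (0:ℝ), (∫⁻ τ in Ioo (0:ℝ) w, ENNReal.ofReal (2 * τ ^ (-(1/2) : ℝ))) *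
          (ENNReal.ofReal (w ^ (3/2 : ℝ)) * g w ^ 2) := by
        refine lintegral_congr fun w => ?_
        rw [← lintegral_mul_const _ (by fun_prop), ← Ioi_inter_Iio, inter_comm,
          ← Measure.restrict_restrict measurableSet_Iio, ← lintegral_indicator measurableSet_Iio]
        refine lintegral_congr fun τ => ?_
        by_cases h : τ < w <;> simp [indicator, h]
    _ = ∫⁻ w in Ioi (0:ℝ), 4 * (ENNReal.ofReal (w ^ 2) * g w ^ 2) := by
        refine setLIntegral_congr_fun measurableSet_Ioi fun w hw => ?_
        have hw0 : 0 < w := hw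
        have : ∫⁻ τ in Ioo (0:ℝ) w, ENNReal.ofReal (2 * τ ^ (-(1/2) : ℝ)) =
            ENNReal.ofReal (4 * w ^ (1/2 : ℝ)) := by
          have hi : IntervalIntegrable (fun τ : ℝ => 2 * τ ^ (-(1/2) : ℝ)) volume 0 w :=
            (intervalIntegral.intervalIntegrable_rpow' (by norm_num)).const_mul 2
          rw [restrict_Ioo_eq_restrict_Ioc, ← ofReal_integral_eq_lintegral_ofReal
            ((intervalIntegrable_iff_integrableOn_Ioc_of_le hw0.le).1 hi)
            ((ae_restrict_mem measurableSet_Ioc).mono fun τ hτ => by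
              have hw0 : 0 < τ := hτ.1
              positivity), ← intervalIntegral.integral_of_le hw0.le,
              intervalIntegral.integral_const_mul, integral_rpow (Or.inl (by norm_num))]
          congr 1
          rw [show (-(1/2) : ℝ) + 1 = 1/2 by norm_num, Real.zero_rpow (by norm_num)]; ring
        rw [this, ← mul_assoc, ← ENNReal.ofReal_mul (by positivity), mul_assoc 4,
          ← Real.rpow_add hw0, ENNReal.ofReal_mul (by norm_num), mul_assoc,
          show (1 / 2 + 3 / 2 : ℝ) = (2 : ℕ) by norm_num, Real.rpow_natCast, ENNReal.ofReal_ofNat]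
    _ = _ := lintegral_const_mul _ (by fun_prop)

section

open ComplexConjugate

/-- Measurable profiles decaying like `(1 + ‖ξ‖)^(-k)`. -/
def Dec (k : ℕ) (h : E3 → ℂ) : Prop :=
  Measurable h ∧ ∃ C : ℝ, ∀ ξ, ‖h ξ‖ * (1 + ‖ξ‖) ^ k ≤ C

lemma Dec.mul {k l : ℕ} {h m : E3 → ℂ} {K : ℝ} (hh : Dec (k + l) h) (hm : Measurable m)
    (hK : ∀ ξ, ‖m ξ‖ ≤ K * (1 + ‖ξ‖) ^ l) : Dec k (fun ξ => m ξ * h ξ) := by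
  obtain ⟨h1, C, hC⟩ := hh
  have hK0 : 0 ≤ K := by simpa using (norm_nonneg _).trans (hK 0)
  refine ⟨hm.mul h1, K * C, fun ξ => ?_⟩
  calc _ = ‖m ξ‖ * (‖h ξ‖ * (1 + ‖ξ‖) ^ k) := by rw [norm_mul, mul_assoc]
    _ ≤ (K * (1 + ‖ξ‖) ^ l) * (‖h ξ‖ * (1 + ‖ξ‖) ^ k) := by gcongr; exact hK ξ
    _ = K * (‖h ξ‖ * (1 + ‖ξ‖) ^ (k + l)) := by ring
    _ ≤ K * C := by gcongr; exact hC ξ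

lemma Dec.mul_bdd {k : ℕ} {h m : E3 → ℂ} {K : ℝ} (hh : Dec k h) (hm : Measurable m)
    (hK : ∀ ξ, ‖m ξ‖ ≤ K) : Dec k (fun ξ => m ξ * h ξ) :=
  Dec.mul (l := 0) (K := K) hh hm (by simpa using hK)

lemma Dec.mono {k l : ℕ} {h : E3 → ℂ} (hh : Dec l h) (hkl : k ≤ l) : Dec k h := by
  obtain ⟨h1, C, hC⟩ := hh
  refine ⟨h1, C, fun ξ => le_trans ?_ (hC ξ)⟩
  gcongr
  simp

lemma Dec.integrable {k : ℕ} {h : E3 → ℂ} (hh : Dec k h) (hk : 4 ≤ k) : Integrable h := by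
  obtain ⟨h1, C, hC⟩ := hh.mono hk
  have h0 : Integrable (fun ξ : E3 => C * (1 + ‖ξ‖) ^ (-(4:ℝ))) :=
    (integrable_one_add_norm (by simp; norm_num)).const_mul C
  refine h0.mono' h1.aestronglyMeasurable (ae_of_all _ fun ξ => ?_)
  have : (0:ℝ) < 1 + ‖ξ‖ := by positivity
  rw [Real.rpow_neg this.le, ← div_eq_mul_inv, le_div_iff₀ (by positivity)]
  exact_mod_cast hC ξ

lemma Dec.bddInt {k : ℕ} {h : E3 → ℂ} (hh : Dec k h) (hk : 4 ≤ k) : BddInt volume h := by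
  obtain ⟨h1, C, hC⟩ := hh.mono (Nat.zero_le _)
  exact ⟨h1, hh.integrable hk, C, fun ξ => by simpa using hC ξ⟩

lemma Dec.memLp {k : ℕ} {h : E3 → ℂ} (hh : Dec k h) (hk : 4 ≤ k) : MemLp h 2 :=
  memLp_two_of_bdd (hh.bddInt hk)

lemma norm_exp_mul_le {s a : ℂ} (h : (s * a).re ≤ 0) : ‖Complex.exp (s * a)‖ ≤ 1 := by
  rw [Complex.norm_exp]; exact Real.exp_le_one_iff.2 h

lemma hasDerivAt_integral_exp {a H : E3 → ℂ} {s0 ε : ℝ} (ha : Measurable a) (hH : Integrable H)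
    (haH : Integrable fun ξ => a ξ * H ξ) (hε : 0 < ε)
    (hre : ∀ s ∈ ball s0 ε, ∀ ξ, ((s : ℂ) * a ξ).re ≤ 0) :
    HasDerivAt (fun s : ℝ => ∫ ξ, Complex.exp (s * a ξ) * H ξ)
      (∫ ξ, Complex.exp (s0 * a ξ) * (a ξ * H ξ)) s0 := by
  have hm : ∀ s : ℝ, Measurable fun ξ => Complex.exp (s * a ξ) := fun s => by fun_prop
  refine (hasDerivAt_integral_of_dominated_loc_of_deriv_le (ball_mem_nhds s0 hε)
    (F := fun (s : ℝ) ξ => Complex.exp (s * a ξ) * H ξ)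
    (F' := fun (s : ℝ) ξ => Complex.exp (s * a ξ) * (a ξ * H ξ))
    (bound := fun ξ => ‖a ξ * H ξ‖) ?_ ?_ ?_ ?_ haH.norm ?_).2
  · exact Filter.Eventually.of_forall fun s => (hm s).aestronglyMeasurable.mul
      hH.aestronglyMeasurable
  · refine hH.bdd_mul (c := 1) (hm s0).aestronglyMeasurable (ae_of_all _ fun ξ => ?_)
    exact norm_exp_mul_le (hre s0 (mem_ball_self hε) ξ)
  · exact (hm s0).aestronglyMeasurable.mul haH.aestronglyMeasurable
  · refine ae_of_all _ fun ξ s hs => ?_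
    rw [norm_mul]
    exact mul_le_of_le_one_left (norm_nonneg _) (norm_exp_mul_le (hre s hs ξ))
  · refine ae_of_all _ fun ξ s _ => ?_
    have h1 : HasDerivAt (fun s : ℝ => (s : ℂ) * a ξ) (1 * a ξ) s :=
      (Complex.ofRealCLM.hasDerivAt (x := s)).mul_const (a ξ)
    exact (h1.cexp.mul_const (H ξ)).congr_deriv (by ring)

/-- The heat flow `e^{τΔ/(4π²)}` applied to the function with Fourier transform `h`. -/
def heat (h : E3 → ℂ) (τ : ℝ) : E3 → ℂ :=
  𝓕⁻ fun ξ => Complex.exp (τ * ((-‖ξ‖ ^ 2 : ℝ) : ℂ)) * h ξ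

lemma heat_re {τ : ℝ} (hτ : 0 ≤ τ) (ξ : E3) : ((τ : ℂ) * ((-‖ξ‖ ^ 2 : ℝ) : ℂ)).re ≤ 0 := by
  rw [← Complex.ofReal_mul, Complex.ofReal_re]
  nlinarith [sq_nonneg ‖ξ‖, mul_nonneg hτ (sq_nonneg ‖ξ‖)]

lemma Dec.heat {k : ℕ} {h : E3 → ℂ} (hh : Dec k h) {τ : ℝ} (hτ : 0 ≤ τ) :
    Dec k fun ξ => Complex.exp (τ * ((-‖ξ‖ ^ 2 : ℝ) : ℂ)) * h ξ :=
  hh.mul_bdd (K := 1) (by fun_prop) fun ξ => norm_exp_mul_le (heat_re hτ ξ)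

lemma norm_heat_le {h : E3 → ℂ} (hh : Dec 4 h) {τ : ℝ} (hτ : 0 ≤ τ) (x : E3) :
    ‖heat h τ x‖ ≤ ∫ ξ, ‖h ξ‖ := by
  refine (norm_fourierInv_le3 _ x).trans (integral_mono ((hh.heat hτ).integrable le_rfl).norm
    (hh.integrable le_rfl).norm fun ξ => ?_)
  simp only [norm_mul]
  exact mul_le_of_le_one_left (norm_nonneg _) (norm_exp_mul_le (heat_re hτ ξ))

lemma eLpNorm_heat_le {h : E3 → ℂ} (hh : Dec 4 h) {τ : ℝ} (hτ : 0 ≤ τ) :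
    eLpNorm (heat h τ) 2 volume ≤ eLpNorm h 2 volume := by
  have hd := hh.heat hτ
  rw [heat, eLpNorm_fourierInv (hd.integrable le_rfl) (hd.memLp le_rfl)]
  refine eLpNorm_mono fun ξ => ?_
  rw [norm_mul]
  exact mul_le_of_le_one_left (norm_nonneg _) (norm_exp_mul_le (heat_re hτ ξ))

lemma memLp_heat {h : E3 → ℂ} (hh : Dec 4 h) {τ : ℝ} (hτ : 0 ≤ τ) : MemLp (heat h τ) 2 :=
  memLp_fourierInv ((hh.heat hτ).integrable le_rfl) ((hh.heat hτ).memLp le_rfl)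

lemma continuous_heat {h : E3 → ℂ} (hh : Dec 4 h) {τ : ℝ} (hτ : 0 ≤ τ) : Continuous (heat h τ) :=
  continuous_fourierInv3 ((hh.heat hτ).integrable le_rfl)

lemma measurable_heat {h : E3 → ℂ} (hh : Measurable h) :
    Measurable fun p : ℝ × E3 => heat h p.1 p.2 := by
  refine measurable_fourierInv_param
    (K := fun (τ : ℝ) (ξ : E3) => Complex.exp (τ * ((-‖ξ‖ ^ 2 : ℝ) : ℂ)) * h ξ) ?_
  refine Measurable.mul ?_ (hh.comp measurable_snd)
  fun_prop

lemma heat_eq (h : E3 → ℂ) (τ : ℝ) (x : E3) : heat h τ x =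
    ∫ ξ, Complex.exp (τ * ((-‖ξ‖ ^ 2 : ℝ) : ℂ)) *
      (Complex.exp ((2 * Real.pi * ⟪ξ, x⟫ : ℝ) * Complex.I) * h ξ) := by
  rw [heat, Real.fourierInv_eq']
  congr 1; ext ξ
  rw [smul_eq_mul]; ring

lemma norm_phase (r : ℝ) : ‖Complex.exp ((r : ℂ) * Complex.I)‖ = 1 := Complex.norm_exp_ofReal_mul_I r

lemma heat_hasDerivAt_time {h : E3 → ℂ} (hh : Dec 6 h) {τ : ℝ} (hτ : 0 < τ) (x : E3) :
    HasDerivAt (fun s => heat h s x) (heat (fun ξ => ((-‖ξ‖ ^ 2 : ℝ) : ℂ) * h ξ) τ x) τ := by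
  have hd : Dec 4 (fun ξ => ((-‖ξ‖ ^ 2 : ℝ) : ℂ) * h ξ) := by
    refine Dec.mul (l := 2) (K := 1) hh (by fun_prop) fun ξ => ?_
    rw [Complex.norm_real, norm_neg, norm_pow, norm_norm, one_mul]
    gcongr; linarith
  have hp : Measurable fun ξ : E3 => Complex.exp ((2 * Real.pi * ⟪ξ, x⟫ : ℝ) * Complex.I) := by
    fun_prop
  simp only [heat_eq]
  have h1 := hasDerivAt_integral_exp (a := fun ξ => ((-‖ξ‖ ^ 2 : ℝ) : ℂ))
    (H := fun ξ => Complex.exp ((2 * Real.pi * ⟪ξ, x⟫ : ℝ) * Complex.I) * h ξ) (s0 := τ)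
    (by fun_prop)
    ((hh.mul_bdd (K := 1) hp fun ξ => (norm_phase _).le).integrable (by norm_num)) ?_ hτ
    fun s hs ξ => heat_re (by
      rw [mem_ball, Real.dist_eq, abs_lt] at hs; linarith) ξ
  · convert h1 using 2
    ext ξ; ring
  · refine ((hd.mul_bdd (K := 1) hp fun ξ => (norm_phase _).le).integrable le_rfl).congr
      (ae_of_all _ fun ξ => ?_)
    simp only; ring

/-- The symbol of the `j`-th partial derivative. -/
def dsym (j : Fin 3) (ξ : E3) : ℂ := ((2 * Real.pi * ξ j : ℝ) : ℂ) * Complex.I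

lemma measurable_dsym (j : Fin 3) : Measurable (dsym j) := by unfold dsym; fun_prop

lemma norm_dsym_le (j : Fin 3) (ξ : E3) : ‖dsym j ξ‖ ≤ 2 * Real.pi * ‖ξ‖ := by
  rw [dsym, norm_mul, Complex.norm_I, mul_one, Complex.norm_real, norm_mul,
    Real.norm_of_nonneg (by positivity)]
  gcongr
  exact PiLp.norm_apply_le ξ j

lemma Dec.dsym {k : ℕ} {h : E3 → ℂ} (hh : Dec (k + 1) h) (j : Fin 3) :
    Dec k fun ξ => dsym j ξ * h ξ := by
  refine Dec.mul (l := 1) (K := 2 * Real.pi) hh (measurable_dsym j) fun ξ => ?_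
  refine (norm_dsym_le j ξ).trans ?_
  gcongr; linarith

lemma heat_hasLineDerivAt {h : E3 → ℂ} (hh : Dec 5 h) {τ : ℝ} (hτ : 0 ≤ τ) (x : E3) (j : Fin 3) :
    HasLineDerivAt ℝ (heat h τ) (heat (fun ξ => dsym j ξ * h ξ) τ x) x
      (EuclideanSpace.single j 1) := by
  have hd : Dec 4 (fun ξ => dsym j ξ * (Complex.exp (τ * ((-‖ξ‖ ^ 2 : ℝ) : ℂ)) * h ξ)) :=
    (hh.heat hτ).dsym j
  have hp : Measurable fun ξ : E3 => Complex.exp ((2 * Real.pi * ⟪ξ, x⟫ : ℝ) * Complex.I) := by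
    fun_prop
  have h1 := hasDerivAt_integral_exp (a := dsym j)
    (H := fun ξ => Complex.exp ((2 * Real.pi * ⟪ξ, x⟫ : ℝ) * Complex.I) *
      (Complex.exp (τ * ((-‖ξ‖ ^ 2 : ℝ) : ℂ)) * h ξ)) (s0 := 0) (measurable_dsym j)
    (((hh.heat hτ).mul_bdd (K := 1) hp fun ξ => (norm_phase _).le).integrable (by norm_num)) ?_
    one_pos fun s _ ξ => by
      rw [dsym, ← mul_assoc, ← Complex.ofReal_mul, Complex.re_ofReal_mul]; simp
  · have e1 : (fun s : ℝ => heat h τ (x + s • EuclideanSpace.single j 1)) = fun s : ℝ =>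
        ∫ ξ, Complex.exp (s * dsym j ξ) *
          (Complex.exp ((2 * Real.pi * ⟪ξ, x⟫ : ℝ) * Complex.I) *
            (Complex.exp (τ * ((-‖ξ‖ ^ 2 : ℝ) : ℂ)) * h ξ)) := by
      ext s
      rw [heat_eq]
      congr 1; ext ξ
      have : (s : ℂ) * dsym j ξ = ((2 * Real.pi * (s * ξ j) : ℝ) : ℂ) * Complex.I := by
        rw [dsym]; push_cast; ring
      rw [this, inner_add_right, inner_smul_right, EuclideanSpace.inner_single_right]
      simp only [conj_trivial, one_mul, mul_add, Complex.ofReal_add, add_mul, Complex.exp_add]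
      ring
    have e2 : heat (fun ξ => dsym j ξ * h ξ) τ x =
        ∫ ξ, Complex.exp ((0 : ℝ) * dsym j ξ) *
          (dsym j ξ * (Complex.exp ((2 * Real.pi * ⟪ξ, x⟫ : ℝ) * Complex.I) *
            (Complex.exp (τ * ((-‖ξ‖ ^ 2 : ℝ) : ℂ)) * h ξ))) := by
      rw [heat_eq]
      congr 1; ext ξ
      simp only [Complex.ofReal_zero, zero_mul, Complex.exp_zero, one_mul]
      ring
    rw [HasLineDerivAt, e1, e2]
    exact h1
  · refine ((hd.mul_bdd (K := 1) hp fun ξ => (norm_phase _).le).integrable le_rfl).congr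
      (ae_of_all _ fun ξ => ?_)
    simp only; ring

lemma dsym_sq_sum (ξ : E3) : ∑ j, dsym j ξ * dsym j ξ = ((4 * Real.pi ^ 2 : ℝ) : ℂ) *
    ((-‖ξ‖ ^ 2 : ℝ) : ℂ) := by
  rw [EuclideanSpace.real_norm_sq_eq]
  push_cast
  rw [← Finset.sum_neg_distrib, Finset.mul_sum]
  refine Finset.sum_congr rfl fun j _ => ?_
  rw [dsym]
  push_cast
  linear_combination (4 * Real.pi ^ 2 * ξ j ^ 2 : ℂ) * Complex.I_sq

end

section

open ComplexConjugate

/-- The map `v ↦ |v|^(q-2) v`. -/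
def powG (q : ℝ) (v : ℂ) : ℂ := ((‖v‖ ^ (q - 2) : ℝ) : ℂ) * v

/-- The derivative of `powG q` at `v` in the direction `w`. -/
def powG' (q : ℝ) (v w : ℂ) : ℂ := ((‖v‖ ^ (q - 2) : ℝ) : ℂ) * w +
  (((q - 2) * ‖v‖ ^ (q - 4) * ⟪v, w⟫ : ℝ) : ℂ) * v

lemma hasDerivAt_norm_rpow_comp {v : ℝ → ℂ} {v' : ℂ} {s p : ℝ} (hv : HasDerivAt v v' s)
    (h : v s ≠ 0 ∨ 2 ≤ p) :
    HasDerivAt (fun s => ‖v s‖ ^ p) (p * ‖v s‖ ^ (p - 2) * ⟪v s, v'⟫) s := by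
  have h1 := hv.norm_sq.rpow_const (p := p / 2) (h.imp (fun h => by simpa using h)
    (fun h => by linarith))
  have e : ∀ (z : ℂ) (r : ℝ), (‖z‖ ^ 2) ^ (r / 2) = ‖z‖ ^ r := fun z r => by
    rw [← Real.rpow_natCast, ← Real.rpow_mul (norm_nonneg _)]; congr 1; push_cast; ring
  rw [show p / 2 - 1 = (p - 2) / 2 by ring] at h1
  simp only [e] at h1
  exact h1.congr_deriv (by ring)

lemma hasDerivAt_powG {v : ℝ → ℂ} {v' : ℂ} {s q : ℝ} (hq : 2 < q) (hv : HasDerivAt v v' s) :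
    HasDerivAt (fun s => powG q (v s)) (powG' q (v s) v') s := by
  by_cases h0 : v s = 0
  · rw [hasDerivAt_iff_tendsto_slope] at hv ⊢
    have hc : Filter.Tendsto (fun t => ((‖v t‖ ^ (q - 2) : ℝ) : ℂ)) (nhdsWithin s {s}ᶜ)
        (nhds ((‖v s‖ ^ (q - 2) : ℝ) : ℂ)) := by
      rw [← hasDerivAt_iff_tendsto_slope] at hv
      refine (Complex.continuous_ofReal.tendsto _).comp ?_
      exact ((hv.continuousAt.norm.rpow_const (Or.inr (by linarith))).tendsto).mono_left
        nhdsWithin_le_nhds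
    have := hc.mul hv
    rw [powG', h0, mul_zero, add_zero]
    rw [h0] at this
    refine this.congr fun t => ?_
    simp only [slope_def_module, powG, h0, mul_zero, sub_zero, Complex.real_smul]
    ring
  · have h1 := (hasDerivAt_norm_rpow_comp (p := q - 2) hv (Or.inl h0)).ofReal_comp.mul hv
    refine h1.congr_deriv ?_
    rw [powG', show q - 2 - 2 = q - 4 by ring]
    ring

lemma norm_powG (q : ℝ) (v : ℂ) : ‖powG q v‖ = ‖v‖ ^ (q - 2) * ‖v‖ := by
  rw [powG, norm_mul, Complex.norm_real, Real.norm_of_nonneg (by positivity)]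

lemma norm_powG'_le {q : ℝ} (hq : 2 < q) (v w : ℂ) :
    ‖powG' q v w‖ ≤ (q - 1) * ‖v‖ ^ (q - 2) * ‖w‖ := by
  have hq2 : 0 < q - 2 := by linarith
  refine (norm_add_le _ _).trans ?_
  rw [norm_mul, norm_mul, Complex.norm_real, Complex.norm_real,
    Real.norm_of_nonneg (by positivity)]
  have h1 : ‖(q - 2) * ‖v‖ ^ (q - 4) * ⟪v, w⟫‖ * ‖v‖ ≤ (q - 2) * ‖v‖ ^ (q - 2) * ‖w‖ := by
    rcases eq_or_ne v 0 with rfl | hv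
    · simp [Real.zero_rpow hq2.ne']
    have hv0 : 0 < ‖v‖ := norm_pos_iff.2 hv
    rw [norm_mul, Real.norm_of_nonneg (by positivity)]
    have h2 : ‖v‖ ^ (q - 2) = ‖v‖ ^ (q - 4) * ‖v‖ * ‖v‖ := by
      rw [← Real.rpow_add_one hv0.ne', ← Real.rpow_add_one hv0.ne']; ring_nf
    calc _ ≤ (q - 2) * ‖v‖ ^ (q - 4) * (‖v‖ * ‖w‖) * ‖v‖ := by
          gcongr; exact norm_inner_le_norm v w
      _ = _ := by rw [h2]; ring
  linarith

lemma measurable_powG (q : ℝ) : Measurable (powG q) :=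
  (Complex.measurable_ofReal.comp (measurable_norm.pow_const _)).mul measurable_id

lemma measurable_powG' (q : ℝ) {α : Type*} [MeasurableSpace α] {v w : α → ℂ} (hv : Measurable v)
    (hw : Measurable w) : Measurable fun x => powG' q (v x) (w x) := by
  unfold powG'
  refine ((Complex.measurable_ofReal.comp (hv.norm.pow_const _)).mul hw).add
    ((Complex.measurable_ofReal.comp ?_).mul hv)
  exact ((hv.norm.pow_const _).const_mul _).mul (hv.inner hw)

lemma integrable_of_norm_le_mul {f a b : E3 → ℂ} {c : ℝ} (hf : Measurable f) (ha : MemLp a 2)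
    (hb : MemLp b 2) (h : ∀ x, ‖f x‖ ≤ c * (‖a x‖ * ‖b x‖)) : Integrable f :=
  ((ha.norm.integrable_mul hb.norm).const_mul c).mono' hf.aestronglyMeasurable (ae_of_all _ h)

/-- The energy inequality in one coordinate direction. -/
lemma heat_by_parts {q : ℝ} (hq : 2 < q) {h : E3 → ℂ} (hh : Dec 6 h) {τ : ℝ} (hτ : 0 ≤ τ)
    (j : Fin 3) :
    ‖∫ x, powG q (heat h τ x) * conj (heat (fun ξ => dsym j ξ * (dsym j ξ * h ξ)) τ x)‖ ≤
      (q - 1) * ∫ x, ‖heat h τ x‖ ^ (q - 2) * ‖heat (fun ξ => dsym j ξ * h ξ) τ x‖ ^ 2 := by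
  have hq2 : 0 ≤ q - 2 := by linarith
  have h1 : Dec 5 (fun ξ => dsym j ξ * h ξ) := hh.dsym j
  have h2 : Dec 4 (fun ξ => dsym j ξ * (dsym j ξ * h ξ)) := h1.dsym j
  have h14 := h1.mono (k := 4) (by norm_num)
  have h04 := hh.mono (k := 4) (by norm_num)
  obtain ⟨u, hu⟩ : ∃ u, u = heat h τ := ⟨_, rfl⟩
  obtain ⟨v, hv⟩ : ∃ v, v = heat (fun ξ => dsym j ξ * h ξ) τ := ⟨_, rfl⟩
  obtain ⟨w, hw⟩ : ∃ w, w = heat (fun ξ => dsym j ξ * (dsym j ξ * h ξ)) τ := ⟨_, rfl⟩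
  have hum : Measurable u := hu ▸ (continuous_heat h04 hτ).measurable
  have hvm : Measurable v := hv ▸ (continuous_heat h14 hτ).measurable
  have hwm : Measurable w := hw ▸ (continuous_heat h2 hτ).measurable
  have hu2 : MemLp u 2 := hu ▸ memLp_heat h04 hτ
  have hv2 : MemLp v 2 := hv ▸ memLp_heat h14 hτ
  have hw2 : MemLp w 2 := hw ▸ memLp_heat h2 hτ
  obtain ⟨K, hK⟩ : ∃ K : ℝ, ∀ x, ‖u x‖ ≤ K := ⟨_, fun x => hu ▸ norm_heat_le h04 hτ x⟩
  have hcj : ∀ {f : E3 → ℂ}, Measurable f → Measurable fun x => conj (f x) := fun hf =>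
    Complex.continuous_conj.measurable.comp hf
  rw [← hu, ← hv, ← hw]
  have hbd : ∀ x, ‖powG' q (u x) (v x) * conj (v x)‖ ≤
      (q - 1) * (‖u x‖ ^ (q - 2) * ‖v x‖ ^ 2) := fun x => by
    rw [norm_mul, Complex.norm_conj]
    calc _ ≤ ((q - 1) * ‖u x‖ ^ (q - 2) * ‖v x‖) * ‖v x‖ := by
          gcongr; exact norm_powG'_le hq _ _
      _ = _ := by ring
  have hi1 : Integrable fun x => powG' q (u x) (v x) * conj (v x) := by
    refine integrable_of_norm_le_mul (c := (q - 1) * K ^ (q - 2))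
      ((measurable_powG' q hum hvm).mul (hcj hvm)) hv2 hv2 fun x => (hbd x).trans ?_
    have : 0 ≤ q - 1 := by linarith
    calc _ ≤ (q - 1) * (K ^ (q - 2) * ‖v x‖ ^ 2) := by gcongr; exact hK x
      _ = _ := by ring
  have hGi : ∀ {g : E3 → ℂ}, Measurable g → MemLp g 2 →
      Integrable fun x => powG q (u x) * conj (g x) := fun {g} hg hg2 => by
    refine integrable_of_norm_le_mul (c := K ^ (q - 2))
      (((measurable_powG q).comp hum).mul (hcj hg)) hu2 hg2 fun x => ?_
    rw [norm_mul, Complex.norm_conj, norm_powG, mul_assoc]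
    gcongr
    exact hK x
  have hip := integral_bilinear_hasLineDerivAt_right_eq_neg_left_of_integrable
    (μ := (volume : Measure E3)) (f := fun x => powG q (u x)) (f' := fun x => powG' q (u x) (v x))
    (g := fun x => conj (v x)) (g' := fun x => conj (w x)) (v := EuclideanSpace.single j (1:ℝ))
    (B := ContinuousLinearMap.mul ℝ ℂ) hi1 (hGi hwm hw2) (hGi hvm hv2)
    (fun x _ => ?_) (fun x _ => ?_)
  · simp only [ContinuousLinearMap.mul_apply'] at hip
    rw [hip, norm_neg, ← integral_const_mul]
    refine norm_integral_le_of_norm_le ?_ (ae_of_all _ hbd)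
    refine Integrable.const_mul ?_ _
    have : Integrable fun x => K ^ (q - 2) * ‖v x‖ ^ 2 :=
      (hv2.integrable_norm_pow two_ne_zero).const_mul _
    refine this.mono' ((hum.norm.pow_const _).mul (hvm.norm.pow_const _)).aestronglyMeasurable
      (ae_of_all _ fun x => ?_)
    rw [Real.norm_of_nonneg (by positivity)]
    gcongr
    exact hK x
  · have := heat_hasLineDerivAt (hh.mono (by norm_num)) hτ x j
    rw [← hu, ← hv, HasLineDerivAt] at this
    have h3 := hasDerivAt_powG hq this
    rw [zero_smul, add_zero] at h3
    exact h3
  · have := heat_hasLineDerivAt h1 hτ x j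
    rw [← hv, ← hw, HasLineDerivAt] at this
    exact this.star

end

section

open ComplexConjugate

lemma heat_add {h k : E3 → ℂ} (hh : Dec 4 h) (hk : Dec 4 k) {τ : ℝ} (hτ : 0 ≤ τ) (x : E3) :
    heat (fun ξ => h ξ + k ξ) τ x = heat h τ x + heat k τ x := by
  simp only [heat_eq]
  have hp : Measurable fun ξ : E3 => Complex.exp ((2 * Real.pi * ⟪ξ, x⟫ : ℝ) * Complex.I) := by
    fun_prop
  have hi : ∀ {h : E3 → ℂ}, Dec 4 h → Integrable fun ξ : E3 =>
      Complex.exp (τ * ((-‖ξ‖ ^ 2 : ℝ) : ℂ)) *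
        (Complex.exp ((2 * Real.pi * ⟪ξ, x⟫ : ℝ) * Complex.I) * h ξ) := fun hh =>
    ((hh.mul_bdd (K := 1) hp fun ξ => (norm_phase _).le).heat hτ).integrable le_rfl
  rw [← integral_add (hi hh) (hi hk)]
  congr 1; ext ξ; ring

lemma heat_const_mul (c : ℂ) (h : E3 → ℂ) (τ : ℝ) (x : E3) :
    heat (fun ξ => c * h ξ) τ x = c * heat h τ x := by
  simp only [heat_eq]
  rw [← integral_const_mul]
  congr 1; ext ξ; ring

lemma heat_laplacian {h : E3 → ℂ} (hh : Dec 6 h) {τ : ℝ} (hτ : 0 ≤ τ) (x : E3) :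
    ∑ j, heat (fun ξ => dsym j ξ * (dsym j ξ * h ξ)) τ x =
      ((4 * Real.pi ^ 2 : ℝ) : ℂ) * heat (fun ξ => ((-‖ξ‖ ^ 2 : ℝ) : ℂ) * h ξ) τ x := by
  have hd : ∀ j, Dec 4 (fun ξ => dsym j ξ * (dsym j ξ * h ξ)) := fun j =>
    Dec.dsym (Dec.dsym hh j) j
  rw [← heat_const_mul, Fin.sum_univ_three, ← heat_add (hd 0) (hd 1) hτ, ← heat_add ?_ (hd 2) hτ]
  · congr 1; ext ξ
    rw [← mul_assoc ((4 * Real.pi ^ 2 : ℝ) : ℂ), ← dsym_sq_sum, Fin.sum_univ_three]; ring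
  · obtain ⟨m0, C0, h0⟩ := hd 0
    obtain ⟨m1, C1, h1⟩ := hd 1
    refine ⟨m0.add m1, C0 + C1, fun ξ => ?_⟩
    refine le_trans ?_ (add_le_add (h0 ξ) (h1 ξ))
    rw [← add_mul]
    gcongr
    exact norm_add_le _ _

lemma inner_complex_eq (a b : ℂ) : ⟪a, b⟫ = (a * conj b).re := by
  rw [Complex.inner]; simp only [Complex.mul_re, Complex.conj_re, Complex.conj_im]; ring

/-- Energy dissipation in `L^q` at a fixed time. -/
lemma heat_dissipation {q : ℝ} (hq : 2 < q) {h : E3 → ℂ} (hh : Dec 6 h) {τ : ℝ} (hτ : 0 ≤ τ) :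
    ‖∫ x, q * ‖heat h τ x‖ ^ (q - 2) *
        ⟪heat h τ x, heat (fun ξ => ((-‖ξ‖ ^ 2 : ℝ) : ℂ) * h ξ) τ x⟫‖ ≤
      q * (q - 1) * ∑ j, ∫ x, ‖heat h τ x‖ ^ (q - 2) *
        ‖heat (fun ξ => dsym j ξ * h ξ) τ x‖ ^ 2 := by
  have hq2 : 0 ≤ q - 2 := by linarith
  have h04 := hh.mono (k := 4) (by norm_num)
  have h2 : ∀ j, Dec 4 (fun ξ => dsym j ξ * (dsym j ξ * h ξ)) := fun j => Dec.dsym (Dec.dsym hh j) j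
  obtain ⟨K, hK⟩ : ∃ K : ℝ, ∀ x, ‖heat h τ x‖ ≤ K := ⟨_, fun x => norm_heat_le h04 hτ x⟩
  have hcj : ∀ {f : E3 → ℂ}, Measurable f → Measurable fun x => conj (f x) := fun hf =>
    Complex.continuous_conj.measurable.comp hf
  have hGi : ∀ j, Integrable fun x => powG q (heat h τ x) *
      conj (heat (fun ξ => dsym j ξ * (dsym j ξ * h ξ)) τ x) := fun j => by
    have hgm := (continuous_heat (h2 j) hτ).measurable
    refine integrable_of_norm_le_mul (c := K ^ (q - 2))
      (((measurable_powG q).comp (continuous_heat h04 hτ).measurable).mul (hcj hgm))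
      (memLp_heat h04 hτ) (memLp_heat (h2 j) hτ) fun x => ?_
    rw [norm_mul, Complex.norm_conj, norm_powG, mul_assoc]
    gcongr
    exact hK x
  have e : ∫ x, q * ‖heat h τ x‖ ^ (q - 2) *
        ⟪heat h τ x, heat (fun ξ => ((-‖ξ‖ ^ 2 : ℝ) : ℂ) * h ξ) τ x⟫ =
      q * (1 / (4 * Real.pi ^ 2)) * (∑ j, ∫ x, powG q (heat h τ x) *
        conj (heat (fun ξ => dsym j ξ * (dsym j ξ * h ξ)) τ x)).re := by
    rw [← integral_finsetSum _ fun j _ => hGi j]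
    have hInt := integrable_finsetSum (μ := volume) Finset.univ fun j _ => hGi j
    rw [show ∀ z : ℂ, z.re = RCLike.re z from fun _ => rfl, ← integral_re hInt,
      ← integral_const_mul]
    congr 1; ext x
    rw [← Finset.mul_sum, ← map_sum, heat_laplacian hh hτ, inner_complex_eq, powG]
    simp only [map_mul, Complex.conj_ofReal, RCLike.re_eq_complex_re]
    rw [show ∀ a b c d : ℂ, a * b * (c * d) = (a * c) * (b * d) from fun a b c d => by ring,
      ← Complex.ofReal_mul, Complex.re_ofReal_mul]
    field_simp
  rw [e, norm_mul, Real.norm_of_nonneg (by positivity), mul_assoc, mul_assoc]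
  refine mul_le_mul_of_nonneg_left ?_ (by linarith)
  have h1 : 1 / (4 * Real.pi ^ 2) ≤ 1 := by
    rw [div_le_one (by positivity)]
    nlinarith [Real.pi_gt_three]
  calc _ ≤ 1 * ‖∑ j, ∫ x, powG q (heat h τ x) *
        conj (heat (fun ξ => dsym j ξ * (dsym j ξ * h ξ)) τ x)‖ := by
        gcongr
        exact Complex.abs_re_le_norm _
    _ ≤ ∑ j, ‖∫ x, powG q (heat h τ x) *
        conj (heat (fun ξ => dsym j ξ * (dsym j ξ * h ξ)) τ x)‖ := by
        rw [one_mul]; exact norm_sum_le _ _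
    _ ≤ ∑ j, (q - 1) * ∫ x, ‖heat h τ x‖ ^ (q - 2) *
        ‖heat (fun ξ => dsym j ξ * h ξ) τ x‖ ^ 2 :=
        Finset.sum_le_sum fun j _ => heat_by_parts hq hh hτ j
    _ = _ := by rw [Finset.mul_sum]

lemma ofReal_integral_mul_sq_le {a b : E3 → ℂ} {r : ℝ} (hr : 0 ≤ r) :
    ENNReal.ofReal (∫ x, ‖a x‖ ^ r * ‖b x‖ ^ 2) ≤ ∫⁻ x, ‖a x‖ₑ ^ r * ‖b x‖ₑ ^ 2 := by
  refine (Real.ofReal_le_enorm _).trans ((enorm_integral_le_lintegral_enorm _).trans_eq ?_)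
  congr 1; ext x
  rw [enorm_mul, enorm_pow, enorm_norm, Real.enorm_rpow_of_nonneg (norm_nonneg _) hr, enorm_norm]

lemma lintegral_heat_sq_le {h : E3 → ℂ} (hh : Dec 4 h) {τ : ℝ} (hτ : 0 ≤ τ) :
    ∫⁻ x, ‖heat h τ x‖ₑ ^ 2 ≤ ∫⁻ ξ, ‖h ξ‖ₑ ^ 2 := by
  have := eLpNorm_heat_le hh hτ
  rw [eLpNorm_eq_lintegral_rpow_enorm_toReal two_ne_zero ENNReal.ofNat_ne_top,
    eLpNorm_eq_lintegral_rpow_enorm_toReal two_ne_zero ENNReal.ofNat_ne_top] at this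
  have h2 := (ENNReal.rpow_le_rpow_iff (by simp)).1 this
  simpa using h2

lemma lintegral_sq_lt_top {h : E3 → ℂ} (hh : Dec 4 h) : ∫⁻ ξ, ‖h ξ‖ₑ ^ 2 < ∞ := by
  have := (hh.memLp le_rfl).integrable_norm_pow two_ne_zero
  simpa [HasFiniteIntegral] using this.2

lemma integrable_heat_rpow {q : ℝ} (hq : 2 < q) {h : E3 → ℂ} (hh : Dec 4 h) {τ : ℝ} (hτ : 0 ≤ τ) :
    Integrable fun x => ‖heat h τ x‖ ^ q := by
  obtain ⟨K, hK⟩ : ∃ K : ℝ, ∀ x, ‖heat h τ x‖ ≤ K := ⟨_, fun x => norm_heat_le hh hτ x⟩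
  have h2 := memLp_heat hh hτ
  refine ((h2.integrable_norm_pow two_ne_zero).const_mul (K ^ (q - 2))).mono'
    ((continuous_heat hh hτ).measurable.norm.pow_const _).aestronglyMeasurable
    (ae_of_all _ fun x => ?_)
  rw [Real.norm_of_nonneg (by positivity), ← rpow_test_mul (norm_nonneg _) (P := q) (q := 2)
    (by linarith) two_pos, Real.rpow_two]
  have : 0 ≤ q - 2 := by linarith
  gcongr
  exact hK x

lemma continuousOn_heat_time {h : E3 → ℂ} (hh : Dec 4 h) (x : E3) :
    ContinuousOn (fun τ => heat h τ x) (Ici 0) := by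
  simp only [heat_eq]
  have hp : Measurable fun ξ : E3 => Complex.exp ((2 * Real.pi * ⟪ξ, x⟫ : ℝ) * Complex.I) := by
    fun_prop
  refine continuousOn_of_dominated (bound := fun ξ => ‖h ξ‖) (fun τ _ => ?_) (fun τ hτ => ?_)
    (hh.integrable le_rfl).norm (ae_of_all _ fun ξ => ?_)
  · exact (Measurable.mul (by fun_prop) (hp.mul hh.1)).aestronglyMeasurable
  · refine ae_of_all _ fun ξ => ?_
    rw [norm_mul, norm_mul, norm_phase, one_mul]
    exact mul_le_of_le_one_left (norm_nonneg _) (norm_exp_mul_le (heat_re hτ ξ))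
  · exact Continuous.continuousOn (by fun_prop)

lemma dec_laplacian {k : ℕ} {h : E3 → ℂ} (hh : Dec (k + 2) h) :
    Dec k fun ξ => ((-‖ξ‖ ^ 2 : ℝ) : ℂ) * h ξ := by
  refine Dec.mul (l := 2) (K := 1) hh (by fun_prop) fun ξ => ?_
  rw [Complex.norm_real, norm_neg, norm_pow, norm_norm, one_mul]
  gcongr; linarith

/-- The energy inequality in `L^q` for the heat flow. -/
lemma heat_energy {q : ℝ} (hq : 2 < q) {h : E3 → ℂ} (hh : Dec 6 h) {a T : ℝ} (ha : 0 ≤ a)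
    (haT : a ≤ T) :
    ∫⁻ x, ‖heat h a x‖ₑ ^ q ≤ (∫⁻ x, ‖heat h T x‖ₑ ^ q) +
      ENNReal.ofReal (q * (q - 1)) * ∫⁻ τ in Ioc a T, ∑ j, ∫⁻ x, ‖heat h τ x‖ₑ ^ (q - 2) *
        ‖heat (fun ξ => dsym j ξ * h ξ) τ x‖ₑ ^ 2 := by
  have hq2 : 0 ≤ q - 2 := by linarith
  have h04 := hh.mono (k := 4) (by norm_num)
  have hw4 : Dec 4 (fun ξ => ((-‖ξ‖ ^ 2 : ℝ) : ℂ) * h ξ) := dec_laplacian hh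
  obtain ⟨u, hu⟩ : ∃ u, u = heat h := ⟨_, rfl⟩
  obtain ⟨w, hw⟩ : ∃ w, w = heat (fun ξ => ((-‖ξ‖ ^ 2 : ℝ) : ℂ) * h ξ) := ⟨_, rfl⟩
  obtain ⟨k, hk⟩ : ∃ k : ℝ × E3 → ℝ, ∀ p, k p = q * ‖u p.1 p.2‖ ^ (q - 2) * ⟪u p.1 p.2, w p.1 p.2⟫ :=
    ⟨_, fun _ => rfl⟩
  have hum : Measurable fun p : ℝ × E3 => u p.1 p.2 := hu ▸ measurable_heat hh.1
  have hwm : Measurable fun p : ℝ × E3 => w p.1 p.2 := hw ▸ measurable_heat hw4.1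
  have hkm : Measurable k := by
    rw [funext hk]
    exact ((hum.norm.pow_const _).const_mul _).mul (hum.inner hwm)
  obtain ⟨K, hK⟩ : ∃ K : ℝ, ∀ τ, 0 ≤ τ → ∀ x, ‖u τ x‖ ≤ K :=
    ⟨_, fun τ hτ x => hu ▸ norm_heat_le h04 hτ x⟩
  have hkint : Integrable k ((volume.restrict (Ioc a T)).prod volume) := by
    refine ⟨hkm.aestronglyMeasurable, ?_⟩
    rw [HasFiniteIntegral, lintegral_prod _ hkm.enorm.aemeasurable]
    have hb : ∀ τ ∈ Ioc a T, ∫⁻ x, ‖k (τ, x)‖ₑ ≤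
        ENNReal.ofReal (q * K ^ (q - 2)) * ((∫⁻ ξ, ‖h ξ‖ₑ ^ 2) +
          ∫⁻ ξ, ‖((-‖ξ‖ ^ 2 : ℝ) : ℂ) * h ξ‖ₑ ^ 2) := by
      intro τ hτ
      have hτ0 : 0 ≤ τ := ha.trans hτ.1.le
      have hut : Measurable (u τ) := hu ▸ (continuous_heat h04 hτ0).measurable
      refine le_trans ?_ (mul_le_mul_right (add_le_add (lintegral_heat_sq_le h04 hτ0)
        (lintegral_heat_sq_le hw4 hτ0)) _)
      rw [← hu, ← hw, ← lintegral_add_left (hut.enorm.pow_const _), ← lintegral_const_mul']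
      swap; · exact ENNReal.ofReal_ne_top
      refine lintegral_mono fun x => ?_
      simp only [hk]
      rw [← ofReal_norm, ← ofReal_norm, ← ofReal_norm, ← ENNReal.ofReal_pow (norm_nonneg _),
        ← ENNReal.ofReal_pow (norm_nonneg _), ← ENNReal.ofReal_add (by positivity) (by positivity),
        ← ENNReal.ofReal_mul' (by positivity)]
      refine ENNReal.ofReal_le_ofReal ?_
      rw [norm_mul, Real.norm_of_nonneg (by positivity)]
      have h1 := norm_inner_le_norm (𝕜 := ℝ) (u τ x) (w τ x)
      have h2 : ‖u τ x‖ * ‖w τ x‖ ≤ ‖u τ x‖ ^ 2 + ‖w τ x‖ ^ 2 := by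
        nlinarith [sq_nonneg (‖u τ x‖ - ‖w τ x‖), sq_nonneg ‖u τ x‖, sq_nonneg ‖w τ x‖]
      have := hK τ hτ0 x
      have hK0 : 0 ≤ K := (norm_nonneg _).trans this
      gcongr
      exact h1.trans h2
    refine (setLIntegral_mono' measurableSet_Ioc hb).trans_lt ?_
    rw [setLIntegral_const]
    refine ENNReal.mul_lt_top (ENNReal.mul_lt_top ENNReal.ofReal_lt_top ?_) (by simp)
    exact ENNReal.add_lt_top.2 ⟨lintegral_sq_lt_top h04, lintegral_sq_lt_top hw4⟩
  have hpt : ∀ᵐ x, ‖u T x‖ ^ q - ‖u a x‖ ^ q = ∫ τ in Ioc a T, k (τ, x) := by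
    filter_upwards [hkint.prod_left_ae] with x hx
    rw [← intervalIntegral.integral_of_le haT]
    refine (intervalIntegral.integral_eq_sub_of_hasDerivAt_of_le haT
      (f := fun τ => ‖u τ x‖ ^ q) ?_ (fun τ hτ => ?_) ?_).symm
    · rw [hu]
      exact (((continuousOn_heat_time h04 x).mono fun t ht => ha.trans ht.1).norm.rpow_const
        fun _ _ => Or.inr (by linarith))
    · have := hasDerivAt_norm_rpow_comp (p := q)
        (heat_hasDerivAt_time hh (ha.trans_lt hτ.1) x) (Or.inr hq.le)
      rw [hk, hu, hw]
      exact this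
    · exact (intervalIntegrable_iff_integrableOn_Ioc_of_le haT).2 hx
  have hT := ha.trans haT
  have hIT : Integrable fun x => ‖u T x‖ ^ q := hu ▸ integrable_heat_rpow hq h04 hT
  have hIa : Integrable fun x => ‖u a x‖ ^ q := hu ▸ integrable_heat_rpow hq h04 ha
  have hmain : (∫ x, ‖u T x‖ ^ q) - ∫ x, ‖u a x‖ ^ q = ∫ τ in Ioc a T, (∫ x, k (τ, x)) := by
    rw [← integral_sub hIT hIa, integral_congr_ae hpt]
    exact (integral_integral_swap (f := fun τ x => k (τ, x)) hkint).symm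
  have hofr : ∀ t, Integrable (fun x => ‖u t x‖ ^ q) →
      ∫⁻ x, ‖u t x‖ₑ ^ q = ENNReal.ofReal (∫ x, ‖u t x‖ ^ q) := fun t ht => by
    rw [ofReal_integral_eq_lintegral_ofReal ht (ae_of_all _ fun _ => by positivity)]
    congr 1; ext x
    rw [← ENNReal.ofReal_rpow_of_nonneg (norm_nonneg _) (by linarith), ofReal_norm]
  rw [← hu, hofr a hIa, hofr T hIT]
  have h1 : ∫ x, ‖u a x‖ ^ q ≤ (∫ x, ‖u T x‖ ^ q) + ‖∫ τ in Ioc a T, (∫ x, k (τ, x))‖ := by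
    rw [← hmain, Real.norm_eq_abs]
    linarith [neg_abs_le ((∫ x, ‖u T x‖ ^ q) - ∫ x, ‖u a x‖ ^ q)]
  refine (ENNReal.ofReal_le_ofReal h1).trans (ENNReal.ofReal_add_le.trans (add_le_add le_rfl ?_))
  rw [ofReal_norm, ← lintegral_const_mul' _ _ ENNReal.ofReal_ne_top]
  refine (enorm_integral_le_lintegral_enorm _).trans
    (setLIntegral_mono' measurableSet_Ioc fun τ hτ => ?_)
  have hτ0 : 0 ≤ τ := ha.trans hτ.1.le
  have h2 := heat_dissipation hq hh hτ0
  rw [← ofReal_norm]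
  simp only [hk]
  rw [hu, hw]
  refine (ENNReal.ofReal_le_ofReal h2).trans ?_
  rw [ENNReal.ofReal_mul (by nlinarith)]
  gcongr
  rw [ENNReal.ofReal_sum_of_nonneg fun j _ => integral_nonneg fun x => by positivity]
  exact Finset.sum_le_sum fun j _ => ofReal_integral_mul_sq_le hq2

end

lemma lintegral_heat_rpow_le {q : ℝ} (hq : 2 < q) {h : E3 → ℂ} (hh : Dec 4 h) {τ : ℝ}
    (hτ : 0 ≤ τ) :
    ∫⁻ x, ‖heat h τ x‖ₑ ^ q ≤
      ENNReal.ofReal (∫ ξ, ‖Complex.exp (τ * ((-‖ξ‖ ^ 2 : ℝ) : ℂ)) * h ξ‖) ^ (q - 2) *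
        ∫⁻ ξ, ‖h ξ‖ₑ ^ 2 := by
  refine le_trans ?_ (mul_le_mul_right (lintegral_heat_sq_le hh hτ) _)
  rw [← lintegral_const_mul _ ((continuous_heat hh hτ).measurable.enorm.pow_const _)]
  refine lintegral_mono fun x => ?_
  have : ‖heat h τ x‖ₑ ^ q = ‖heat h τ x‖ₑ ^ (q - 2) * ‖heat h τ x‖ₑ ^ 2 := by
    rw [← ENNReal.rpow_two, ← ENNReal.rpow_add_of_nonneg _ _ (by linarith) zero_le_two]
    congr 1; ring
  rw [this]
  have hq2 : 0 ≤ q - 2 := by linarith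
  gcongr
  rw [← ofReal_norm]
  exact ENNReal.ofReal_le_ofReal (norm_fourierInv_le3 _ x)

lemma tendsto_integral_norm_heat {h : E3 → ℂ} (hh : Dec 4 h) :
    Filter.Tendsto (fun T : ℝ => ∫ ξ, ‖Complex.exp (T * ((-‖ξ‖ ^ 2 : ℝ) : ℂ)) * h ξ‖)
      Filter.atTop (nhds 0) := by
  have h1 : Filter.Tendsto (fun T : ℝ => ∫ ξ, ‖Complex.exp (T * ((-‖ξ‖ ^ 2 : ℝ) : ℂ)) * h ξ‖)
      Filter.atTop (nhds (∫ _ : E3, (0:ℝ))) := by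
    refine tendsto_integral_filter_of_dominated_convergence (fun ξ => ‖h ξ‖)
      (Filter.Eventually.of_forall fun T => ?_) ?_ (hh.integrable le_rfl).norm ?_
    · exact (Measurable.mul (by fun_prop) hh.1).norm.aestronglyMeasurable
    · filter_upwards [Filter.eventually_ge_atTop 0] with T hT
      refine ae_of_all _ fun ξ => ?_
      rw [norm_norm, norm_mul]
      exact mul_le_of_le_one_left (norm_nonneg _) (norm_exp_mul_le (heat_re hT ξ))
    · have h0 : ∀ᵐ ξ : E3, ξ ≠ 0 := by simp [ae_iff]
      filter_upwards [h0] with ξ hξ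
      simp only [norm_mul, ← Complex.ofReal_mul, Complex.norm_exp, Complex.ofReal_re]
      rw [← zero_mul ‖h ξ‖]
      refine Filter.Tendsto.mul_const _ (Real.tendsto_exp_atBot.comp ?_)
      exact Filter.tendsto_id.atTop_mul_const_of_neg (by
        have := norm_pos_iff.2 hξ; simp; positivity)
  rwa [integral_zero] at h1

lemma tendsto_lintegral_heat_rpow {q : ℝ} (hq : 2 < q) {h : E3 → ℂ} (hh : Dec 4 h) :
    Filter.Tendsto (fun T : ℝ => ∫⁻ x, ‖heat h T x‖ₑ ^ q) Filter.atTop (nhds 0) := by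
  have h1 := tendsto_integral_norm_heat hh
  have h2 := (((ENNReal.tendsto_ofReal h1).ennrpow_const (q - 2)))
  rw [ENNReal.ofReal_zero, ENNReal.zero_rpow_of_pos (by linarith)] at h2
  have h3 := ENNReal.Tendsto.mul_const (b := ∫⁻ ξ, ‖h ξ‖ₑ ^ 2) h2
    (Or.inr (lintegral_sq_lt_top hh).ne)
  rw [zero_mul] at h3
  refine tendsto_of_tendsto_of_tendsto_of_le_of_le' tendsto_const_nhds h3
    (Filter.Eventually.of_forall fun _ => zero_le) ?_
  filter_upwards [Filter.eventually_ge_atTop 0] with T hT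
  exact lintegral_heat_rpow_le hq hh hT

/-- The vertical square function for the heat flow dominates `L^q` norms. -/
lemma eLpNorm_sq_le_heat {q : ℝ} (hq : 2 < q) {h : E3 → ℂ} (hh : Dec 6 h) :
    eLpNorm' (heat h 0) q volume ^ 2 ≤ ENNReal.ofReal (q * (q - 1)) *
      ∑ j, ∫⁻ τ in Ioi (0:ℝ), eLpNorm' (heat (fun ξ => dsym j ξ * h ξ) τ) q volume ^ 2 := by
  have hq0 : 0 < q := by linarith
  have hq2 : 0 < q - 2 := by linarith
  have h04 := hh.mono (k := 4) (by norm_num)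
  have hj4 : ∀ j, Dec 4 (fun ξ => dsym j ξ * h ξ) := fun j => Dec.mono (Dec.dsym hh j) (by norm_num)
  obtain ⟨N, hN⟩ : ∃ N : ℝ → ℝ≥0∞, ∀ τ, N τ = ∫⁻ x, ‖heat h τ x‖ₑ ^ q := ⟨_, fun _ => rfl⟩
  obtain ⟨M, hM⟩ : ∃ M : ℝ≥0∞, M = ⨆ τ ∈ Ici (0:ℝ), N τ := ⟨_, rfl⟩
  obtain ⟨D, hD⟩ : ∃ D : ℝ≥0∞, D = ∑ j, ∫⁻ τ in Ioi (0:ℝ),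
    eLpNorm' (heat (fun ξ => dsym j ξ * h ξ) τ) q volume ^ 2 := ⟨_, rfl⟩
  have hNM : ∀ τ, 0 ≤ τ → N τ ≤ M := fun τ hτ => hM ▸ le_iSup₂ (f := fun τ (_ : τ ∈ Ici (0:ℝ)) => N τ) τ hτ
  have hMT : M ≠ ∞ := by
    refine ne_top_of_le_ne_top (b := ENNReal.ofReal (∫ ξ, ‖h ξ‖) ^ (q - 2) * ∫⁻ ξ, ‖h ξ‖ₑ ^ 2) ?_ ?_
    · exact ENNReal.mul_ne_top (ENNReal.rpow_ne_top_of_nonneg hq2.le ENNReal.ofReal_ne_top)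
        (lintegral_sq_lt_top h04).ne
    · rw [hM]
      refine iSup₂_le fun τ hτ => ?_
      rw [hN]
      refine (lintegral_heat_rpow_le hq h04 hτ).trans ?_
      gcongr
      · exact ((h04.heat hτ).integrable le_rfl).norm
      · exact (h04.integrable le_rfl).norm
      · intro ξ
        simp only [norm_mul]
        exact mul_le_of_le_one_left (norm_nonneg _) (norm_exp_mul_le (heat_re hτ ξ))
  have hmeasj : ∀ j, Measurable fun τ =>
      eLpNorm' (heat (fun ξ => dsym j ξ * h ξ) τ) q volume := fun j => by
    unfold eLpNorm'
    exact (Measurable.lintegral_prod_right' ((measurable_heat (hj4 j).1).enorm.pow_const q)).pow_const _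
  have hconj : (q / (q - 2)).HolderConjugate (q / 2) := by
    rw [Real.holderConjugate_iff]
    refine ⟨by rw [lt_div_iff₀ hq2]; linarith, ?_⟩
    field_simp; ring
  have hterm : ∀ τ, 0 ≤ τ → ∀ j, ∫⁻ x, ‖heat h τ x‖ₑ ^ (q - 2) *
      ‖heat (fun ξ => dsym j ξ * h ξ) τ x‖ₑ ^ 2 ≤
      M ^ ((q - 2) / q) * eLpNorm' (heat (fun ξ => dsym j ξ * h ξ) τ) q volume ^ 2 := by
    intro τ hτ j
    have h1 := ENNReal.lintegral_mul_le_Lp_mul_Lq volume hconj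
      (f := fun x => ‖heat h τ x‖ₑ ^ (q - 2)) (g := fun x =>
        ‖heat (fun ξ => dsym j ξ * h ξ) τ x‖ₑ ^ 2)
      ((continuous_heat h04 hτ).measurable.enorm.pow_const _).aemeasurable
      ((continuous_heat (hj4 j) hτ).measurable.enorm.pow_const _).aemeasurable
    refine h1.trans (mul_le_mul' ?_ ?_)
    · simp only [← ENNReal.rpow_mul]
      rw [one_div_div, mul_div_cancel₀ _ hq2.ne', ← hN]
      exact ENNReal.rpow_le_rpow (hNM τ hτ) (by positivity)
    · rw [eLpNorm', ← ENNReal.rpow_two, ← ENNReal.rpow_mul, one_div_div, one_div_mul_eq_div]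
      refine le_of_eq ?_
      congr 2; ext x
      rw [← ENNReal.rpow_two, ← ENNReal.rpow_mul]
      congr 1; ring
  have hstep : ∀ a T, 0 ≤ a → a ≤ T → N a ≤ N T +
      ENNReal.ofReal (q * (q - 1)) * (M ^ ((q - 2) / q) * D) := by
    intro a T ha haT
    rw [hN, hN, hD]
    refine (heat_energy hq hh ha haT).trans ?_
    gcongr
    rw [← lintegral_finsetSum _ fun j _ => (hmeasj j).pow_const 2,
      ← lintegral_const_mul _ (Finset.measurable_sum _ fun j _ => (hmeasj j).pow_const 2)]
    refine (setLIntegral_mono' measurableSet_Ioc fun τ hτ => ?_).trans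
      (lintegral_mono_set fun τ hτ => ha.trans_lt hτ.1)
    rw [Finset.mul_sum]
    exact Finset.sum_le_sum fun j _ => hterm τ (ha.trans hτ.1.le) j
  have hfin : ∀ a, 0 ≤ a → N a ≤ ENNReal.ofReal (q * (q - 1)) * (M ^ ((q - 2) / q) * D) := by
    intro a ha
    have hl := (tendsto_lintegral_heat_rpow hq h04).add_const
      (ENNReal.ofReal (q * (q - 1)) * (M ^ ((q - 2) / q) * D))
    rw [zero_add] at hl
    refine ge_of_tendsto hl ?_
    filter_upwards [Filter.eventually_ge_atTop a] with T hT
    rw [← hN]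
    exact hstep a T ha hT
  have hMle : M ≤ (ENNReal.ofReal (q * (q - 1)) * D) * M ^ (1 / (q / (q - 2))) := by
    rw [one_div_div]
    conv_lhs => rw [hM]
    refine iSup₂_le fun τ hτ => (hfin τ hτ).trans_eq (by ring)
  have h2 := rpow_le_of_le_mul_rpow hconj.symm hMT hMle
  rw [← hD]
  refine le_trans ?_ h2
  rw [eLpNorm', ← ENNReal.rpow_two, ← ENNReal.rpow_mul, one_div_div, one_div_mul_eq_div, ← hN]
  exact ENNReal.rpow_le_rpow (hNM 0 le_rfl) (by positivity)

lemma enorm_heat_le_lintegral {h : E3 → ℂ} (hh : Dec 6 h) {τ : ℝ} (hτ : 0 < τ) (x : E3) :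
    ‖heat h τ x‖ₑ ≤ ∫⁻ w in Ioi τ, ‖heat (fun ξ => ((-‖ξ‖ ^ 2 : ℝ) : ℂ) * h ξ) w x‖ₑ := by
  have h04 := hh.mono (k := 4) (by norm_num)
  have hc := continuousOn_heat_time (dec_laplacian (k := 4) hh) x
  have hstep : ∀ T, τ ≤ T → ‖heat h τ x‖ₑ ≤ ‖heat h T x‖ₑ +
      ∫⁻ w in Ioi τ, ‖heat (fun ξ => ((-‖ξ‖ ^ 2 : ℝ) : ℂ) * h ξ) w x‖ₑ := by
    intro T hT
    have hi := intervalIntegral.integral_eq_sub_of_hasDerivAt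
      (fun w hw => heat_hasDerivAt_time hh (hτ.trans_le (uIcc_of_le hT ▸ hw).1) x)
      ((hc.mono (uIcc_of_le hT ▸ fun w hw => hτ.le.trans hw.1)).intervalIntegrable)
    have h2 : heat h τ x = heat h T x -
        (∫ w in τ..T, heat (fun ξ => ((-‖ξ‖ ^ 2 : ℝ) : ℂ) * h ξ) w x) := by rw [hi]; ring
    rw [h2]
    refine enorm_sub_le.trans (add_le_add le_rfl ?_)
    rw [intervalIntegral.integral_of_le hT]
    exact (enorm_integral_le_lintegral_enorm _).trans (lintegral_mono_set Ioc_subset_Ioi_self)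
  have hl : Filter.Tendsto (fun T : ℝ => ‖heat h T x‖ₑ) Filter.atTop (nhds 0) := by
    have h1 := ENNReal.tendsto_ofReal (tendsto_integral_norm_heat h04)
    rw [ENNReal.ofReal_zero] at h1
    refine tendsto_of_tendsto_of_tendsto_of_le_of_le tendsto_const_nhds h1
      (fun _ => zero_le) fun T => ?_
    rw [← ofReal_norm]
    exact ENNReal.ofReal_le_ofReal (norm_fourierInv_le3 _ x)
  have h3 := hl.add_const (∫⁻ w in Ioi τ, ‖heat (fun ξ => ((-‖ξ‖ ^ 2 : ℝ) : ℂ) * h ξ) w x‖ₑ)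
  rw [zero_add] at h3
  refine ge_of_tendsto h3 ?_
  filter_upwards [Filter.eventually_ge_atTop τ] with T hT using hstep T hT

lemma measurable_eLpNorm'_heat {h : E3 → ℂ} (hm : Measurable h) (q : ℝ) :
    Measurable fun τ => eLpNorm' (heat h τ) q volume := by
  unfold eLpNorm'
  exact (Measurable.lintegral_prod_right' ((measurable_heat hm).enorm.pow_const q)).pow_const _

lemma eLpNorm'_heat_le_lintegral {q : ℝ} (hq : 1 ≤ q) {h : E3 → ℂ} (hh : Dec 6 h) {τ : ℝ}
    (hτ : 0 < τ) : eLpNorm' (heat h τ) q volume ≤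
      ∫⁻ w in Ioi τ, eLpNorm' (heat (fun ξ => ((-‖ξ‖ ^ 2 : ℝ) : ℂ) * h ξ) w) q volume := by
  have hm : Measurable fun p : E3 × ℝ =>
      ‖heat (fun ξ => ((-‖ξ‖ ^ 2 : ℝ) : ℂ) * h ξ) p.2 p.1‖ₑ :=
    ((measurable_heat (dec_laplacian (k := 4) hh).1).comp measurable_swap).enorm
  refine le_trans ?_ (lintegral_minkowski (μ := volume) (ν := volume.restrict (Ioi τ)) hq hm)
  unfold eLpNorm'
  gcongr with x
  exact enorm_heat_le_lintegral hh hτ x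

/-- A square function estimate with two extra derivatives. -/
lemma eLpNorm_sq_le_heat_laplacian {q : ℝ} (hq : 2 < q) {h : E3 → ℂ} (hh : Dec 7 h) :
    eLpNorm' (heat h 0) q volume ^ 2 ≤ ENNReal.ofReal (4 * (q * (q - 1))) *
      ∑ j, ∫⁻ τ in Ioi (0:ℝ), ENNReal.ofReal (τ ^ 2) *
        eLpNorm' (heat (fun ξ => ((-‖ξ‖ ^ 2 : ℝ) : ℂ) * (dsym j ξ * h ξ)) τ) q volume ^ 2 := by
  refine (eLpNorm_sq_le_heat hq (hh.mono (by norm_num))).trans ?_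
  have e : ENNReal.ofReal (4 * (q * (q - 1))) = ENNReal.ofReal (q * (q - 1)) * 4 := by
    rw [mul_comm, ENNReal.ofReal_mul' (by norm_num), ENNReal.ofReal_ofNat]
  rw [e, mul_assoc]
  refine mul_le_mul' le_rfl ?_
  rw [Finset.mul_sum]
  refine Finset.sum_le_sum fun j _ => ?_
  have hd : Dec 6 fun ξ => dsym j ξ * h ξ := hh.dsym j
  have h1 := lintegral_hardy (measurable_eLpNorm'_heat (dec_laplacian (k := 4) hd).1 q)
  refine le_trans (setLIntegral_mono' measurableSet_Ioi fun τ hτ => ?_) h1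
  gcongr
  exact eLpNorm'_heat_le_lintegral (by linarith) hd hτ

/-- The half-wave evolution of the frequency profile `h`. -/
def wave (σ : ℝ) (h : E3 → ℂ) (t : ℝ) : E3 → ℂ :=
  𝓕⁻ fun ξ => Complex.exp (Complex.I * (σ * (2 * Real.pi * t * ‖ξ‖))) * h ξ

/-- The frequency profile of the `j`-th derivative of the Laplacian of a heat extension, with the
damping of the wave at scale `√τ` removed. -/
def heatPiece (h : E3 → ℂ) (j : Fin 3) (τ : ℝ) (ξ : E3) : ℂ :=
  ((Real.exp (2 * Real.pi * √τ * ‖ξ‖ - τ * ‖ξ‖ ^ 2) : ℝ) : ℂ) *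
    (((-‖ξ‖ ^ 2 : ℝ) : ℂ) * (dsym j ξ * h ξ))

lemma norm_wave_symbol (σ t : ℝ) (ξ : E3) :
    ‖Complex.exp (Complex.I * (σ * (2 * Real.pi * t * ‖ξ‖)))‖ = 1 := by
  have : Complex.I * (σ * (2 * Real.pi * t * ‖ξ‖)) =
      ((σ * (2 * Real.pi * t * ‖ξ‖) : ℝ) : ℂ) * Complex.I := by push_cast; ring
  rw [this, Complex.norm_exp_ofReal_mul_I]

lemma Dec.wave {k : ℕ} {h : E3 → ℂ} (hh : Dec k h) (σ t : ℝ) :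
    Dec k fun ξ => Complex.exp (Complex.I * (σ * (2 * Real.pi * t * ‖ξ‖))) * h ξ :=
  hh.mul_bdd (K := 1) (by fun_prop) fun ξ => (norm_wave_symbol σ t ξ).le

lemma heatPiece_exponent_le {τ : ℝ} (hτ : 0 ≤ τ) (r : ℝ) :
    2 * Real.pi * √τ * r - τ * r ^ 2 ≤ 2 * Real.pi ^ 2 + -(τ * r ^ 2 / 2) := by
  have h1 := Real.sq_sqrt hτ
  have : τ * r ^ 2 = (√τ * r) ^ 2 := by rw [mul_pow, h1]
  nlinarith [sq_nonneg (√τ * r - 2 * Real.pi)]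

lemma Dec.heatPiece {h : E3 → ℂ} (hh : Dec 7 h) (j : Fin 3) {τ : ℝ} (hτ : 0 ≤ τ) :
    Dec 4 (heatPiece h j τ) := by
  refine Dec.mul_bdd (K := Real.exp (2 * Real.pi ^ 2))
    (dec_laplacian (k := 4) (Dec.dsym (k := 6) hh j)) (by fun_prop) fun ξ => ?_
  rw [Complex.norm_real, Real.norm_of_nonneg (Real.exp_pos _).le]
  refine Real.exp_le_exp.2 ((heatPiece_exponent_le hτ _).trans ?_)
  have : 0 ≤ τ * ‖ξ‖ ^ 2 := by positivity
  linarith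

lemma heat_wave_eq (σ t : ℝ) (h : E3 → ℂ) (j : Fin 3) (τ : ℝ) :
    heat (fun ξ => ((-‖ξ‖ ^ 2 : ℝ) : ℂ) * (dsym j ξ *
      (Complex.exp (Complex.I * (σ * (2 * Real.pi * t * ‖ξ‖))) * h ξ))) τ =
    dampedWave σ √τ (heatPiece h j τ) t := by
  unfold heat dampedWave heatPiece
  congr 1; ext ξ
  have : Complex.exp (τ * ((-‖ξ‖ ^ 2 : ℝ) : ℂ)) *
      Complex.exp (Complex.I * (σ * (2 * Real.pi * t * ‖ξ‖))) =
      Complex.exp (-waveC σ √τ t * (‖ξ‖ : ℝ)) *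
        ((Real.exp (2 * Real.pi * √τ * ‖ξ‖ - τ * ‖ξ‖ ^ 2) : ℝ) : ℂ) := by
    rw [← Complex.exp_add, Complex.ofReal_exp, ← Complex.exp_add, waveC]
    congr 1; push_cast; ring
  linear_combination (((-‖ξ‖ ^ 2 : ℝ) : ℂ) * (dsym j ξ * h ξ)) * this

lemma wave_sq_le {q : ℝ} (hq : 2 < q) {h : E3 → ℂ} (hh : Dec 7 h) (σ t : ℝ) :
    eLpNorm' (wave σ h t) q volume ^ 2 ≤ ENNReal.ofReal (4 * (q * (q - 1))) *
      ∑ j, ∫⁻ τ in Ioi (0:ℝ), ENNReal.ofReal (τ ^ 2) *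
        eLpNorm' (dampedWave σ √τ (heatPiece h j τ) t) q volume ^ 2 := by
  have h1 := eLpNorm_sq_le_heat_laplacian hq (hh.wave σ t)
  simp only [heat_wave_eq] at h1
  convert h1 using 3
  unfold wave heat
  congr 1; ext ξ; simp

lemma measurable_dampedWave_heatPiece {h : E3 → ℂ} (hm : Measurable h) (σ : ℝ) (j : Fin 3) :
    Measurable fun p : (ℝ × ℝ) × E3 => dampedWave σ √p.1.2 (heatPiece h j p.1.2) p.1.1 p.2 := by
  refine measurable_fourierInv_param (α := ℝ × ℝ) (K := fun a ξ =>
    Complex.exp (-waveC σ √a.2 a.1 * (‖ξ‖ : ℝ)) * heatPiece h j a.2 ξ) ?_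
  have h0 : Measurable fun p : (ℝ × ℝ) × E3 => dsym j p.2 := (measurable_dsym j).comp measurable_snd
  have h1 : Measurable fun p : (ℝ × ℝ) × E3 => h p.2 := hm.comp measurable_snd
  simp only [Function.uncurry_def, waveC, heatPiece]
  refine Measurable.mul (Continuous.measurable (by fun_prop)) (Measurable.mul
    (Continuous.measurable (by fun_prop)) (Measurable.mul (Continuous.measurable (by fun_prop))
      (h0.mul h1)))

lemma lintegral_rpow_mul_exp {s c : ℝ} (hs : s < 3) (hc : 0 < c) :
    ∫⁻ τ in Ioi (0:ℝ), ENNReal.ofReal (τ ^ 2 * τ ^ (-s) * Real.exp (-(c * τ))) =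
      ENNReal.ofReal (Real.Gamma (3 - s) * c ^ (-(3 - s))) := by
  have h1 := Real.integral_rpow_mul_exp_neg_mul_Ioi (a := 3 - s) (r := c) (by linarith) hc
  have e : ∀ τ ∈ Ioi (0:ℝ), τ ^ 2 * τ ^ (-s) * Real.exp (-(c * τ)) =
      τ ^ (3 - s - 1) * Real.exp (-(c * τ)) := by
    intro τ hτ
    rw [← Real.rpow_two, ← Real.rpow_add hτ]
    ring_nf
  rw [setLIntegral_congr_fun measurableSet_Ioi fun τ hτ => congrArg ENNReal.ofReal (e τ hτ),
    ← ofReal_integral_eq_lintegral_ofReal, h1, one_div, Real.inv_rpow hc.le, ← Real.rpow_neg hc.le,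
    mul_comm]
  · have hG := Real.Gamma_pos_of_pos (s := 3 - s) (by linarith)
    by_contra hn
    have := integral_undef hn
    rw [h1] at this
    have : 0 < (1 / c) ^ (3 - s) * Real.Gamma (3 - s) := by positivity
    linarith
  · filter_upwards [ae_restrict_mem measurableSet_Ioi] with τ hτ
    have : (0:ℝ) < τ := hτ
    positivity

lemma lintegral_heatPiece_le {s : ℝ} (hs : s < 3) {h : E3 → ℂ} (hm : Measurable h) (j : Fin 3) :
    ∫⁻ τ in Ioi (0:ℝ), ENNReal.ofReal (τ ^ 2 * τ ^ (-s)) * ∫⁻ ξ, ‖heatPiece h j τ ξ‖ₑ ^ 2 ≤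
      ENNReal.ofReal (Real.exp (4 * Real.pi ^ 2) * (4 * Real.pi ^ 2) * Real.Gamma (3 - s)) *
        ∫⁻ ξ, ENNReal.ofReal (‖ξ‖ ^ (2 * s)) * ‖h ξ‖ₑ ^ 2 := by
  have hG := Real.Gamma_pos_of_pos (s := 3 - s) (by linarith)
  have hmp : Measurable fun p : ℝ × E3 => heatPiece h j p.1 p.2 := by
    have h0 : Measurable fun p : ℝ × E3 => dsym j p.2 := (measurable_dsym j).comp measurable_snd
    have h1 : Measurable fun p : ℝ × E3 => h p.2 := hm.comp measurable_snd
    unfold heatPiece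
    exact (Continuous.measurable (by fun_prop)).mul
      ((Continuous.measurable (by fun_prop)).mul (h0.mul h1))
  have e1 : ∀ τ, ENNReal.ofReal (τ ^ 2 * τ ^ (-s)) * ∫⁻ ξ, ‖heatPiece h j τ ξ‖ₑ ^ 2 =
      ∫⁻ ξ, ENNReal.ofReal (τ ^ 2 * τ ^ (-s)) * ‖heatPiece h j τ ξ‖ₑ ^ 2 := fun τ =>
    (lintegral_const_mul _ ((hmp.comp (measurable_const.prodMk measurable_id)).enorm.pow_const 2)).symm
  simp only [e1]
  rw [lintegral_lintegral_swap (Measurable.aemeasurable (by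
    exact (by fun_prop : Measurable fun p : ℝ × E3 => ENNReal.ofReal (p.1 ^ 2 * p.1 ^ (-s))).mul
      (hmp.enorm.pow_const 2))), ← lintegral_const_mul _ (by fun_prop)]
  have h0 : ∀ᵐ ξ : E3, ξ ≠ 0 := by simp [ae_iff]
  refine lintegral_mono_ae ?_
  filter_upwards [h0] with ξ hξ
  have hr : 0 < ‖ξ‖ := norm_pos_iff.2 hξ
  calc ∫⁻ τ in Ioi (0:ℝ), ENNReal.ofReal (τ ^ 2 * τ ^ (-s)) * ‖heatPiece h j τ ξ‖ₑ ^ 2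
      ≤ ∫⁻ τ in Ioi (0:ℝ), ENNReal.ofReal (τ ^ 2 * τ ^ (-s) * Real.exp (-(‖ξ‖ ^ 2 * τ))) *
        (ENNReal.ofReal (Real.exp (4 * Real.pi ^ 2) * (4 * Real.pi ^ 2) * ‖ξ‖ ^ 6) *
          ‖h ξ‖ₑ ^ 2) := by
        refine setLIntegral_mono' measurableSet_Ioi fun τ hτ => ?_
        have hτ0 : (0:ℝ) < τ := hτ
        rw [ENNReal.ofReal_mul (q := Real.exp _) (by positivity), mul_assoc, ← mul_assoc
          (ENNReal.ofReal (Real.exp (-(‖ξ‖ ^ 2 * τ)))), ← ENNReal.ofReal_mul (by positivity)]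
        refine mul_le_mul' le_rfl ?_
        rw [← ofReal_norm, ← ofReal_norm, ← ENNReal.ofReal_pow (norm_nonneg _),
          ← ENNReal.ofReal_pow (norm_nonneg _), ← ENNReal.ofReal_mul (by positivity)]
        refine ENNReal.ofReal_le_ofReal ?_
        rw [heatPiece, norm_mul, norm_mul, norm_mul, Complex.norm_real, Complex.norm_real,
          Real.norm_of_nonneg (Real.exp_pos _).le, norm_neg, norm_pow, norm_norm]
        have hE : Real.exp (2 * Real.pi * √τ * ‖ξ‖ - τ * ‖ξ‖ ^ 2) ^ 2 ≤
            Real.exp (-(‖ξ‖ ^ 2 * τ)) * Real.exp (4 * Real.pi ^ 2) := by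
          rw [← Real.exp_nat_mul, ← Real.exp_add]
          refine Real.exp_le_exp.2 ?_
          have := heatPiece_exponent_le hτ0.le ‖ξ‖
          push_cast; linarith
        have hD : ‖dsym j ξ‖ ^ 2 ≤ 4 * Real.pi ^ 2 * ‖ξ‖ ^ 2 := by
          calc ‖dsym j ξ‖ ^ 2 ≤ (2 * Real.pi * ‖ξ‖) ^ 2 := by gcongr; exact norm_dsym_le j ξ
            _ = _ := by ring
        calc _ = Real.exp (2 * Real.pi * √τ * ‖ξ‖ - τ * ‖ξ‖ ^ 2) ^ 2 * (‖ξ‖ ^ 4 * (‖dsym j ξ‖ ^ 2 *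
              ‖h ξ‖ ^ 2)) := by ring
          _ ≤ (Real.exp (-(‖ξ‖ ^ 2 * τ)) * Real.exp (4 * Real.pi ^ 2)) * (‖ξ‖ ^ 4 *
              ((4 * Real.pi ^ 2 * ‖ξ‖ ^ 2) * ‖h ξ‖ ^ 2)) := by gcongr
          _ = _ := by ring
    _ = ENNReal.ofReal (Real.exp (4 * Real.pi ^ 2) * (4 * Real.pi ^ 2) * Real.Gamma (3 - s)) *
        (ENNReal.ofReal (‖ξ‖ ^ (2 * s)) * ‖h ξ‖ₑ ^ 2) := by
        rw [lintegral_mul_const _ (by fun_prop), lintegral_rpow_mul_exp hs (by positivity),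
          ← mul_assoc (ENNReal.ofReal _) (ENNReal.ofReal _),
          ← mul_assoc (ENNReal.ofReal _) (ENNReal.ofReal _), ← ENNReal.ofReal_mul (by positivity),
          ← ENNReal.ofReal_mul (by positivity)]
        congr 2
        have : (‖ξ‖ ^ 2) ^ (-(3 - s)) * ‖ξ‖ ^ 6 = ‖ξ‖ ^ (2 * s) := by
          rw [← Real.rpow_two, ← Real.rpow_mul hr.le, ← Real.rpow_natCast ‖ξ‖ 6,
            ← Real.rpow_add hr]
          congr 1; push_cast; ring
        linear_combination (Real.Gamma (3 - s) * (Real.exp (4 * Real.pi ^ 2) *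
          (4 * Real.pi ^ 2))) * this

/-- A bound for the damped dispersive kernel at all scales. -/
def KernelBound (ν : Measure ℝ) (θ P' s D : ℝ) : Prop :=
  ∀ y : ℝ, 0 < y → ∀ φ : ℝ → ℝ≥0∞, Measurable φ →
    ∫⁻ z, ENNReal.ofReal (waveKer θ y (z.1 - z.2)) * φ z.1 * φ z.2 ∂(ν.prod ν) ≤
      ENNReal.ofReal (D * y ^ (-(2 * s))) * (∫⁻ t, φ t ^ P' ∂ν) ^ (2 / P')

theorem strichartz_wave {ν : Measure ℝ} [IsFiniteMeasure ν] {σ P P' q r s D : ℝ} (hσ : |σ| = 1)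
    (hq : 2 < q) (hqr : q.HolderConjugate r) (hP : 2 ≤ P) (hPP : P.HolderConjugate P')
    (hs : s < 3) (hD : 0 ≤ D) (hK : KernelBound ν (1 - 2 / q) P' s D) {h : E3 → ℂ} (hh : Dec 7 h) :
    (∫⁻ t, eLpNorm' (wave σ h t) q volume ^ P ∂ν) ^ (2 / P) ≤
      ENNReal.ofReal (4 * (q * (q - 1)) * (3 * (dispC r * D *
        (Real.exp (4 * Real.pi ^ 2) * (4 * Real.pi ^ 2) * Real.Gamma (3 - s))))) *
        ∫⁻ ξ, ENNReal.ofReal (‖ξ‖ ^ (2 * s)) * ‖h ξ‖ₑ ^ 2 := by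
  have hP0 : 0 < P := by linarith
  have hr2 : r < 2 := by
    have h1 : q⁻¹ + r⁻¹ = 1 := hqr.inv_add_inv_eq_one
    have h2 : q⁻¹ < 2⁻¹ := inv_strictAnti₀ two_pos hq
    exact (inv_lt_inv₀ two_pos hqr.symm.pos).1 (by linarith)
  have hd := (dispC_pos hr2).le
  obtain ⟨K, hKdef⟩ : ∃ K, K = Real.exp (4 * Real.pi ^ 2) * (4 * Real.pi ^ 2) *
    Real.Gamma (3 - s) := ⟨_, rfl⟩
  have hK0 : 0 ≤ K := by
    have := Real.Gamma_pos_of_pos (s := 3 - s) (by linarith)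
    rw [hKdef]; positivity
  obtain ⟨G, hG⟩ : ∃ G : Fin 3 → ℝ × ℝ → ℝ≥0∞, ∀ j p, G j p =
    eLpNorm' (dampedWave σ √p.2 (heatPiece h j p.2) p.1) q volume := ⟨_, fun _ _ => rfl⟩
  have hGm : ∀ j, Measurable (G j) := fun j => by
    have : G j = fun p : ℝ × ℝ => eLpNorm' (dampedWave σ √p.2 (heatPiece h j p.2) p.1) q volume :=
      funext (hG j)
    rw [this]
    unfold eLpNorm'
    exact (Measurable.lintegral_prod_right'
      ((measurable_dampedWave_heatPiece hh.1 σ j).enorm.pow_const q)).pow_const _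
  obtain ⟨Φ, hΦ⟩ : ∃ Φ : Fin 3 → ℝ × ℝ → ℝ≥0∞, ∀ j p, Φ j p =
    ENNReal.ofReal (p.2 ^ 2) * G j p ^ 2 := ⟨_, fun _ _ => rfl⟩
  have hΦm : ∀ j, Measurable (Φ j) := fun j => by
    rw [show Φ j = _ from funext (hΦ j)]
    exact (by fun_prop : Measurable fun p : ℝ × ℝ => ENNReal.ofReal (p.2 ^ 2)).mul
      ((hGm j).pow_const 2)
  have hP2 : 1 ≤ P / 2 := by linarith
  have hG4 : ∀ j τ, 0 < τ → (∫⁻ t, Φ j (t, τ) ^ (P / 2) ∂ν) ^ (1 / (P / 2)) ≤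
      ENNReal.ofReal (dispC r * D) *
        (ENNReal.ofReal (τ ^ 2 * τ ^ (-s)) * ∫⁻ ξ, ‖heatPiece h j τ ξ‖ₑ ^ 2) := by
    intro j τ hτ
    have hdec := hh.heatPiece j hτ.le
    have h1 := strichartz_damped (ν := ν) hσ (Real.sqrt_pos.2 hτ) hq hqr (by linarith) hPP
      (hK √τ (Real.sqrt_pos.2 hτ)) hdec.1 (hdec.integrable le_rfl) (hdec.memLp le_rfl)
    have e1 : ∀ t, Φ j (t, τ) ^ (P / 2) = ENNReal.ofReal (τ ^ 2) ^ (P / 2) *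
        eLpNorm' (dampedWave σ √τ (heatPiece h j τ) t) q volume ^ P := fun t => by
      rw [hΦ, hG, ENNReal.mul_rpow_of_nonneg _ _ (by positivity)]
      congr 1
      rw [← ENNReal.rpow_two, ← ENNReal.rpow_mul]
      congr 1; ring
    have hm : Measurable fun t => eLpNorm' (dampedWave σ √τ (heatPiece h j τ) t) q volume ^ P := by
      have := (hGm j).comp (measurable_id.prodMk (measurable_const (a := τ)))
      simp only [Function.comp_def, hG, id] at this
      exact this.pow_const P
    simp only [e1]
    rw [lintegral_const_mul _ hm, ENNReal.mul_rpow_of_nonneg _ _ (by positivity),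
      ← ENNReal.rpow_mul, mul_one_div_cancel (by positivity), ENNReal.rpow_one, one_div_div]
    refine (mul_le_mul' le_rfl h1).trans (le_of_eq ?_)
    have e2 : √τ ^ (-(2 * s)) = τ ^ (-s) := by
      rw [Real.sqrt_eq_rpow, ← Real.rpow_mul hτ.le]; congr 1; ring
    rw [e2, ENNReal.ofReal_mul hd, ENNReal.ofReal_mul hD, ENNReal.ofReal_mul (sq_nonneg τ)]
    ring
  calc (∫⁻ t, eLpNorm' (wave σ h t) q volume ^ P ∂ν) ^ (2 / P)
      = (∫⁻ t, (eLpNorm' (wave σ h t) q volume ^ 2) ^ (P / 2) ∂ν) ^ (1 / (P / 2)) := by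
        rw [one_div_div]
        congr 2; ext t
        rw [← ENNReal.rpow_two, ← ENNReal.rpow_mul]
        congr 1; ring
    _ ≤ (∫⁻ t, (ENNReal.ofReal (4 * (q * (q - 1))) *
          ∑ j, ∫⁻ τ in Ioi (0:ℝ), Φ j (t, τ)) ^ (P / 2) ∂ν) ^ (1 / (P / 2)) := by
        refine ENNReal.rpow_le_rpow (lintegral_mono fun t => ENNReal.rpow_le_rpow ?_
          (by positivity)) (by positivity)
        simp only [hΦ, hG]
        exact wave_sq_le hq hh σ t
    _ = ENNReal.ofReal (4 * (q * (q - 1))) *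
          (∫⁻ t, (∑ j, ∫⁻ τ in Ioi (0:ℝ), Φ j (t, τ)) ^ (P / 2) ∂ν) ^ (1 / (P / 2)) := by
        simp only [ENNReal.mul_rpow_of_nonneg _ _ (by positivity : 0 ≤ P / 2)]
        rw [lintegral_const_mul _ ((Finset.measurable_sum _ fun j _ =>
          (hΦm j).lintegral_prod_right').pow_const _),
          ENNReal.mul_rpow_of_nonneg _ _ (by positivity),
          ← ENNReal.rpow_mul, mul_one_div_cancel (by positivity), ENNReal.rpow_one]
    _ ≤ ENNReal.ofReal (4 * (q * (q - 1))) * ∑ _j : Fin 3, ENNReal.ofReal (dispC r * D * K) *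
          ∫⁻ ξ, ENNReal.ofReal (‖ξ‖ ^ (2 * s)) * ‖h ξ‖ₑ ^ 2 := by
        refine mul_le_mul' le_rfl ((minkowski_finset hP2 fun j =>
          (hΦm j).lintegral_prod_right').trans (Finset.sum_le_sum fun j _ => ?_))
        refine (lintegral_minkowski hP2 (hΦm j)).trans ?_
        refine (setLIntegral_mono' measurableSet_Ioi fun τ hτ => hG4 j τ hτ).trans ?_
        rw [lintegral_const_mul' _ _ ENNReal.ofReal_ne_top,
          ENNReal.ofReal_mul (p := dispC r * D) (by positivity), mul_assoc (ENNReal.ofReal _), hKdef]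
        exact mul_le_mul' le_rfl (lintegral_heatPiece_le hs hh.1 j)
    _ = _ := by
        have : 0 ≤ 4 * (q * (q - 1)) := by nlinarith
        rw [← hKdef, Finset.sum_const, Finset.card_univ, Fintype.card_fin, nsmul_eq_mul,
          ENNReal.ofReal_mul this, ENNReal.ofReal_mul (p := 3) (by norm_num), ENNReal.ofReal_ofNat]
        push_cast
        ring

lemma kernelBound_dirac {θ : ℝ} (t : ℝ) :
    KernelBound (Measure.dirac t) θ 2 (3 * θ / 2) 1 := by
  intro y hy φ hφ
  rw [Measure.dirac_prod_dirac, lintegral_dirac' _ (by unfold waveKer; fun_prop),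
    lintegral_dirac' _ (by fun_prop)]
  simp only [sub_self, waveKer, abs_zero, add_zero]
  rw [div_self two_ne_zero, ENNReal.rpow_one, ENNReal.rpow_two, one_mul, mul_assoc, sq (φ t)]
  refine le_of_eq ?_
  congr 2
  rw [one_div, Real.inv_rpow (by positivity), ← Real.rpow_neg (by positivity),
    show y ^ 2 * y = y ^ 3 by ring, ← Real.rpow_natCast, ← Real.rpow_mul hy.le]
  congr 1; push_cast; ring

lemma waveKer_le {θ a y : ℝ} (ha : 0 ≤ a) (haθ : a ≤ θ) (hy : 0 < y) {m : ℝ} (hm : m ≠ 0) :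
    waveKer θ y m ≤ y ^ (-(3 * θ - a)) * |m| ^ (-a) := by
  have hm' : 0 < |m| := abs_pos.2 hm
  have h1 : waveKer θ y m = y ^ (-(2 * θ)) * ((y + |m|) ^ (-(θ - a)) * (y + |m|) ^ (-a)) := by
    rw [waveKer, one_div, Real.inv_rpow (by positivity), ← Real.rpow_neg (by positivity),
      Real.mul_rpow (by positivity) (by positivity), ← Real.rpow_add (by positivity),
      ← Real.rpow_two, ← Real.rpow_mul hy.le]
    congr 2 <;> ring
  have h2 : y ^ (-(3 * θ - a)) = y ^ (-(2 * θ)) * y ^ (-(θ - a)) := by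
    rw [← Real.rpow_add hy]; congr 1; ring
  rw [h1, h2, mul_assoc]
  refine mul_le_mul_of_nonneg_left (mul_le_mul ?_ ?_ (by positivity) (by positivity))
    (by positivity)
  · exact Real.rpow_le_rpow_of_nonpos hy (by linarith) (by linarith)
  · exact Real.rpow_le_rpow_of_nonpos hm' (by linarith) (by linarith)

lemma ofReal_waveKer_le {θ a y : ℝ} (ha : 0 < a) (haθ : a ≤ θ) (hy : 0 < y) (m : ℝ) :
    ENNReal.ofReal (waveKer θ y m) ≤
      ENNReal.ofReal (y ^ (-(3 * θ - a))) * ENNReal.ofReal |m| ^ (-a) := by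
  rcases eq_or_ne m 0 with rfl | hm
  · rw [abs_zero, ENNReal.ofReal_zero, ENNReal.zero_rpow_of_neg (by linarith),
      ENNReal.mul_top (ENNReal.ofReal_pos.2 (by positivity)).ne']
    exact le_top
  · rw [ENNReal.ofReal_rpow_of_pos (abs_pos.2 hm), ← ENNReal.ofReal_mul (by positivity)]
    exact ENNReal.ofReal_le_ofReal (waveKer_le ha.le haθ hy hm)

lemma kernelBound_restrict {θ P P' : ℝ} (hP : 2 < P) (hPP : P.HolderConjugate P')
    (hθ : 2 / P ≤ θ) {S : Set ℝ} (hS : MeasurableSet S) :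
    KernelBound (volume.restrict S) θ P' ((3 * θ - 2 / P) / 2)
      (2 * (2 / (1 - 2 / P) + 2 ^ (1 / P))) := by
  intro y hy φ hφ
  have ha : 0 < 2 / P := by positivity
  have h2P : 2 / P < 1 := by rw [div_lt_one (by linarith)]; exact hP
  have hP' := hPP.symm.pos
  obtain ⟨ψ, hψ⟩ : ∃ ψ : ℝ → ℝ≥0∞, ψ = S.indicator φ := ⟨_, rfl⟩
  have hψm : Measurable ψ := hψ ▸ hφ.indicator hS
  have hψφ : ∀ t ∈ S, φ t = ψ t := fun t ht => by rw [hψ, indicator_of_mem ht]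
  have h1 := hls hP hPP hψm
  have e1 : ∫⁻ t, ψ t ^ P' = ∫⁻ t in S, φ t ^ P' := by
    rw [← lintegral_indicator hS]
    congr 1; ext t
    by_cases ht : t ∈ S
    · simp [hψ, ht]
    · simp [hψ, ht, hP']
  rw [e1] at h1
  have hmk : Measurable fun z : ℝ × ℝ => ENNReal.ofReal (waveKer θ y (z.1 - z.2)) := by
    unfold waveKer; fun_prop
  rw [lintegral_prod _ (by fun_prop)]
  calc ∫⁻ t in S, ∫⁻ s in S, ENNReal.ofReal (waveKer θ y (t - s)) * φ t * φ s
      ≤ ∫⁻ t in S, ∫⁻ s in S, ENNReal.ofReal (y ^ (-(3 * θ - 2 / P))) *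
        (ENNReal.ofReal |t - s| ^ (-(2 / P)) * ψ s * ψ t) := by
        refine setLIntegral_mono' hS fun t ht => setLIntegral_mono' hS fun s hs => ?_
        rw [hψφ t ht, hψφ s hs]
        refine (mul_le_mul' (mul_le_mul' (ofReal_waveKer_le ha hθ hy (t - s)) le_rfl) le_rfl).trans
          (le_of_eq (by ring))
    _ ≤ ∫⁻ t, ∫⁻ s, ENNReal.ofReal (y ^ (-(3 * θ - 2 / P))) *
        (ENNReal.ofReal |t - s| ^ (-(2 / P)) * ψ s * ψ t) :=
        (lintegral_mono fun _ => lintegral_mono' Measure.restrict_le_self le_rfl).trans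
          (lintegral_mono' Measure.restrict_le_self le_rfl)
    _ = ENNReal.ofReal (y ^ (-(3 * θ - 2 / P))) *
        ∫⁻ t, ∫⁻ s, ENNReal.ofReal |t - s| ^ (-(2 / P)) * ψ s * ψ t := by
        simp only [lintegral_const_mul' _ _ ENNReal.ofReal_ne_top]
    _ ≤ _ := by
        refine (mul_le_mul' le_rfl h1).trans (le_of_eq ?_)
        rw [← ENNReal.ofReal_ofNat (n := 2), ← ENNReal.ofReal_mul zero_le_two, ← mul_assoc,
          ← ENNReal.ofReal_mul (by positivity)]
        congr 2
        rw [mul_div_cancel₀ _ (two_ne_zero' ℝ)]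
        ring

lemma measurable_wave (σ : ℝ) {h : E3 → ℂ} (hm : Measurable h) :
    Measurable fun p : ℝ × E3 => wave σ h p.1 p.2 := by
  refine measurable_fourierInv_param
    (K := fun (t : ℝ) ξ => Complex.exp (Complex.I * (σ * (2 * Real.pi * t * ‖ξ‖))) * h ξ) ?_
  exact (Continuous.measurable (by fun_prop)).mul (hm.comp measurable_snd)

/-- The homogeneous Strichartz estimate with regularity `s`. -/
def HomStrichartz (p q : ℝ≥0∞) (s : ℝ) (C : ℝ≥0) : Prop :=
  ∀ σ : ℝ, |σ| = 1 → ∀ h : E3 → ℂ, Dec 7 h →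
    eLpNorm (fun t => eLpNorm (wave σ h t) q volume) p volume ≤
      C * (∫⁻ ξ, ENNReal.ofReal (‖ξ‖ ^ (2 * s)) * ‖h ξ‖ₑ ^ 2) ^ (1 / 2 : ℝ)

lemma homStrichartz_energy : HomStrichartz ∞ 2 0 1 := by
  intro σ hσ h hh
  rw [eLpNorm_exponent_top, eLpNormEssSup]
  refine essSup_le_of_ae_le _ (ae_of_all _ fun t => ?_)
  have hd := hh.wave σ t
  simp only [enorm_eq_self]
  rw [wave, eLpNorm_fourierInv (hd.integrable (by norm_num))
    (hd.memLp (by norm_num)), eLpNorm_eq_eLpNorm' two_ne_zero ENNReal.ofNat_ne_top, eLpNorm']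
  refine le_of_eq ?_
  simp [← ofReal_norm, norm_wave_symbol]

lemma sq_rpow_half (a : ℝ≥0∞) : (a ^ 2) ^ (1 / 2 : ℝ) = a := by
  rw [← ENNReal.rpow_two, ← ENNReal.rpow_mul]; norm_num

lemma homStrichartz_top {q : ℝ} (hq : 2 < q) :
    ∃ C, HomStrichartz ∞ (ENNReal.ofReal q) (3 / 2 - 3 / q) C := by
  have hq0 : 0 < q := by linarith
  have hqr : q.HolderConjugate q.conjExponent := .conjExponent (by linarith)
  refine ⟨(ENNReal.ofReal (4 * (q * (q - 1)) * (3 * (dispC q.conjExponent * 1 *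
        (Real.exp (4 * Real.pi ^ 2) * (4 * Real.pi ^ 2) *
          Real.Gamma (3 - (3 * (1 - 2 / q) / 2))))))).toNNReal ^ (1 / 2 : ℝ), ?_⟩
  intro σ hσ h hh
  rw [eLpNorm_exponent_top, eLpNormEssSup]
  refine essSup_le_of_ae_le _ (ae_of_all _ fun t => ?_)
  have h1 := strichartz_wave (ν := Measure.dirac t) (P := 2) (P' := 2) hσ hq hqr le_rfl
    (by rw [Real.holderConjugate_iff]; norm_num)
    (by have : 0 < 2 / q := by positivity
        linarith) zero_le_one (kernelBound_dirac t) hh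
  have hm : Measurable fun t => eLpNorm' (wave σ h t) q volume := by
    unfold eLpNorm'
    exact (Measurable.lintegral_prod_right' ((measurable_wave σ hh.1).enorm.pow_const q)).pow_const _
  rw [lintegral_dirac' _ (hm.pow_const _), div_self two_ne_zero, ENNReal.rpow_one,
    ENNReal.rpow_two] at h1
  have e : 2 * (3 * (1 - 2 / q) / 2) = 2 * (3 / 2 - 3 / q) := by ring
  rw [e] at h1
  have h2 := ENNReal.rpow_le_rpow h1 (by norm_num : (0:ℝ) ≤ 1 / 2)
  rw [sq_rpow_half, ENNReal.mul_rpow_of_nonneg _ _ (by norm_num)] at h2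
  simp only [enorm_eq_self]
  rw [eLpNorm_eq_eLpNorm' (by simpa using hq0) ENNReal.ofReal_ne_top,
    ENNReal.toReal_ofReal hq0.le]
  refine h2.trans (le_of_eq ?_)
  rw [ENNReal.coe_rpow_of_nonneg _ (by norm_num), ENNReal.coe_toNNReal ENNReal.ofReal_ne_top]

lemma homStrichartz_lt_top {p q : ℝ} (hp : 2 < p) (hq : 2 < q) (hpq : 1 / p + 1 / q ≤ 1 / 2) :
    ∃ C, HomStrichartz (ENNReal.ofReal p) (ENNReal.ofReal q) (3 / 2 - 1 / p - 3 / q) C := by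
  have hq0 : 0 < q := by linarith
  have hp0 : 0 < p := by linarith
  have hqr : q.HolderConjugate q.conjExponent := .conjExponent (by linarith)
  have hpp : p.HolderConjugate p.conjExponent := .conjExponent (by linarith)
  have hθ : 2 / p ≤ 1 - 2 / q := by
    have e1 : 2 / p = 2 * (1 / p) := by ring
    have e2 : 2 / q = 2 * (1 / q) := by ring
    linarith
  have h2p : 2 / p < 1 := by rw [div_lt_one (by linarith)]; exact hp
  obtain ⟨A, hA⟩ : ∃ A, A = 4 * (q * (q - 1)) * (3 * (dispC q.conjExponent *
      (2 * (2 / (1 - 2 / p) + 2 ^ (1 / p))) *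
        (Real.exp (4 * Real.pi ^ 2) * (4 * Real.pi ^ 2) *
          Real.Gamma (3 - ((3 * (1 - 2 / q) - 2 / p) / 2))))) := ⟨_, rfl⟩
  refine ⟨(ENNReal.ofReal A).toNNReal ^ (1 / 2 : ℝ), ?_⟩
  intro σ hσ h hh
  obtain ⟨B, hB⟩ : ∃ B, B = ENNReal.ofReal A *
    ∫⁻ ξ, ENNReal.ofReal (‖ξ‖ ^ (2 * (3 / 2 - 1 / p - 3 / q))) * ‖h ξ‖ₑ ^ 2 := ⟨_, rfl⟩
  have h1 : ∀ R : ℝ, ∫⁻ t in Icc (-R) R, eLpNorm' (wave σ h t) q volume ^ p ≤ B ^ (p / 2) := by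
    intro R
    have h1 := strichartz_wave (ν := volume.restrict (Icc (-R) R)) hσ hq hqr hp.le hpp
      (by have : 0 < 2 / q := by positivity
          have : 0 < 2 / p := by positivity
          linarith) (by have : 0 < 1 - 2 / p := by linarith
                        positivity) (kernelBound_restrict hp hpp hθ measurableSet_Icc) hh
    have e : 2 * ((3 * (1 - 2 / q) - 2 / p) / 2) = 2 * (3 / 2 - 1 / p - 3 / q) := by ring
    rw [← hA, e, ← hB] at h1
    have h2 := ENNReal.rpow_le_rpow h1 (by positivity : 0 ≤ p / 2)
    rwa [← ENNReal.rpow_mul, div_mul_div_cancel₀ hp0.ne', div_self two_ne_zero,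
      ENNReal.rpow_one] at h2
  have h2 : ∫⁻ t, eLpNorm' (wave σ h t) q volume ^ p ≤ B ^ (p / 2) := by
    have hU : ⋃ n : ℕ, Icc (-(n:ℝ)) n = univ := by
      refine eq_univ_of_forall fun t => ?_
      obtain ⟨n, hn⟩ := exists_nat_ge |t|
      exact mem_iUnion.2 ⟨n, abs_le.1 hn⟩
    rw [← setLIntegral_univ, ← hU, setLIntegral_iUnion_of_directed]
    · exact iSup_le fun n => h1 n
    · refine (monotone_nat_of_le_succ fun n => Icc_subset_Icc ?_ ?_).directed_le
      · push_cast; linarith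
      · push_cast; linarith
  have hp' : ENNReal.ofReal p ≠ 0 := by simpa using hp0
  have hq' : ENNReal.ofReal q ≠ 0 := by simpa using hq0
  rw [eLpNorm_eq_eLpNorm' hp' ENNReal.ofReal_ne_top, ENNReal.toReal_ofReal hp0.le, eLpNorm']
  simp only [enorm_eq_self, eLpNorm_eq_eLpNorm' hq' ENNReal.ofReal_ne_top,
    ENNReal.toReal_ofReal hq0.le]
  refine (ENNReal.rpow_le_rpow h2 (by positivity)).trans (le_of_eq ?_)
  rw [← ENNReal.rpow_mul, hB, ENNReal.coe_rpow_of_nonneg _ (by norm_num),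
    ENNReal.coe_toNNReal ENNReal.ofReal_ne_top, ← ENNReal.mul_rpow_of_nonneg _ _ (by norm_num)]
  congr 1
  field_simp


/-- The homogeneous Strichartz estimate for all wave-admissible exponents. -/
theorem homStrichartz {p q : ℝ≥0∞} (hp : 2 ≤ p) (hq2 : 2 ≤ q) (hq : q ≠ ∞)
    (hadm : 1 / p + 1 / q ≤ 1 / 2) :
    ∃ C, HomStrichartz p q (3 / 2 - 1 / p.toReal - 3 / q.toReal) C := by
  have hqe := ENNReal.ofReal_toReal hq
  have hq0 : q ≠ 0 := (two_pos.trans_le hq2).ne'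
  have hq2r : 2 ≤ q.toReal := by simpa using ENNReal.toReal_mono hq hq2
  rcases eq_or_ne p ∞ with rfl | hpT
  · rw [ENNReal.toReal_top, div_zero, sub_zero]
    rcases hq2r.eq_or_lt with h | h
    · refine ⟨1, ?_⟩
      have : q = 2 := by rw [← hqe, ← h]; simp
      rw [this]
      norm_num
      exact homStrichartz_energy
    · obtain ⟨C, hC⟩ := homStrichartz_top h
      rw [hqe] at hC
      exact ⟨C, hC⟩
  · have hpe := ENNReal.ofReal_toReal hpT
    have hp0 : p ≠ 0 := (two_pos.trans_le hp).ne'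
    have hadm' : 1 / p.toReal + 1 / q.toReal ≤ 1 / 2 := by
      have h1 := ENNReal.toReal_mono (by simp) hadm
      rw [ENNReal.toReal_add (by simp [hp0]) (by simp [hq0])] at h1
      simpa using h1
    have hpr := ENNReal.toReal_pos hp0 hpT
    have hqr := ENNReal.toReal_pos hq0 hq
    have hp2 : 2 < p.toReal := by
      have : 0 < 1 / q.toReal := by positivity
      exact (one_div_lt_one_div hpr two_pos).1 (by linarith)
    have hq2 : 2 < q.toReal := by
      have : 0 < 1 / p.toReal := by positivity
      exact (one_div_lt_one_div hqr two_pos).1 (by linarith)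
    obtain ⟨C, hC⟩ := homStrichartz_lt_top hp2 hq2 hadm'
    rw [hqe, hpe] at hC
    exact ⟨C, hC⟩

section

open ComplexConjugate

/-- Hölder's inequality with the dual exponent written as `(1 - 1 / p)⁻¹`. -/
lemma lintegral_mul_le_eLpNorm_mul {α : Type*} [MeasurableSpace α] {μ : Measure α} {p : ℝ≥0∞}
    (hp : 2 ≤ p) {f g : α → ℝ≥0∞} (hf : Measurable f) (hg : Measurable g) :
    ∫⁻ a, f a * g a ∂μ ≤ eLpNorm f (1 - 1 / p)⁻¹ μ * eLpNorm g p μ := by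
  rcases eq_or_ne p ∞ with rfl | hpT
  · have h1 : (1 - 1 / ∞ : ℝ≥0∞)⁻¹ = 1 := by simp
    rw [h1, eLpNorm_one_eq_lintegral_enorm, eLpNorm_exponent_top, eLpNormEssSup]
    simp only [enorm_eq_self]
    rw [← lintegral_mul_const _ hf]
    refine lintegral_mono_ae ?_
    filter_upwards [ENNReal.ae_le_essSup g] with a ha
    exact mul_le_mul' le_rfl ha
  · have hp0 : p ≠ 0 := (two_pos.trans_le hp).ne'
    have hp2 : 2 ≤ p.toReal := by simpa using ENNReal.toReal_mono hpT hp
    have hc : (p.toReal.conjExponent).HolderConjugate p.toReal :=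
      (Real.HolderConjugate.conjExponent (by linarith)).symm
    have e : (1 - 1 / p)⁻¹ = ENNReal.ofReal p.toReal.conjExponent := by
      have h1 : 1 - 1 / p = ENNReal.ofReal (1 - 1 / p.toReal) := by
        rw [ENNReal.ofReal_sub _ (by positivity), ENNReal.ofReal_one, one_div, one_div,
          ENNReal.ofReal_inv_of_pos (by linarith), ENNReal.ofReal_toReal hpT]
      have h2 : 1 - 1 / p.toReal = p.toReal.conjExponent⁻¹ := by
        have := hc.inv_add_inv_eq_one
        rw [one_div]; linarith
      rw [h1, h2, ENNReal.ofReal_inv_of_pos hc.pos, inv_inv]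
    rw [e, eLpNorm_eq_eLpNorm' (by simpa using hc.pos) ENNReal.ofReal_ne_top,
      eLpNorm_eq_eLpNorm' hp0 hpT, ENNReal.toReal_ofReal hc.nonneg, eLpNorm', eLpNorm']
    exact ENNReal.lintegral_mul_le_Lp_mul_Lq μ hc hf.aemeasurable hg.aemeasurable

/-- Polynomial decay in frequency, uniformly in time. -/
def UDec (k : ℕ) (H : ℝ → E3 → ℂ) : Prop :=
  Measurable (Function.uncurry H) ∧ ∃ C : ℝ, ∀ s ξ, ‖H s ξ‖ * (1 + ‖ξ‖) ^ k ≤ C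

lemma UDec.dec {k : ℕ} {H : ℝ → E3 → ℂ} (hH : UDec k H) (s : ℝ) : Dec k (H s) :=
  ⟨hH.1.comp (measurable_const.prodMk measurable_id), hH.2.imp fun _ h => h s⟩

lemma UDec.mul {k l : ℕ} {H m : ℝ → E3 → ℂ} {K : ℝ} (hH : UDec (k + l) H)
    (hm : Measurable (Function.uncurry m)) (hK : ∀ s ξ, ‖m s ξ‖ ≤ K * (1 + ‖ξ‖) ^ l) :
    UDec k (fun s ξ => m s ξ * H s ξ) := by
  obtain ⟨h1, C, hC⟩ := hH
  have hK0 : 0 ≤ K := by simpa using (norm_nonneg _).trans (hK 0 0)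
  refine ⟨hm.mul h1, K * C, fun s ξ => ?_⟩
  rw [norm_mul]
  calc ‖m s ξ‖ * ‖H s ξ‖ * (1 + ‖ξ‖) ^ k ≤ K * (1 + ‖ξ‖) ^ l * ‖H s ξ‖ * (1 + ‖ξ‖) ^ k := by
        gcongr; exact hK s ξ
    _ = K * (‖H s ξ‖ * (1 + ‖ξ‖) ^ (k + l)) := by ring
    _ ≤ K * C := by gcongr; exact hC s ξ

lemma UDec.mono {k l : ℕ} {H : ℝ → E3 → ℂ} (hH : UDec l H) (hkl : k ≤ l) : UDec k H := by
  obtain ⟨h1, C, hC⟩ := hH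
  refine ⟨h1, C, fun s ξ => le_trans ?_ (hC s ξ)⟩
  gcongr
  simp

lemma UDec.integrable {H : ℝ → E3 → ℂ} (hH : UDec 4 H) (ν : Measure ℝ) [IsFiniteMeasure ν] :
    Integrable (Function.uncurry H) (ν.prod volume) := by
  obtain ⟨h1, C, hC⟩ := hH
  have h0 : Integrable (fun ξ : E3 => C * (1 + ‖ξ‖) ^ (-(4:ℝ))) :=
    (integrable_one_add_norm (by simp; norm_num)).const_mul C
  refine ((integrable_const (μ := ν) (1:ℝ)).mul_prod h0).mono' h1.aestronglyMeasurable
    (ae_of_all _ fun p => ?_)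
  have hp : 0 < 1 + ‖p.2‖ := by positivity
  rw [one_mul, Real.rpow_neg hp.le, ← div_eq_mul_inv, le_div_iff₀ (by positivity)]
  exact_mod_cast hC p.1 p.2

lemma UDec.integral {k : ℕ} {H : ℝ → E3 → ℂ} (hH : UDec k H) (ν : Measure ℝ)
    [IsFiniteMeasure ν] : Dec k fun ξ => ∫ s, H s ξ ∂ν := by
  obtain ⟨h1, C, hC⟩ := hH
  refine ⟨(h1.stronglyMeasurable.integral_prod_left' (μ := ν)).measurable, C * ν.real univ,
    fun ξ => ?_⟩
  have hp : 0 < (1 + ‖ξ‖) ^ k := by positivity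
  have := norm_integral_le_of_norm_le_const (μ := ν) (f := fun s => H s ξ) (C := C / (1 + ‖ξ‖) ^ k)
    (ae_of_all _ fun s => by rw [le_div_iff₀ hp]; exact hC s ξ)
  calc _ ≤ C / (1 + ‖ξ‖) ^ k * ν.real univ * (1 + ‖ξ‖) ^ k := by gcongr
    _ = _ := by field_simp

/-- The frequency profile of the data generated by the forcing `H` on the support of `ν`. -/
def duhamelData (ν : Measure ℝ) (σ : ℝ) (H : ℝ → E3 → ℂ) (ξ : E3) : ℂ :=
  ∫ s, Complex.exp (-(Complex.I * (σ * (2 * Real.pi * s * ‖ξ‖)))) * H s ξ ∂ν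

lemma norm_wave_symbol_neg (σ t : ℝ) (ξ : E3) :
    ‖Complex.exp (-(Complex.I * (σ * (2 * Real.pi * t * ‖ξ‖))))‖ = 1 := by
  have := norm_wave_symbol σ t ξ
  rw [Complex.exp_neg, norm_inv, this, inv_one]

lemma UDec.wave {k : ℕ} {H : ℝ → E3 → ℂ} (hH : UDec k H) (σ : ℝ) :
    UDec k fun s ξ => Complex.exp (-(Complex.I * (σ * (2 * Real.pi * s * ‖ξ‖)))) * H s ξ := by
  refine UDec.mul (l := 0) (K := 1)
    (m := fun s ξ => Complex.exp (-(Complex.I * (σ * (2 * Real.pi * s * ‖ξ‖))))) hH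
    (Continuous.measurable (by fun_prop)) fun s ξ => ?_
  rw [norm_wave_symbol_neg]; simp

lemma UDec.duhamelData {k : ℕ} {H : ℝ → E3 → ℂ} (hH : UDec k H) (ν : Measure ℝ)
    [IsFiniteMeasure ν] (σ : ℝ) : Dec k (duhamelData ν σ H) :=
  (hH.wave σ).integral ν

lemma measurable_eLpNorm_param {u : ℝ → E3 → ℂ} (hu : Measurable (Function.uncurry u))
    {q : ℝ≥0∞} (hq : q ≠ ∞) : Measurable fun t => eLpNorm (u t) q volume := by
  rcases eq_or_ne q 0 with rfl | hq0
  · simp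
  simp only [eLpNorm_eq_eLpNorm' hq0 hq, eLpNorm']
  exact (Measurable.lintegral_prod_right' (hu.enorm.pow_const _)).pow_const _

lemma dual_exponent_ne_top {q : ℝ≥0∞} (hq : 2 ≤ q) : (1 - 1 / q)⁻¹ ≠ ∞ := by
  rw [ne_eq, ENNReal.inv_eq_top, tsub_eq_zero_iff_le, not_le]
  calc 1 / q ≤ 1 / 2 := by gcongr
    _ < 1 := by simp

lemma duhamelData_pairing {ν : Measure ℝ} [IsFiniteMeasure ν] {q : ℝ≥0∞} (hq : 2 ≤ q) (σ : ℝ) {G : ℝ → E3 → ℂ} (hG : UDec 4 G) {ψ : E3 → ℂ} (hψ : Dec 4 ψ) :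
    ‖∫ ξ, duhamelData ν σ G ξ * conj (ψ ξ)‖ₑ ≤
      ∫⁻ s, eLpNorm (𝓕⁻ (G s)) (1 - 1 / q)⁻¹ volume * eLpNorm (wave σ ψ s) q volume ∂ν := by
  have hm : Measurable fun p : ℝ × E3 => conj (ψ p.2) :=
    Complex.continuous_conj.measurable.comp (hψ.1.comp measurable_snd)
  have hU : UDec 4 fun s ξ => conj (ψ ξ) *
      (Complex.exp (-(Complex.I * (σ * (2 * Real.pi * s * ‖ξ‖)))) * G s ξ) := by
    obtain ⟨C, hC⟩ := (hψ.mono (Nat.zero_le _)).2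
    refine UDec.mul (l := 0) (K := C) (m := fun _ ξ => conj (ψ ξ)) (hG.wave σ) hm fun s ξ => ?_
    simpa using hC ξ
  have e1 : ∫ ξ, duhamelData ν σ G ξ * conj (ψ ξ) = ∫ s, (∫ ξ, G s ξ *
      conj (Complex.exp (Complex.I * (σ * (2 * Real.pi * s * ‖ξ‖))) * ψ ξ)) ∂ν := by
    rw [integral_integral_swap]
    · congr 1; ext ξ
      rw [duhamelData, ← integral_mul_const]
      congr 1; ext s
      rw [map_mul, ← Complex.exp_conj]
      simp only [map_mul, Complex.conj_I, Complex.conj_ofReal, map_ofNat]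
      rw [neg_mul]; ring
    · refine (hU.integrable ν).congr (ae_of_all _ fun p => ?_)
      simp only [Function.uncurry_def, map_mul, ← Complex.exp_conj, Complex.conj_I,
        Complex.conj_ofReal, map_ofNat]
      rw [neg_mul]; ring
  rw [e1]
  refine (enorm_integral_le_lintegral_enorm _).trans (lintegral_mono fun s => ?_)
  have hd := hψ.wave σ s
  rw [← integral_fourierInv_mul_conj ((hG.dec s).integrable le_rfl) ((hG.dec s).memLp le_rfl)
    (hd.integrable le_rfl) (hd.memLp le_rfl)]
  refine (enorm_integral_le_lintegral_enorm _).trans ?_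
  have h1 : Continuous (𝓕⁻ (G s)) := continuous_fourierInv3 ((hG.dec s).integrable le_rfl)
  have h2 : Continuous (wave σ ψ s) := continuous_fourierInv3 (hd.integrable le_rfl)
  have h3 := lintegral_mul_le_eLpNorm_mul (μ := (volume : Measure E3)) hq h1.measurable.enorm
    h2.measurable.enorm
  rw [eLpNorm_enorm, eLpNorm_enorm] at h3
  refine le_trans (le_of_eq ?_) h3
  congr 1; ext x
  rw [enorm_mul]
  congr 1
  rw [← ofReal_norm, ← ofReal_norm, RCLike.norm_conj]
  rfl

lemma ofReal_rpow_add_mul_sq {r a b : ℝ} (hr : 0 < r) (z : ℂ) :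
    ENNReal.ofReal (r ^ (2 * a)) * ‖((r ^ b : ℝ) : ℂ) * z‖ₑ ^ 2 =
      ENNReal.ofReal (r ^ (2 * (a + b))) * ‖z‖ₑ ^ 2 := by
  rw [enorm_mul, mul_pow, ← mul_assoc, ← ofReal_norm, Complex.norm_real,
    Real.norm_of_nonneg (by positivity), ← ENNReal.ofReal_pow (by positivity),
    ← ENNReal.ofReal_mul (by positivity), ← Real.rpow_natCast, ← Real.rpow_mul hr.le,
    ← Real.rpow_add hr]
  congr 3; push_cast; ring

lemma rpow_le_one_add_pow {r a : ℝ} {n : ℕ} (hr : 0 ≤ r) (ha : 0 ≤ a) (han : a ≤ n) :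
    r ^ a ≤ (1 + r) ^ n := by
  calc r ^ a ≤ (1 + r) ^ a := Real.rpow_le_rpow hr (by linarith) ha
    _ ≤ (1 + r) ^ (n : ℝ) := Real.rpow_le_rpow_of_exponent_le (by linarith) han
    _ = _ := Real.rpow_natCast _ _

/-- The forcing after applying `|∇|^a`. -/
def gradForcing (a : ℝ) (H : ℝ → E3 → ℂ) (s : ℝ) (ξ : E3) : ℂ :=
  (((2 * Real.pi * ‖ξ‖) ^ a : ℝ) : ℂ) * H s ξ

lemma norm_gradSymbol_le {a : ℝ} (ha : 0 ≤ a) (ha3 : a ≤ 3) (ξ : E3) :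
    ‖(((2 * Real.pi * ‖ξ‖) ^ a : ℝ) : ℂ)‖ ≤ (2 * Real.pi) ^ a * (1 + ‖ξ‖) ^ 3 := by
  rw [Complex.norm_real, Real.norm_of_nonneg (by positivity),
    Real.mul_rpow (by positivity) (norm_nonneg _)]
  gcongr
  exact rpow_le_one_add_pow (norm_nonneg _) ha (by exact_mod_cast ha3)

lemma UDec.gradForcing {k : ℕ} {a : ℝ} (ha : 0 ≤ a) (ha3 : a ≤ 3) {H : ℝ → E3 → ℂ}
    (hH : UDec (k + 3) H) : UDec k (gradForcing a H) :=
  UDec.mul (m := fun _ ξ => (((2 * Real.pi * ‖ξ‖) ^ a : ℝ) : ℂ)) hH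
    (by simp only [Function.uncurry_def]; fun_prop) fun _ ξ => norm_gradSymbol_le ha ha3 ξ

/-- The dual Strichartz estimate, away from the zero frequency. -/
lemma dual_strichartz_annulus {q p : ℝ≥0∞} {s t : ℝ} {C : ℝ≥0} (hp : 2 ≤ p) (hq : 2 ≤ q)
    (hqT : q ≠ ∞) (hC : HomStrichartz p q t C) (hst : 0 ≤ s + t) (hst3 : s + t ≤ 3) (hs : s - t ≤ 2)
    {σ : ℝ} (hσ : |σ| = 1) {ν : Measure ℝ} [IsFiniteMeasure ν] (hν : ν ≤ volume)
    {H : ℝ → E3 → ℂ} (hH : UDec 12 H) {δ : ℝ} (hδ : 0 < δ) :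
    (∫⁻ ξ in {ξ | δ ≤ ‖ξ‖}, ENNReal.ofReal (‖ξ‖ ^ (2 * s)) * ‖duhamelData ν σ H ξ‖ₑ ^ 2) ^
        (1 / 2 : ℝ) ≤
      C * eLpNorm (fun τ => eLpNorm (𝓕⁻ (gradForcing (s + t) H τ)) (1 - 1 / q)⁻¹ volume)
        (1 - 1 / p)⁻¹ ν := by
  have hS : MeasurableSet {ξ : E3 | δ ≤ ‖ξ‖} := measurableSet_le measurable_const measurable_norm
  obtain ⟨f, hf⟩ : ∃ f, f = duhamelData ν σ H := ⟨_, rfl⟩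
  have hfd : Dec 12 f := hf ▸ hH.duhamelData ν σ
  obtain ⟨m, hm⟩ : ∃ m : E3 → ℝ, m = {ξ : E3 | δ ≤ ‖ξ‖}.indicator fun ξ => ‖ξ‖ ^ (s - t) :=
    ⟨_, rfl⟩
  have hmm : Measurable m := hm ▸ Measurable.indicator (by fun_prop) hS
  have hm0 : ∀ ξ, 0 ≤ m ξ := fun ξ => hm ▸ indicator_nonneg (fun ξ _ => by positivity) ξ
  have hmb : ∀ ξ, ‖(m ξ : ℂ)‖ ≤ (1 + δ ^ (s - t)) * (1 + ‖ξ‖) ^ 2 := by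
    intro ξ
    rw [Complex.norm_real, Real.norm_of_nonneg (hm0 ξ), hm]
    have hδ' : 0 < δ ^ (s - t) := by positivity
    have h1 : 1 ≤ (1 + ‖ξ‖) ^ 2 := one_le_pow₀ (by linarith [norm_nonneg ξ])
    by_cases hξ : δ ≤ ‖ξ‖
    · rw [indicator_of_mem (by exact hξ)]
      rcases le_total 0 (s - t) with h | h
      · have := rpow_le_one_add_pow (n := 2) (norm_nonneg ξ) h (by exact_mod_cast hs)
        nlinarith
      · have := Real.rpow_le_rpow_of_nonpos hδ hξ h
        nlinarith
    · rw [indicator_of_notMem (by exact hξ)]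
      positivity
  have hψ : Dec 7 fun ξ => (m ξ : ℂ) * f ξ :=
    Dec.mul (l := 2) (hfd.mono (by norm_num)) (by fun_prop) hmb
  have hG : UDec 4 (gradForcing (s + t) H) := UDec.gradForcing hst hst3 (hH.mono (by norm_num))
  obtain ⟨X, hX⟩ : ∃ X, X = ∫⁻ ξ in {ξ | δ ≤ ‖ξ‖}, ENNReal.ofReal (‖ξ‖ ^ (2 * s)) *
    ‖f ξ‖ₑ ^ 2 := ⟨_, rfl⟩
  have eD : ∀ ξ, duhamelData ν σ (gradForcing (s + t) H) ξ =
      (((2 * Real.pi * ‖ξ‖) ^ (s + t) : ℝ) : ℂ) * f ξ := by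
    intro ξ
    rw [hf, duhamelData, duhamelData, ← integral_const_mul]
    congr 1; ext τ
    rw [gradForcing]; ring
  have eW : ∀ ξ, duhamelData ν σ (gradForcing (s + t) H) ξ * conj ((m ξ : ℂ) * f ξ) =
      (((2 * Real.pi * ‖ξ‖) ^ (s + t) * m ξ * ‖f ξ‖ ^ 2 : ℝ) : ℂ) := by
    intro ξ
    rw [eD, map_mul, Complex.conj_ofReal]
    push_cast
    rw [← Complex.mul_conj']
    ring
  have hw0 : ∀ ξ, 0 ≤ (2 * Real.pi * ‖ξ‖) ^ (s + t) * m ξ * ‖f ξ‖ ^ 2 := fun ξ => by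
    have := hm0 ξ
    positivity
  have hWi : Integrable fun ξ => (2 * Real.pi * ‖ξ‖) ^ (s + t) * m ξ * ‖f ξ‖ ^ 2 := by
    obtain ⟨K, hK⟩ := (hψ.mono (Nat.zero_le _)).2
    have h1 : Dec 4 fun ξ => conj ((m ξ : ℂ) * f ξ) *
        duhamelData ν σ (gradForcing (s + t) H) ξ :=
      (hG.duhamelData ν σ).mul_bdd (K := K) (Complex.continuous_conj.measurable.comp hψ.1)
        fun ξ => by rw [RCLike.norm_conj]; simpa using hK ξ
    refine (h1.integrable le_rfl).norm.congr (ae_of_all _ fun ξ => ?_)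
    simp only []
    rw [mul_comm, eW, Complex.norm_real, Real.norm_of_nonneg (hw0 ξ)]
  have hXle : X ≤ ‖∫ ξ, duhamelData ν σ (gradForcing (s + t) H) ξ * conj ((m ξ : ℂ) * f ξ)‖ₑ := by
    simp only [eW]
    rw [integral_complex_ofReal, ← ofReal_norm, Complex.norm_real,
      Real.norm_of_nonneg (integral_nonneg hw0),
      ofReal_integral_eq_lintegral_ofReal hWi (ae_of_all _ hw0), hX]
    refine (setLIntegral_mono' hS fun ξ hξ => ?_).trans (setLIntegral_le_lintegral _ _)
    have hr : 0 < ‖ξ‖ := hδ.trans_le hξ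
    rw [← ofReal_norm, ← ENNReal.ofReal_pow (norm_nonneg _), ← ENNReal.ofReal_mul (by positivity)]
    refine ENNReal.ofReal_le_ofReal (mul_le_mul_of_nonneg_right ?_ (by positivity))
    rw [hm, indicator_of_mem hξ]
    calc ‖ξ‖ ^ (2 * s) = ‖ξ‖ ^ (s + t) * ‖ξ‖ ^ (s - t) := by
          rw [← Real.rpow_add hr]; ring_nf
      _ ≤ _ := by
          gcongr
          nlinarith [Real.pi_gt_three]
  have hXT : X ≠ ∞ := ne_top_of_le_ne_top enorm_ne_top hXle
  have eX : ∫⁻ ξ, ENNReal.ofReal (‖ξ‖ ^ (2 * t)) * ‖(m ξ : ℂ) * f ξ‖ₑ ^ 2 = X := by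
    rw [hX, ← lintegral_indicator hS]
    congr 1; ext ξ
    by_cases hξ : δ ≤ ‖ξ‖
    · rw [hm, indicator_of_mem (by exact hξ), indicator_of_mem (by exact hξ),
        ofReal_rpow_add_mul_sq (hδ.trans_le hξ), add_sub_cancel]
    · rw [hm, indicator_of_notMem (by exact hξ), indicator_of_notMem (by exact hξ)]
      simp
  have hAm : Measurable fun τ =>
      eLpNorm (𝓕⁻ (gradForcing (s + t) H τ)) (1 - 1 / q)⁻¹ volume :=
    measurable_eLpNorm_param (u := fun τ => 𝓕⁻ (gradForcing (s + t) H τ))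
      (measurable_fourierInv_param hG.1) (dual_exponent_ne_top hq)
  have hBm : Measurable fun τ => eLpNorm (wave σ (fun ξ => (m ξ : ℂ) * f ξ) τ) q volume :=
    measurable_eLpNorm_param (u := wave σ fun ξ => (m ξ : ℂ) * f ξ) (measurable_wave σ hψ.1) hqT
  have hmain : X ≤ (C * eLpNorm (fun τ => eLpNorm (𝓕⁻ (gradForcing (s + t) H τ)) (1 - 1 / q)⁻¹
      volume) (1 - 1 / p)⁻¹ ν) * X ^ (1 / 2 : ℝ) := by
    refine (hXle.trans ((duhamelData_pairing hq σ hG (hψ.mono (by norm_num))).trans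
      (lintegral_mul_le_eLpNorm_mul hp hAm hBm))).trans ?_
    have h1 := (eLpNorm_mono_measure _ hν).trans (hC σ hσ _ hψ)
    rw [eX] at h1
    refine (mul_le_mul' le_rfl h1).trans (le_of_eq (by ring))
  rw [← hf, ← hX]
  exact rpow_le_of_le_mul_rpow (by rw [Real.holderConjugate_iff]; norm_num) hXT hmain

/-- The dual Strichartz estimate. -/
lemma dual_strichartz {q p : ℝ≥0∞} {s t : ℝ} {C : ℝ≥0} (hp : 2 ≤ p) (hq : 2 ≤ q)
    (hqT : q ≠ ∞) (hC : HomStrichartz p q t C) (hst : 0 ≤ s + t) (hst3 : s + t ≤ 3) (hs : s - t ≤ 2)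
    {σ : ℝ} (hσ : |σ| = 1) {ν : Measure ℝ} [IsFiniteMeasure ν] (hν : ν ≤ volume)
    {H : ℝ → E3 → ℂ} (hH : UDec 12 H) :
    (∫⁻ ξ, ENNReal.ofReal (‖ξ‖ ^ (2 * s)) * ‖duhamelData ν σ H ξ‖ₑ ^ 2) ^ (1 / 2 : ℝ) ≤
      C * eLpNorm (fun τ => eLpNorm (𝓕⁻ (gradForcing (s + t) H τ)) (1 - 1 / q)⁻¹ volume)
        (1 - 1 / p)⁻¹ ν := by
  obtain ⟨B, hB⟩ : ∃ B, B = C * eLpNorm (fun τ => eLpNorm (𝓕⁻ (gradForcing (s + t) H τ))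
    (1 - 1 / q)⁻¹ volume) (1 - 1 / p)⁻¹ ν := ⟨_, rfl⟩
  have h1 : ∀ n : ℕ, ∫⁻ ξ in {ξ : E3 | 1 / ((n : ℝ) + 1) ≤ ‖ξ‖}, ENNReal.ofReal (‖ξ‖ ^ (2 * s)) *
      ‖duhamelData ν σ H ξ‖ₑ ^ 2 ≤ B ^ 2 := by
    intro n
    have := ENNReal.rpow_le_rpow (dual_strichartz_annulus hp hq hqT hC hst hst3 hs hσ hν hH
      (δ := 1 / ((n : ℝ) + 1)) (by positivity)) (zero_le_two (α := ℝ))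
    rw [← hB, ← ENNReal.rpow_mul] at this
    simpa using this
  have hU : (⋃ n : ℕ, {ξ : E3 | 1 / ((n : ℝ) + 1) ≤ ‖ξ‖} : Set E3) =ᵐ[volume] univ := by
    have h0 : ∀ᵐ ξ : E3, ξ ≠ 0 := by simp [ae_iff]
    refine Filter.eventuallyEq_univ.2 ?_
    filter_upwards [h0] with ξ hξ
    obtain ⟨n, hn⟩ := exists_nat_one_div_lt (norm_pos_iff.2 hξ)
    exact mem_iUnion.2 ⟨n, hn.le⟩
  rw [← hB, ← setLIntegral_univ, ← setLIntegral_congr hU, setLIntegral_iUnion_of_directed]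
  · refine (ENNReal.rpow_le_rpow (iSup_le h1) (by norm_num)).trans_eq (sq_rpow_half B)
  · refine (monotone_nat_of_le_succ fun n ξ hξ => ?_).directed_le
    have hξ' : 1 / ((n : ℝ) + 1) ≤ ‖ξ‖ := hξ
    change 1 / (((n + 1 : ℕ) : ℝ) + 1) ≤ ‖ξ‖
    refine le_trans ?_ hξ'
    push_cast
    gcongr; linarith

/-- The untruncated inhomogeneous Strichartz estimate. -/
theorem strichartz_untruncated {p q pt qt : ℝ≥0∞} {s t : ℝ} {C C' : ℝ≥0}
    (hC : HomStrichartz p q s C) (hpt : 2 ≤ pt) (hqt : 2 ≤ qt) (hqtT : qt ≠ ∞)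
    (hC' : HomStrichartz pt qt t C') (hst : 0 ≤ s + t) (hst3 : s + t ≤ 3) (hs : s - t ≤ 2)
    {σ : ℝ} (hσ : |σ| = 1) {ν : Measure ℝ} [IsFiniteMeasure ν] (hν : ν ≤ volume)
    {H : ℝ → E3 → ℂ} (hH : UDec 12 H) :
    eLpNorm (fun τ => eLpNorm (wave σ (duhamelData ν σ H) τ) q volume) p volume ≤
      (C * C' : ℝ≥0) * eLpNorm (fun τ => eLpNorm (𝓕⁻ (gradForcing (s + t) H τ))
        (1 - 1 / qt)⁻¹ volume) (1 - 1 / pt)⁻¹ ν := by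
  refine (hC σ hσ _ ((hH.duhamelData ν σ).mono (by norm_num))).trans ?_
  rw [ENNReal.coe_mul, mul_assoc]
  exact mul_le_mul' le_rfl (dual_strichartz hpt hqt hqtT hC' hst hst3 hs hσ hν hH)

end

lemma eLpNorm_restrict_union_le {α : Type*} [MeasurableSpace α] {μ : Measure α} {p : ℝ≥0∞}
    (hp : p ≠ 0) {h : α → ℝ≥0∞} {s t : Set α} {X : ℝ≥0∞} (h1 : eLpNorm h p (μ.restrict s) ≤ X)
    (h2 : eLpNorm h p (μ.restrict t) ≤ X) :
    eLpNorm h p (μ.restrict (s ∪ t)) ≤ 2 ^ (1 / p.toReal) * X := by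
  rcases eq_or_ne p ∞ with rfl | hpT
  · simp only [eLpNorm_exponent_top] at h1 h2 ⊢
    simp only [ENNReal.toReal_top, div_zero, ENNReal.rpow_zero, one_mul]
    refine eLpNormEssSup_le_of_ae_enorm_bound ((ae_restrict_union_iff _ _ _).2 ⟨?_, ?_⟩)
    · filter_upwards [enorm_ae_le_eLpNormEssSup h (μ.restrict s)] with x hx
      exact hx.trans h1
    · filter_upwards [enorm_ae_le_eLpNormEssSup h (μ.restrict t)] with x hx
      exact hx.trans h2
  · have hp' : 0 < p.toReal := ENNReal.toReal_pos hp hpT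
    rw [eLpNorm_eq_eLpNorm' hp hpT, eLpNorm', one_div,
      ENNReal.rpow_inv_le_iff hp'] at h1 h2 ⊢
    rw [ENNReal.mul_rpow_of_nonneg _ _ hp'.le, ← ENNReal.rpow_mul, inv_mul_cancel₀ hp'.ne',
      ENNReal.rpow_one, two_mul]
    exact (lintegral_union_le _ _ _).trans (add_le_add h1 h2)

/-- One bisection step in the proof of the Christ–Kiselev lemma. -/
lemma christ_kiselev_step {p : ℝ≥0∞} (hp : 1 ≤ p) {r : ℝ} (hr : 0 < r) {f : ℝ → ℝ}
    (hf : ∀ a b, IntervalIntegrable f volume a b) (hf0 : ∀ s, 0 ≤ f s)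
    {g : ℝ → ℝ → ℝ≥0∞} {K : ℝ → ℝ → ℝ → ℝ≥0∞} (hgm : ∀ a, Measurable (g a))
    (hKm : ∀ a c, Measurable (K a c)) (hgK : ∀ a c τ, a ≤ c → c ≤ τ → g a τ ≤ K a c τ + g c τ)
    {D : ℝ≥0} (hK : ∀ a c, a ≤ c →
      eLpNorm (K a c) p volume ≤ D * ENNReal.ofReal (∫ s in a..c, f s) ^ (1 / r))
    {L : ℝ} {κ : ℝ≥0} (hκ : ∀ a b, a ≤ b → b - a ≤ L → eLpNorm (g a) p (volume.restrict (Ioc a b)) ≤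
      κ * ENNReal.ofReal (∫ s in a..b, f s) ^ (1 / r)) {a b : ℝ} (hab : a ≤ b) (hL : b - a ≤ L) :
    eLpNorm (g a) p (volume.restrict (Ioc a b)) ≤
      ((2 : ℝ≥0) ^ (1 / p.toReal - 1 / r) * κ + D : ℝ≥0) *
        ENNReal.ofReal (∫ s in a..b, f s) ^ (1 / r) := by
  have hm0 : 0 ≤ ∫ s in a..b, f s := intervalIntegral.integral_nonneg hab fun s _ => hf0 s
  obtain ⟨c, ⟨hac, hcb⟩, hc⟩ : ∃ c ∈ Icc a b, ∫ s in a..c, f s = (∫ s in a..b, f s) / 2 := by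
    have := intermediate_value_Icc hab (intervalIntegral.continuous_primitive hf a).continuousOn
    refine this ⟨?_, ?_⟩
    · simp; linarith
    · simp; linarith
  have hc' : ∫ s in c..b, f s = (∫ s in a..b, f s) / 2 := by
    have := intervalIntegral.integral_add_adjacent_intervals (hf a c) (hf c b)
    linarith
  obtain ⟨X, hX⟩ : ∃ X, X = ENNReal.ofReal (∫ s in a..b, f s) ^ (1 / r) := ⟨_, rfl⟩
  have hhalf : ENNReal.ofReal ((∫ s in a..b, f s) / 2) ^ (1 / r) = 2 ^ (-(1 / r)) * X := by
    rw [div_eq_inv_mul, ENNReal.ofReal_mul (by norm_num), ENNReal.mul_rpow_of_nonneg _ _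
      (by positivity), ← hX, ENNReal.rpow_neg, ← ENNReal.inv_rpow,
      ENNReal.ofReal_inv_of_pos two_pos, ENNReal.ofReal_ofNat]
  obtain ⟨h, hh⟩ : ∃ h : ℝ → ℝ≥0∞, h = (Iic c).piecewise (g a) (g c) := ⟨_, rfl⟩
  have hhm : Measurable h := hh ▸ (hgm a).piecewise measurableSet_Iic (hgm c)
  have hle : ∀ᵐ τ ∂volume.restrict (Ioc a b), ‖g a τ‖ₑ ≤ ‖(K a c + h) τ‖ₑ := by
    refine ae_of_all _ fun τ => ?_
    simp only [enorm_eq_self, Pi.add_apply, hh]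
    by_cases hτ : τ ≤ c
    · rw [piecewise_eq_of_mem _ _ _ (show τ ∈ Iic c from hτ)]
      exact le_add_self
    · rw [piecewise_eq_of_notMem _ _ _ (show τ ∉ Iic c from hτ)]
      exact hgK a c τ hac (not_le.1 hτ).le
  have hh1 : eLpNorm h p (volume.restrict (Ioc a b)) ≤
      2 ^ (1 / p.toReal) * (κ * (2 ^ (-(1 / r)) * X)) := by
    rw [← Ioc_union_Ioc_eq_Ioc hac hcb]
    refine eLpNorm_restrict_union_le (one_pos.trans_le hp).ne' ?_ ?_
    · rw [eLpNorm_congr_ae (g := g a), ← hhalf, ← hc]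
      · exact hκ a c hac (by linarith)
      · filter_upwards [ae_restrict_mem measurableSet_Ioc] with τ hτ
        rw [hh, piecewise_eq_of_mem _ _ _ (show τ ∈ Iic c from hτ.2)]
    · rw [eLpNorm_congr_ae (g := g c), ← hhalf, ← hc']
      · exact hκ c b hcb (by linarith)
      · filter_upwards [ae_restrict_mem measurableSet_Ioc] with τ hτ
        rw [hh, piecewise_eq_of_notMem _ _ _ (show τ ∉ Iic c from not_le.2 hτ.1)]
  have hK1 : eLpNorm (K a c) p (volume.restrict (Ioc a b)) ≤ D * X := by
    refine (eLpNorm_mono_measure _ Measure.restrict_le_self).trans ((hK a c hac).trans ?_)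
    rw [hc, hX]
    gcongr
    linarith
  refine (eLpNorm_mono_enorm_ae hle).trans ((eLpNorm_add_le (hKm a c).aestronglyMeasurable
    hhm.aestronglyMeasurable hp).trans ((add_le_add hK1 hh1).trans_eq ?_))
  rw [← hX, ENNReal.coe_add, ENNReal.coe_mul, ENNReal.coe_rpow_of_ne_zero two_ne_zero,
    sub_eq_add_neg, ENNReal.coe_ofNat, ENNReal.rpow_add _ _ two_ne_zero ENNReal.ofNat_ne_top]
  ring

lemma christ_kiselev_of_pos {p : ℝ≥0∞} (hp : 1 ≤ p) {r : ℝ} (hr : 1 ≤ r)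
    (hpr : 1 / p.toReal < 1 / r) {ε : ℝ} (hε : 0 < ε) {f : ℝ → ℝ}
    (hf : ∀ a b, IntervalIntegrable f volume a b) (hf0 : ∀ s, ε ≤ f s)
    {g : ℝ → ℝ → ℝ≥0∞} {K : ℝ → ℝ → ℝ → ℝ≥0∞} (hgm : ∀ a, Measurable (g a))
    (hKm : ∀ a c, Measurable (K a c)) (hgK : ∀ a c τ, a ≤ c → c ≤ τ → g a τ ≤ K a c τ + g c τ)
    {D : ℝ≥0} (hK : ∀ a c, a ≤ c →
      eLpNorm (K a c) p volume ≤ D * ENNReal.ofReal (∫ s in a..c, f s) ^ (1 / r))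
    {M : ℝ≥0} (hM : ∀ a τ, a ≤ τ → g a τ ≤ M * ENNReal.ofReal (τ - a)) {a b : ℝ} (hab : a ≤ b) :
    eLpNorm (g a) p (volume.restrict (Ioc a b)) ≤
      (D / (1 - (2 : ℝ≥0) ^ (1 / p.toReal - 1 / r)) : ℝ≥0) *
        ENNReal.ofReal (∫ s in a..b, f s) ^ (1 / r) := by
  obtain ⟨θ, hθ⟩ : ∃ θ : ℝ≥0, θ = (2 : ℝ≥0) ^ (1 / p.toReal - 1 / r) := ⟨_, rfl⟩
  have hθ1 : θ < 1 := by
    rw [hθ]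
    exact NNReal.rpow_lt_one_of_one_lt_of_neg one_lt_two (by linarith)
  obtain ⟨L, hL⟩ : ∃ L, L = b - a := ⟨_, rfl⟩
  have hL0 : 0 ≤ L := by linarith
  have hr0 : 1 / r ≤ 1 := by rw [div_le_one (by linarith)]; exact hr
  have hp0 : 0 ≤ 1 / p.toReal := by positivity
  obtain ⟨κ, hκ⟩ : ∃ κ : ℝ≥0, κ = M * (ε ^ (-(1 / r)) * L ^ (1 + 1 / p.toReal - 1 / r)).toNNReal :=
    ⟨_, rfl⟩
  have hcrude : ∀ a b, a ≤ b → b - a ≤ L → eLpNorm (g a) p (volume.restrict (Ioc a b)) ≤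
      κ * ENNReal.ofReal (∫ s in a..b, f s) ^ (1 / r) := by
    intro a b hab hbL
    have hba : 0 ≤ b - a := by linarith
    have h1 : eLpNorm (g a) p (volume.restrict (Ioc a b)) ≤
        ENNReal.ofReal (b - a) ^ (1 / p.toReal) * (M * ENNReal.ofReal (b - a)) := by
      have := eLpNorm_le_of_ae_enorm_bound (μ := volume.restrict (Ioc a b)) (f := g a) (p := p)
        (C := M * ENNReal.ofReal (b - a)) ?_
      · refine this.trans_eq ?_
        simp [mul_comm]
      · filter_upwards [ae_restrict_mem measurableSet_Ioc] with τ hτ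
        rw [enorm_eq_self]
        refine (hM a τ hτ.1.le).trans ?_
        gcongr
        exact hτ.2
    have h2 : ε * (b - a) ≤ ∫ s in a..b, f s := by
      have := intervalIntegral.integral_mono_on hab (intervalIntegrable_const (c := ε)) (hf a b)
        fun s _ => hf0 s
      simpa [mul_comm] using this
    refine h1.trans (le_trans ?_ (mul_le_mul' le_rfl (ENNReal.rpow_le_rpow
      (ENNReal.ofReal_le_ofReal h2) (by positivity))))
    have h3 : (b - a) ^ (1 / p.toReal) * (b - a) ≤
        ε ^ (-(1 / r)) * L ^ (1 + 1 / p.toReal - 1 / r) * (ε * (b - a)) ^ (1 / r) := by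
      rw [Real.mul_rpow hε.le hba]
      have e1 : ε ^ (-(1 / r)) * ε ^ (1 / r) = 1 := by
        rw [← Real.rpow_add hε]; simp
      have e2 : (b - a) ^ (1 / p.toReal) * (b - a) =
          (b - a) ^ (1 + 1 / p.toReal - 1 / r) * (b - a) ^ (1 / r) := by
        rw [← Real.rpow_add_of_nonneg hba (by linarith) (by positivity)]
        nth_rw 2 [← Real.rpow_one (b - a)]
        rw [← Real.rpow_add_of_nonneg hba hp0 (by norm_num)]
        congr 1; ring
      calc _ = _ := e2
        _ ≤ L ^ (1 + 1 / p.toReal - 1 / r) * (b - a) ^ (1 / r) := by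
            gcongr
            linarith
        _ = (ε ^ (-(1 / r)) * ε ^ (1 / r)) * (L ^ (1 + 1 / p.toReal - 1 / r) * (b - a) ^ (1 / r)) := by
            rw [e1, one_mul]
        _ = _ := by ring
    have h4 := ENNReal.ofReal_le_ofReal h3
    rw [ENNReal.ofReal_mul (by positivity), ENNReal.ofReal_mul (p := _ * _) (by positivity),
      ← ENNReal.ofReal_rpow_of_nonneg hba hp0,
      ← ENNReal.ofReal_rpow_of_nonneg (by positivity) (by positivity)] at h4
    rw [hκ, ENNReal.coe_mul]
    calc _ = (M : ℝ≥0∞) * (ENNReal.ofReal (b - a) ^ (1 / p.toReal) * ENNReal.ofReal (b - a)) := by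
          ring
      _ ≤ M * _ := mul_le_mul' le_rfl h4
      _ = _ := by rw [mul_assoc]; rfl
  have hiter : ∀ n : ℕ, ∀ a b, a ≤ b → b - a ≤ L → eLpNorm (g a) p (volume.restrict (Ioc a b)) ≤
      (θ ^ n * κ + D / (1 - θ) : ℝ≥0) * ENNReal.ofReal (∫ s in a..b, f s) ^ (1 / r) := by
    intro n
    induction n with
    | zero =>
      intro a b hab hbL
      refine (hcrude a b hab hbL).trans ?_
      gcongr
      simp
    | succ n ih =>
      intro a b hab hbL
      refine (christ_kiselev_step hp (by linarith) hf (fun s => hε.le.trans (hf0 s)) hgm hKm hgK hK ih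
        hab hbL).trans_eq ?_
      rw [← hθ]
      congr 2
      have : (1 - θ : ℝ≥0) ≠ 0 := (tsub_pos_of_lt hθ1).ne'
      have h1 : D = (1 - θ) * (D / (1 - θ)) := by field_simp
      have h2 : θ * (D / (1 - θ)) + (1 - θ) * (D / (1 - θ)) = D / (1 - θ) := by
        rw [← add_mul, add_tsub_cancel_of_le hθ1.le, one_mul]
      calc _ = θ ^ (n + 1) * κ + (θ * (D / (1 - θ)) + D) := by ring
        _ = θ ^ (n + 1) * κ + (θ * (D / (1 - θ)) + (1 - θ) * (D / (1 - θ))) := by rw [← h1]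
        _ = _ := by rw [h2]
  rw [← hθ]
  have hlim : Filter.Tendsto (fun n : ℕ => ((θ ^ n * κ + D / (1 - θ) : ℝ≥0) : ℝ≥0∞) *
      ENNReal.ofReal (∫ s in a..b, f s) ^ (1 / r)) Filter.atTop
      (nhds (((0 * κ + D / (1 - θ) : ℝ≥0) : ℝ≥0∞) *
        ENNReal.ofReal (∫ s in a..b, f s) ^ (1 / r))) := by
    refine ENNReal.Tendsto.mul_const (ENNReal.tendsto_coe.2 ?_) (Or.inr ?_)
    · exact ((NNReal.tendsto_pow_atTop_nhds_zero_of_lt_one hθ1).mul_const κ).add_const _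
    · exact ENNReal.rpow_ne_top_of_nonneg (by positivity) ENNReal.ofReal_ne_top
  rw [zero_mul, zero_add] at hlim
  exact ge_of_tendsto hlim (Filter.Eventually.of_forall fun n => hiter n a b hab hL.ge)

/-- The **Christ–Kiselev lemma** for a family of retarded quantities `g` dominated by untruncated
quantities `K`. -/
lemma christ_kiselev {p : ℝ≥0∞} (hp : 1 ≤ p) {r : ℝ} (hr : 1 ≤ r)
    (hpr : 1 / p.toReal < 1 / r) {f : ℝ → ℝ}
    (hf : ∀ a b, IntervalIntegrable f volume a b) (hf0 : ∀ s, 0 ≤ f s)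
    {g : ℝ → ℝ → ℝ≥0∞} {K : ℝ → ℝ → ℝ → ℝ≥0∞} (hgm : ∀ a, Measurable (g a))
    (hKm : ∀ a c, Measurable (K a c)) (hgK : ∀ a c τ, a ≤ c → c ≤ τ → g a τ ≤ K a c τ + g c τ)
    {D : ℝ≥0} (hK : ∀ a c, a ≤ c →
      eLpNorm (K a c) p volume ≤ D * ENNReal.ofReal (∫ s in a..c, f s) ^ (1 / r))
    {M : ℝ≥0} (hM : ∀ a τ, a ≤ τ → g a τ ≤ M * ENNReal.ofReal (τ - a)) {a b : ℝ} (hab : a ≤ b) :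
    eLpNorm (g a) p (volume.restrict (Ioc a b)) ≤
      (D / (1 - (2 : ℝ≥0) ^ (1 / p.toReal - 1 / r)) : ℝ≥0) *
        ENNReal.ofReal (∫ s in a..b, f s) ^ (1 / r) := by
  have hfε : ∀ (ε : ℝ) a b, ∫ s in a..b, (f s + ε) = (∫ s in a..b, f s) + ε * (b - a) := by
    intro ε a b
    rw [intervalIntegral.integral_add (hf a b) intervalIntegrable_const]
    simp [mul_comm]
  have key : ∀ ε : ℝ, 0 < ε → eLpNorm (g a) p (volume.restrict (Ioc a b)) ≤
      (D / (1 - (2 : ℝ≥0) ^ (1 / p.toReal - 1 / r)) : ℝ≥0) *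
        ENNReal.ofReal ((∫ s in a..b, f s) + ε * (b - a)) ^ (1 / r) := by
    intro ε hε
    rw [← hfε]
    refine christ_kiselev_of_pos hp hr hpr hε (fun a b => (hf a b).add intervalIntegrable_const)
      (fun s => by linarith [hf0 s]) hgm hKm hgK (fun a c hac => (hK a c hac).trans ?_) hM hab
    rw [hfε]
    gcongr
    nlinarith
  have hlim : Filter.Tendsto (fun ε : ℝ => ((D / (1 - (2 : ℝ≥0) ^ (1 / p.toReal - 1 / r)) : ℝ≥0) : ℝ≥0∞) *
      ENNReal.ofReal ((∫ s in a..b, f s) + ε * (b - a)) ^ (1 / r)) (nhdsWithin 0 (Ioi 0))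
      (nhds (((D / (1 - (2 : ℝ≥0) ^ (1 / p.toReal - 1 / r)) : ℝ≥0) : ℝ≥0∞) *
        ENNReal.ofReal ((∫ s in a..b, f s) + 0 * (b - a)) ^ (1 / r))) := by
    refine ENNReal.Tendsto.const_mul ?_ (Or.inr ENNReal.coe_ne_top)
    refine (ENNReal.continuous_rpow_const.comp (ENNReal.continuous_ofReal.comp (by fun_prop :
      Continuous fun ε : ℝ => (∫ s in a..b, f s) + ε * (b - a)))).continuousAt.tendsto.mono_left
      nhdsWithin_le_nhds
  rw [zero_mul, add_zero] at hlim
  exact ge_of_tendsto hlim (by filter_upwards [self_mem_nhdsWithin] with ε hε using key ε hε)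

lemma eLpNorm_le_of_sup_of_two {q : ℝ≥0∞} (hq2 : 2 ≤ q) (hq : q ≠ ∞) {f : E3 → ℂ} (hf : Measurable f)
    {N : ℝ≥0∞} (h1 : ∀ x, ‖f x‖ₑ ≤ N) (h2 : eLpNorm f 2 volume ≤ N) : eLpNorm f q volume ≤ N := by
  have hq0 : q ≠ 0 := (two_pos.trans_le hq2).ne'
  have hqr : 2 ≤ q.toReal := by simpa using ENNReal.toReal_mono hq hq2
  rw [eLpNorm_eq_eLpNorm' two_ne_zero ENNReal.ofNat_ne_top, eLpNorm', one_div,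
    ENNReal.rpow_inv_le_iff (by simp)] at h2
  rw [eLpNorm_eq_eLpNorm' hq0 hq, eLpNorm', one_div, ENNReal.rpow_inv_le_iff (by linarith)]
  have e : ∀ a : ℝ≥0∞, a ^ q.toReal = a ^ (q.toReal - 2) * a ^ (2 : ℝ) := fun a => by
    rw [← ENNReal.rpow_add_of_nonneg _ _ (by linarith) zero_le_two, sub_add_cancel]
  simp only [ENNReal.toReal_ofNat] at h2
  calc ∫⁻ x, ‖f x‖ₑ ^ q.toReal ≤ ∫⁻ x, N ^ (q.toReal - 2) * ‖f x‖ₑ ^ (2 : ℝ) := by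
        refine lintegral_mono fun x => ?_
        simp only [e]
        exact mul_le_mul' (ENNReal.rpow_le_rpow (h1 x) (by linarith)) le_rfl
    _ = (∫⁻ x, ‖f x‖ₑ ^ (2 : ℝ)) * N ^ (q.toReal - 2) := by
        rw [lintegral_const_mul _ (hf.enorm.pow_const _), mul_comm]
    _ ≤ N ^ (2 : ℝ) * N ^ (q.toReal - 2) := mul_le_mul' h2 le_rfl
    _ = N ^ q.toReal := by rw [e, mul_comm]

lemma exists_eLpNorm_fourierInv_le {q : ℝ≥0∞} (hq2 : 2 ≤ q) (hq : q ≠ ∞) :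
    ∃ N : ℝ≥0, ∀ (h : E3 → ℂ) (C : ℝ), Measurable h → (∀ ξ, ‖h ξ‖ * (1 + ‖ξ‖) ^ 4 ≤ C) →
      eLpNorm (𝓕⁻ h) q volume ≤ N * ENNReal.ofReal C := by
  obtain ⟨w, hw⟩ : ∃ w : E3 → ℂ, w = fun ξ => ((((1 + ‖ξ‖) ^ 4)⁻¹ : ℝ) : ℂ) := ⟨_, rfl⟩
  have hwn : ∀ ξ, ‖w ξ‖ = ((1 + ‖ξ‖) ^ 4)⁻¹ := fun ξ => by
    rw [hw]; simp only [Complex.norm_real]; exact Real.norm_of_nonneg (by positivity)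
  have hwd : Dec 4 w := by
    refine ⟨by rw [hw]; fun_prop, 1, fun ξ => ?_⟩
    rw [hwn, inv_mul_cancel₀ (by positivity)]
  refine ⟨(∫ ξ, ‖w ξ‖).toNNReal + (eLpNorm w 2 volume).toNNReal, fun h C hm hC => ?_⟩
  have hd : Dec 4 h := ⟨hm, C, hC⟩
  have hC0 : 0 ≤ C := (by positivity : 0 ≤ ‖h 0‖ * (1 + ‖(0 : E3)‖) ^ 4).trans (hC 0)
  have hle : ∀ ξ, ‖h ξ‖ ≤ C * ‖w ξ‖ := fun ξ => by
    rw [hwn, ← div_eq_mul_inv, le_div_iff₀ (by positivity)]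
    exact hC ξ
  rw [ENNReal.coe_add, ENNReal.coe_toNNReal (hwd.memLp le_rfl).eLpNorm_ne_top]
  refine eLpNorm_le_of_sup_of_two hq2 hq
    (continuous_fourierInv3 (hd.integrable le_rfl)).measurable (fun x => ?_) ?_
  · refine le_trans ?_ (mul_le_mul' le_self_add le_rfl)
    change _ ≤ ENNReal.ofReal _ * _
    rw [← ENNReal.ofReal_mul (integral_nonneg fun _ => norm_nonneg _), ← ofReal_norm]
    refine ENNReal.ofReal_le_ofReal ((norm_fourierInv_le3 h x).trans ?_)
    rw [← integral_mul_const]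
    refine integral_mono (hd.integrable le_rfl).norm ((hwd.integrable le_rfl).norm.mul_const C)
      fun ξ => ?_
    rw [mul_comm]; exact hle ξ
  · refine le_trans ?_ (mul_le_mul' le_add_self le_rfl)
    rw [eLpNorm_fourierInv (hd.integrable le_rfl) (hd.memLp le_rfl), mul_comm]
    exact eLpNorm_le_mul_eLpNorm_of_ae_le_mul (ae_of_all _ hle) 2

/-- The retarded solution at time `τ` generated by the forcing with spatial frequency profile `H`
after time `a`. -/
def retarded (σ : ℝ) (H : ℝ → E3 → ℂ) (a τ : ℝ) : E3 → ℂ :=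
  wave σ (duhamelData (volume.restrict (Ioc a τ)) σ H) τ

lemma measurable_retarded (σ : ℝ) {H : ℝ → E3 → ℂ} (hH : Measurable (Function.uncurry H)) (a : ℝ) :
    Measurable (Function.uncurry (retarded σ H a)) := by
  refine measurable_fourierInv_param (K := fun (τ : ℝ) ξ => Complex.exp (Complex.I * (σ *
    (2 * Real.pi * τ * ‖ξ‖))) * duhamelData (volume.restrict (Ioc a τ)) σ H ξ) ?_
  refine (Continuous.measurable (by fun_prop)).mul ?_
  have hS : MeasurableSet {z : (ℝ × E3) × ℝ | a < z.2 ∧ z.2 ≤ z.1.1} :=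
    (measurableSet_lt measurable_const measurable_snd).inter
      (measurableSet_le measurable_snd (measurable_fst.comp measurable_fst))
  have h1 : Measurable fun z : (ℝ × E3) × ℝ => indicator {z : (ℝ × E3) × ℝ | a < z.2 ∧ z.2 ≤ z.1.1}
      (fun z => Complex.exp (-(Complex.I * (σ * (2 * Real.pi * z.2 * ‖z.1.2‖)))) * H z.2 z.1.2) z := by
    refine Measurable.indicator ?_ hS
    exact (Continuous.measurable (by fun_prop)).mul
      (hH.comp (measurable_snd.prodMk (measurable_snd.comp measurable_fst)))
  convert (h1.stronglyMeasurable.integral_prod_right' (ν := volume)).measurable using 2 with z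
  rw [duhamelData, ← integral_indicator measurableSet_Ioc]
  rfl

lemma duhamelData_add {k : ℕ} {H : ℝ → E3 → ℂ} (hH : UDec k H) (σ : ℝ) {a c b : ℝ}
    (hac : a ≤ c) (hcb : c ≤ b) (ξ : E3) :
    duhamelData (volume.restrict (Ioc a b)) σ H ξ = duhamelData (volume.restrict (Ioc a c)) σ H ξ +
      duhamelData (volume.restrict (Ioc c b)) σ H ξ := by
  have hi : ∀ u v, IntegrableOn (fun s : ℝ => Complex.exp (-(Complex.I * (σ * (2 * Real.pi * s * ‖ξ‖)))) *
      H s ξ) (Ioc u v) := fun u v => by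
    obtain ⟨h1, C, hC⟩ := (hH.wave σ).mono (Nat.zero_le _)
    refine Measure.integrableOn_of_bounded (M := C) (by simp)
      (h1.comp (measurable_id.prodMk measurable_const)).aestronglyMeasurable
      (ae_of_all _ fun s => by simpa using hC s ξ)
  rw [duhamelData, ← Ioc_union_Ioc_eq_Ioc hac hcb,
    setIntegral_union (Ioc_disjoint_Ioc_of_le le_rfl) measurableSet_Ioc (hi _ _) (hi _ _)]
  rfl

lemma eLpNorm_retarded_le_add {H : ℝ → E3 → ℂ} (hH : UDec 4 H) (σ : ℝ) {q : ℝ≥0∞} (hq : 1 ≤ q)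
    {a c τ : ℝ} (hac : a ≤ c) (hcτ : c ≤ τ) :
    eLpNorm (retarded σ H a τ) q volume ≤
      eLpNorm (wave σ (duhamelData (volume.restrict (Ioc a c)) σ H) τ) q volume +
        eLpNorm (retarded σ H c τ) q volume := by
  have hd1 := (hH.duhamelData (volume.restrict (Ioc a c)) σ).wave σ τ
  have hd2 := (hH.duhamelData (volume.restrict (Ioc c τ)) σ).wave σ τ
  have e : retarded σ H a τ = wave σ (duhamelData (volume.restrict (Ioc a c)) σ H) τ +
      retarded σ H c τ := by
    rw [retarded, retarded, wave, wave, wave,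
      ← fourierInv_add3 (hd1.integrable le_rfl) (hd2.integrable le_rfl)]
    congr 1; ext ξ
    rw [duhamelData_add hH σ hac hcτ, mul_add]
    rfl
  rw [e]
  exact eLpNorm_add_le (continuous_fourierInv3 (hd1.integrable le_rfl)).aestronglyMeasurable
    (continuous_fourierInv3 (hd2.integrable le_rfl)).aestronglyMeasurable hq

lemma exists_eLpNorm_retarded_le {H : ℝ → E3 → ℂ} (hH : UDec 4 H) (σ : ℝ) {q : ℝ≥0∞} (hq2 : 2 ≤ q)
    (hq : q ≠ ∞) : ∃ M : ℝ≥0, ∀ a τ, a ≤ τ →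
      eLpNorm (retarded σ H a τ) q volume ≤ M * ENNReal.ofReal (τ - a) := by
  obtain ⟨N, hN⟩ := exists_eLpNorm_fourierInv_le hq2 hq
  obtain ⟨C, hC⟩ := hH.2
  have hC0 : 0 ≤ C := (by positivity : 0 ≤ ‖H 0 0‖ * (1 + ‖(0 : E3)‖) ^ 4).trans (hC 0 0)
  refine ⟨N * C.toNNReal, fun a τ haτ => ?_⟩
  have h1 := hN _ (C * (τ - a)) ((hH.duhamelData (volume.restrict (Ioc a τ)) σ).wave σ τ).1
    fun ξ => by
      have hp : 0 < (1 + ‖ξ‖) ^ 4 := by positivity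
      have := norm_integral_le_of_norm_le_const (μ := volume.restrict (Ioc a τ))
        (f := fun s : ℝ => Complex.exp (-(Complex.I * (σ * (2 * Real.pi * s * ‖ξ‖)))) * H s ξ)
        (C := C / (1 + ‖ξ‖) ^ 4) (ae_of_all _ fun s => by
          rw [norm_mul, norm_wave_symbol_neg, one_mul, le_div_iff₀ hp]; exact hC s ξ)
      rw [norm_mul, norm_wave_symbol, one_mul]
      have h2 : (volume.restrict (Ioc a τ)).real univ = τ - a := by
        simp [haτ]
      rw [h2] at this
      calc _ ≤ C / (1 + ‖ξ‖) ^ 4 * (τ - a) * (1 + ‖ξ‖) ^ 4 := by gcongr; exact this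
        _ = _ := by field_simp
  refine h1.trans_eq ?_
  rw [ENNReal.ofReal_mul hC0, ENNReal.coe_mul, mul_assoc]
  rfl

/-- The retarded Strichartz estimate on a bounded interval. -/
theorem strichartz_retarded_Ioc {p q pt qt : ℝ≥0∞} {s t : ℝ} {C C' : ℝ≥0} (hp : 1 ≤ p)
    (hq2 : 2 ≤ q) (hq : q ≠ ∞) (hppt : 1 / p.toReal + 1 / pt.toReal < 1)
    (hC : HomStrichartz p q s C) (hpt : 2 ≤ pt) (hqt : 2 ≤ qt) (hqtT : qt ≠ ∞)
    (hC' : HomStrichartz pt qt t C') (hst : 0 ≤ s + t) (hst3 : s + t ≤ 3) (hs : s - t ≤ 2)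
    {σ : ℝ} (hσ : |σ| = 1) {H : ℝ → E3 → ℂ} (hH : UDec 12 H) {T : ℝ} (hT : 0 ≤ T) :
    eLpNorm (fun τ => eLpNorm (retarded σ H 0 τ) q volume) p (volume.restrict (Ioc 0 T)) ≤
      ((C * C' + 1) / (1 - (2 : ℝ≥0) ^ (1 / p.toReal - (1 - 1 / pt.toReal))) : ℝ≥0) *
        eLpNorm (fun τ => eLpNorm (𝓕⁻ (gradForcing (s + t) H τ)) (1 - 1 / qt)⁻¹ volume)
          (1 - 1 / pt)⁻¹ volume := by
  obtain ⟨A, hA⟩ : ∃ A : ℝ → ℝ≥0∞, A = fun τ =>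
    eLpNorm (𝓕⁻ (gradForcing (s + t) H τ)) (1 - 1 / qt)⁻¹ volume := ⟨_, rfl⟩
  obtain ⟨r, hr⟩ : ∃ r : ℝ, r = ((1 - 1 / pt)⁻¹).toReal := ⟨_, rfl⟩
  have hpt0 : pt ≠ 0 := (two_pos.trans_le hpt).ne'
  have hrT := dual_exponent_ne_top hpt
  have hpt1 : 1 / pt ≤ 1 := by
    rw [one_div, ENNReal.inv_le_one]; exact one_le_two.trans hpt
  have hr1 : 1 / r = 1 - 1 / pt.toReal := by
    rw [hr, ENNReal.toReal_inv, one_div, inv_inv, ENNReal.toReal_sub_of_le hpt1 ENNReal.one_ne_top]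
    simp
  have hrle : 1 ≤ r := by
    rw [hr, ← ENNReal.toReal_one]
    refine ENNReal.toReal_mono hrT ?_
    rw [ENNReal.one_le_inv]
    exact tsub_le_self
  have hr0 : (1 - 1 / pt)⁻¹ ≠ 0 := fun h => by rw [h] at hr; norm_num at hr; linarith
  have hAm : Measurable A := by
    rw [hA]
    exact measurable_eLpNorm_param (u := fun τ => 𝓕⁻ (gradForcing (s + t) H τ))
      (measurable_fourierInv_param (hH.gradForcing hst hst3).1) (dual_exponent_ne_top hqt)
  have hnorm : ∀ ν : Measure ℝ, eLpNorm A (1 - 1 / pt)⁻¹ ν = (∫⁻ τ, A τ ^ r ∂ν) ^ (1 / r) := by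
    intro ν
    rw [eLpNorm_eq_eLpNorm' hr0 hrT, eLpNorm', ← hr]
    simp only [enorm_eq_self]
  rw [← hA]
  by_cases hfin : ∫⁻ τ, A τ ^ r = ∞
  · rw [hnorm, hfin, ENNReal.top_rpow_of_pos (by positivity), ENNReal.mul_top]
    · exact le_top
    · rw [ENNReal.coe_ne_zero]
      have : (2 : ℝ≥0) ^ (1 / p.toReal - (1 - 1 / pt.toReal)) < 1 :=
        NNReal.rpow_lt_one_of_one_lt_of_neg one_lt_two (by linarith)
      exact (div_pos (by positivity) (tsub_pos_of_lt this)).ne'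
  have hArm : Measurable fun τ => A τ ^ r := hAm.pow_const r
  have hInt : Integrable (fun τ => (A τ ^ r).toReal) :=
    integrable_toReal_of_lintegral_ne_top hArm.aemeasurable hfin
  have hmass : ∀ a b, a ≤ b → ENNReal.ofReal (∫ τ in a..b, (A τ ^ r).toReal) =
      ∫⁻ τ in Ioc a b, A τ ^ r := by
    intro a b hab
    rw [intervalIntegral.integral_of_le hab, integral_toReal hArm.aemeasurable
      (ae_restrict_of_ae (ae_lt_top hArm hfin)), ENNReal.ofReal_toReal]
    exact ne_top_of_le_ne_top hfin (setLIntegral_le_lintegral _ _)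
  obtain ⟨M, hM⟩ := exists_eLpNorm_retarded_le (hH.mono (by norm_num)) σ hq2 hq
  have key := christ_kiselev hp hrle (by rw [hr1]; linarith) (f := fun τ => (A τ ^ r).toReal)
    (fun a b => hInt.intervalIntegrable) (fun _ => ENNReal.toReal_nonneg)
    (g := fun a τ => eLpNorm (retarded σ H a τ) q volume)
    (K := fun a c τ => eLpNorm (wave σ (duhamelData (volume.restrict (Ioc a c)) σ H) τ) q volume)
    (D := C * C' + 1)
    (fun a => measurable_eLpNorm_param (measurable_retarded σ hH.1 a) hq)
    (fun a c => measurable_eLpNorm_param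
      (u := wave σ (duhamelData (volume.restrict (Ioc a c)) σ H))
      (measurable_wave σ (hH.duhamelData _ σ).1) hq)
    (fun a c τ hac hcτ => eLpNorm_retarded_le_add (hH.mono (by norm_num)) σ
      (one_le_two.trans hq2) hac hcτ)
    (fun a c hac => ?_) hM hT
  · rw [hr1, hmass _ _ hT, ← hr1] at key
    rw [← hr1]
    refine key.trans (mul_le_mul' le_rfl ?_)
    rw [hnorm]
    exact ENNReal.rpow_le_rpow (setLIntegral_le_lintegral _ _) (by positivity)
  · refine (strichartz_untruncated hC hpt hqt hqtT hC' hst hst3 hs hσ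
      (ν := volume.restrict (Ioc a c)) Measure.restrict_le_self hH).trans ?_
    rw [← hA, hnorm, hmass a c hac]
    gcongr
    simp

/-- Fatou's lemma for `L^p` norms, `p ≤ ∞`. -/
lemma eLpNorm_liminf_le {α : Type*} [MeasurableSpace α] {μ : Measure α} {p : ℝ≥0∞} (hp : p ≠ 0)
    {f : ℕ → α → ℝ≥0∞} (hf : ∀ n, Measurable (f n)) :
    eLpNorm (fun a => Filter.liminf (fun n => f n a) Filter.atTop) p μ ≤
      Filter.liminf (fun n => eLpNorm (f n) p μ) Filter.atTop := by
  rcases eq_or_ne p ∞ with rfl | hpT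
  · simp only [eLpNorm_exponent_top]
    refine eLpNormEssSup_le_of_ae_enorm_bound ?_
    have h1 : ∀ᵐ a ∂μ, ∀ n, ‖f n a‖ₑ ≤ eLpNormEssSup (f n) μ :=
      ae_all_iff.2 fun n => enorm_ae_le_eLpNormEssSup (f n) μ
    filter_upwards [h1] with a ha
    rw [enorm_eq_self]
    exact Filter.liminf_le_liminf (Filter.Eventually.of_forall ha)
  · have hp' : 0 < p.toReal := ENNReal.toReal_pos hp hpT
    have hp'' : 0 < 1 / p.toReal := by positivity
    simp only [eLpNorm_eq_eLpNorm' hp hpT, eLpNorm', enorm_eq_self]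
    have e1 : ∀ a, (Filter.liminf (fun n => f n a) Filter.atTop) ^ p.toReal =
        Filter.liminf (fun n => f n a ^ p.toReal) Filter.atTop := fun a =>
      (ENNReal.orderIsoRpow p.toReal hp').liminf_apply
    have e2 := (ENNReal.orderIsoRpow (1 / p.toReal) hp'').liminf_apply
      (f := Filter.atTop) (u := fun n => ∫⁻ a, f n a ^ p.toReal ∂μ)
    simp only [ENNReal.orderIsoRpow_apply] at e2
    rw [← e2]
    simp only [e1]
    exact ENNReal.rpow_le_rpow (lintegral_liminf_le fun n => (hf n).pow_const _) hp''.le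

lemma retarded_eq_integral {H : ℝ → E3 → ℂ} (hH : UDec 4 H) (σ a τ : ℝ) (x : E3) :
    retarded σ H a τ x = ∫ s in Ioc a τ, 𝓕⁻ (fun ξ => Complex.exp (Complex.I * (σ *
      (2 * Real.pi * ((τ - s : ℝ) : ℂ) * ‖ξ‖))) * H s ξ) x := by
  obtain ⟨m, hm⟩ : ∃ m : ℝ → E3 → ℂ, m = fun s ξ =>
    Complex.exp ((2 * Real.pi * ⟪ξ, x⟫ : ℝ) * Complex.I) *
      Complex.exp (Complex.I * (σ * (2 * Real.pi * ((τ - s : ℝ) : ℂ) * ‖ξ‖))) := ⟨_, rfl⟩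
  have hU : UDec 4 fun s ξ => m s ξ * H s ξ := by
    refine UDec.mul (l := 0) (K := 1) hH ?_ fun s ξ => ?_
    · rw [hm]; exact Continuous.measurable (by fun_prop)
    · rw [hm]
      simp only [norm_mul, norm_wave_symbol, Complex.norm_exp_ofReal_mul_I]
      simp
  rw [retarded, wave, Real.fourierInv_eq']
  simp only [Real.fourierInv_eq']
  rw [integral_integral_swap]
  · congr 1; ext ξ
    rw [duhamelData, ← integral_const_mul, smul_eq_mul, ← integral_const_mul]
    congr 1; ext s
    rw [smul_eq_mul, ← mul_assoc (Complex.exp (Complex.I * _)), ← Complex.exp_add]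
    congr 3
    push_cast
    ring
  · refine (hU.integrable (volume.restrict (Ioc a τ))).congr (ae_of_all _ fun p => ?_)
    simp only [Function.uncurry_def, hm, smul_eq_mul, mul_assoc]

/-- Times at which the spatial Fourier transform of `F` decays quantitatively. -/
def decaySet (F : ℝ → E3 → ℂ) (n : ℕ) : Set ℝ :=
  {s | ∀ ξ, ‖𝓕 (F s) ξ‖ * (1 + ‖ξ‖) ^ 12 ≤ n}

lemma measurable_fourier_param {α : Type*} [MeasurableSpace α] {F : α → E3 → ℂ}
    (hF : Measurable (Function.uncurry F)) : Measurable fun p : α × E3 => 𝓕 (F p.1) p.2 := by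
  have := (measurable_fourierInv_param hF).comp (measurable_fst.prodMk measurable_snd.neg)
  convert this using 2 with p
  simp [Real.fourierInv_eq_fourier_neg]

lemma measurableSet_decaySet {F : ℝ → E3 → ℂ} (hF : Measurable (Function.uncurry F))
    (hS : ∀ t, ∃ g : 𝓢(E3, ℂ), F t = g) (n : ℕ) : MeasurableSet (decaySet F n) := by
  have e : decaySet F n = ⋂ k : ℕ, {s | ‖𝓕 (F s) (TopologicalSpace.denseSeq E3 k)‖ *
      (1 + ‖TopologicalSpace.denseSeq E3 k‖) ^ 12 ≤ n} := by
    ext s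
    rw [mem_iInter]
    refine ⟨fun h k => h _, fun h ξ => ?_⟩
    obtain ⟨g, hg⟩ := hS s
    have hc : Continuous (𝓕 (F s)) := by
      rw [hg, ← SchwartzMap.fourier_coe]
      exact (𝓕 g).continuous
    have hcl : IsClosed {ξ | ‖𝓕 (F s) ξ‖ * (1 + ‖ξ‖) ^ 12 ≤ n} :=
      isClosed_le (by fun_prop) continuous_const
    have hsub : range (TopologicalSpace.denseSeq E3) ⊆ {ξ | ‖𝓕 (F s) ξ‖ * (1 + ‖ξ‖) ^ 12 ≤ n} := by
      rintro _ ⟨k, rfl⟩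
      exact h k
    exact (hcl.closure_subset_iff.2 hsub) (TopologicalSpace.denseRange_denseSeq E3 ξ)
  rw [e]
  refine MeasurableSet.iInter fun k => measurableSet_le ?_ measurable_const
  exact ((measurable_fourier_param hF).comp (measurable_id.prodMk measurable_const)).norm.mul_const _

lemma eventually_mem_decaySet {F : ℝ → E3 → ℂ} (hS : ∀ t, ∃ g : 𝓢(E3, ℂ), F t = g) (s : ℝ) :
    ∀ᶠ n in Filter.atTop, s ∈ decaySet F n := by
  obtain ⟨g, hg⟩ := hS s
  obtain ⟨N, hN⟩ := exists_nat_ge (2 ^ 12 *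
    ((Finset.Iic (12, 0)).sup fun m => SchwartzMap.seminorm ℝ (E := E3) (F := ℂ) m.1 m.2) (𝓕 g))
  filter_upwards [Filter.eventually_ge_atTop N] with n hn ξ
  have h1 := SchwartzMap.one_add_le_sup_seminorm_apply (𝕜 := ℝ) (m := (12, 0)) (k := 12) (n := 0)
    le_rfl le_rfl (𝓕 g) ξ
  rw [norm_iteratedFDeriv_zero, SchwartzMap.fourier_coe, ← hg] at h1
  rw [mul_comm]
  exact h1.trans (hN.trans (by exact_mod_cast hn))

/-- Truncation of the spatial Fourier transform of `F` to good times in `J`. -/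
def truncForcing (F : ℝ → E3 → ℂ) (J : Set ℝ) (n : ℕ) (s : ℝ) (ξ : E3) : ℂ :=
  indicator (decaySet F n ∩ J) (fun s => 𝓕 (F s) ξ) s

lemma uDec_truncForcing {F : ℝ → E3 → ℂ} (hF : Measurable (Function.uncurry F))
    (hS : ∀ t, ∃ g : 𝓢(E3, ℂ), F t = g) {J : Set ℝ} (hJ : MeasurableSet J) (n : ℕ) :
    UDec 12 (truncForcing F J n) := by
  refine ⟨?_, n, fun s ξ => ?_⟩
  · have : Function.uncurry (truncForcing F J n) =
        indicator (Prod.fst ⁻¹' (decaySet F n ∩ J)) fun p : ℝ × E3 => 𝓕 (F p.1) p.2 := by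
      ext p
      by_cases hp : p.1 ∈ decaySet F n ∩ J
      · rw [indicator_of_mem (by exact hp), Function.uncurry, truncForcing, indicator_of_mem hp]
      · rw [indicator_of_notMem (by exact hp), Function.uncurry, truncForcing, indicator_of_notMem hp]
    rw [this]
    exact (measurable_fourier_param hF).indicator
      (measurable_fst ((measurableSet_decaySet hF hS n).inter hJ))
  · rw [truncForcing]
    by_cases hs : s ∈ decaySet F n ∩ J
    · rw [indicator_of_mem hs]; exact hs.1 ξ
    · rw [indicator_of_notMem hs]; simp

lemma fourierInv_mul_truncForcing (m : E3 → ℂ) (F : ℝ → E3 → ℂ) (J : Set ℝ) (n : ℕ) (s : ℝ) :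
    𝓕⁻ (fun ξ => m ξ * truncForcing F J n s ξ) =
      indicator (decaySet F n ∩ J) (fun s => fmul3 m (F s)) s := by
  by_cases hs : s ∈ decaySet F n ∩ J
  · simp only [truncForcing, indicator_of_mem hs, fmul3]
  · simp only [truncForcing, indicator_of_notMem hs, mul_zero]
    ext x
    rw [Real.fourierInv_eq]; simp

/-- Pointwise lower semicontinuity of the retarded integral under truncation. -/
lemma enorm_retarded_integral_le_liminf {F : ℝ → E3 → ℂ} (hF : Measurable (Function.uncurry F))
    (hS : ∀ t, ∃ g : 𝓢(E3, ℂ), F t = g) {J : Set ℝ} (hJ : J.OrdConnected) (h0 : 0 ∈ J) (σ : ℝ)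
    {t : ℝ} (ht : t ∈ J) (ht0 : 0 ≤ t) (x : E3) :
    ‖∫ s in (0:ℝ)..t, halfWave3 σ (t - s) (F s) x‖ₑ ≤
      Filter.liminf (fun n => ‖retarded σ (truncForcing F J n) 0 t x‖ₑ) Filter.atTop := by
  have hJm := hJ.measurableSet
  rw [intervalIntegral.integral_of_le ht0]
  by_cases hInt : IntegrableOn (fun s => halfWave3 σ (t - s) (F s) x) (Ioc 0 t)
  swap
  · rw [integral_undef hInt]; simp
  refine le_of_eq (Filter.Tendsto.liminf_eq ?_).symm
  refine (continuous_enorm.tendsto _).comp ?_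
  have e : ∀ n, retarded σ (truncForcing F J n) 0 t x = ∫ s in Ioc 0 t,
      indicator (decaySet F n ∩ J) (fun s => halfWave3 σ (t - s) (F s) x) s := by
    intro n
    rw [retarded_eq_integral ((uDec_truncForcing hF hS hJm n).mono (by norm_num))]
    congr 1; ext s
    rw [fourierInv_mul_truncForcing]
    by_cases hs : s ∈ decaySet F n ∩ J
    · rw [indicator_of_mem hs, indicator_of_mem hs]; rfl
    · rw [indicator_of_notMem hs, indicator_of_notMem hs]; rfl
  simp only [e]
  refine tendsto_integral_of_dominated_convergence (fun s => ‖halfWave3 σ (t - s) (F s) x‖)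
    (fun n => hInt.aestronglyMeasurable.indicator ((measurableSet_decaySet hF hS n).inter hJm))
    hInt.norm (fun n => ae_of_all _ fun s => norm_indicator_le_norm_self _ _) ?_
  filter_upwards [ae_restrict_mem measurableSet_Ioc] with s hs
  refine tendsto_const_nhds.congr' ?_
  filter_upwards [eventually_mem_decaySet hS s] with n hn
  have hsJ : s ∈ decaySet F n ∩ J := ⟨hn, hJ.out h0 ht ⟨hs.1.le, hs.2⟩⟩
  rw [indicator_of_mem hsJ]

/-- A retarded estimate for decaying forcing extends to all Schwartz-valued forcing. -/
lemma retarded_estimate_half {p q pd qd : ℝ≥0∞} (hp : p ≠ 0) (hq0 : q ≠ 0) (hq : q ≠ ∞) {σ a : ℝ}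
    {K : ℝ≥0} (hR : ∀ H, UDec 12 H → ∀ T : ℝ, 0 ≤ T →
      eLpNorm (fun τ => eLpNorm (retarded σ H 0 τ) q volume) p (volume.restrict (Ioc 0 T)) ≤
        K * eLpNorm (fun τ => eLpNorm (𝓕⁻ (gradForcing a H τ)) qd volume) pd volume)
    {F : ℝ → E3 → ℂ} (hF : Measurable (Function.uncurry F))
    (hS : ∀ t, ∃ g : 𝓢(E3, ℂ), F t = g) {J : Set ℝ} (hJ : J.OrdConnected) (h0 : 0 ∈ J) :
    eLpNorm (fun t => eLpNorm (fun x => ∫ s in (0:ℝ)..t, halfWave3 σ (t - s) (F s) x) q volume) p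
        (volume.restrict (J ∩ Ioi 0)) ≤
      K * eLpNorm (fun t => eLpNorm (absGrad3 a (F t)) qd volume) pd (volume.restrict J) := by
  have hJm := hJ.measurableSet
  have hU := fun n => uDec_truncForcing hF hS hJm n
  obtain ⟨u, hu⟩ : ∃ u : ℕ → ℝ → E3 → ℂ, u = fun n => retarded σ (truncForcing F J n) 0 := ⟨_, rfl⟩
  obtain ⟨W, hW⟩ : ∃ W : ℕ → ℝ → ℝ≥0∞, W = fun n : ℕ =>
    indicator (Ioc 0 (n : ℝ)) fun t => eLpNorm (u n t) q volume := ⟨_, rfl⟩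
  have hum : ∀ n, Measurable (Function.uncurry (u n)) := fun n => by
    rw [hu]; exact measurable_retarded σ (hU n).1 0
  have hWm : ∀ n, Measurable (W n) := fun n => by
    rw [hW]; exact (measurable_eLpNorm_param (hum n) hq).indicator measurableSet_Ioc
  have hWle : ∀ n, eLpNorm (W n) p volume ≤
      K * eLpNorm (fun t => eLpNorm (absGrad3 a (F t)) qd volume) pd (volume.restrict J) := by
    intro n
    rw [hW, eLpNorm_indicator_eq_eLpNorm_restrict measurableSet_Ioc, hu]
    refine (hR _ (hU n) n n.cast_nonneg).trans (mul_le_mul' le_rfl ?_)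
    rw [← eLpNorm_indicator_eq_eLpNorm_restrict hJm]
    refine eLpNorm_mono_enorm fun τ => ?_
    have := fourierInv_mul_truncForcing (fun ξ => (((2 * Real.pi * ‖ξ‖) ^ a : ℝ) : ℂ)) F J n τ
    unfold gradForcing
    rw [enorm_eq_self, enorm_eq_self, this]
    by_cases hτ : τ ∈ decaySet F n ∩ J
    · rw [indicator_of_mem hτ, indicator_of_mem hτ.2]; rfl
    · rw [indicator_of_notMem hτ]; simp
  have hpt : ∀ t ∈ J ∩ Ioi 0,
      eLpNorm (fun x => ∫ s in (0:ℝ)..t, halfWave3 σ (t - s) (F s) x) q volume ≤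
        Filter.liminf (fun n => W n t) Filter.atTop := by
    rintro t ⟨htJ, ht⟩
    have ht : 0 < t := ht
    have e : Filter.liminf (fun n => W n t) Filter.atTop =
        Filter.liminf (fun n => eLpNorm (fun x => ‖u n t x‖ₑ) q volume) Filter.atTop := by
      refine Filter.liminf_congr ?_
      filter_upwards [Filter.eventually_ge_atTop ⌈t⌉₊] with n hn
      rw [hW]
      simp only
      have htn : t ∈ Ioc 0 (n : ℝ) := ⟨ht, Nat.ceil_le.1 hn⟩
      rw [indicator_of_mem htn, eLpNorm_enorm]
    rw [e]
    refine le_trans (eLpNorm_mono_enorm fun x => ?_) (eLpNorm_liminf_le hq0 fun n =>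
      ((hum n).comp (measurable_const.prodMk measurable_id)).enorm)
    rw [enorm_eq_self, hu]
    exact enorm_retarded_integral_le_liminf hF hS hJ h0 σ htJ ht.le x
  calc _ ≤ eLpNorm (fun t => Filter.liminf (fun n => W n t) Filter.atTop) p
        (volume.restrict (J ∩ Ioi 0)) := by
        refine eLpNorm_mono_enorm_ae ?_
        filter_upwards [ae_restrict_mem (hJm.inter measurableSet_Ioi)] with t ht
        rw [enorm_eq_self, enorm_eq_self]
        exact hpt t ht
    _ ≤ eLpNorm (fun t => Filter.liminf (fun n => W n t) Filter.atTop) p volume :=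
        eLpNorm_mono_measure _ Measure.restrict_le_self
    _ ≤ Filter.liminf (fun n => eLpNorm (W n) p volume) Filter.atTop := eLpNorm_liminf_le hp hWm
    _ ≤ _ := Filter.liminf_le_of_le (by isBoundedDefault) fun b hb =>
        let ⟨n, hn⟩ := hb.exists
        hn.trans (hWle n)

lemma mixedNorm3_eq_eLpNorm {p : ℝ≥0∞} (hp : p ≠ 0) (q : ℝ≥0∞) (J : Set ℝ) (F : ℝ → E3 → ℂ) :
    mixedNorm3 p q J F = eLpNorm (fun t => eLpNorm (F t) q volume) p (volume.restrict J) := by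
  rw [mixedNorm3]
  split_ifs with h
  · rw [h, eLpNorm_exponent_top, eLpNormEssSup]
    simp only [enorm_eq_self]
  · rw [eLpNorm_eq_eLpNorm' hp h, eLpNorm']
    simp only [enorm_eq_self]

lemma eLpNorm_restrict_comp_neg (h : ℝ → ℝ≥0∞) (p : ℝ≥0∞) (J : Set ℝ) :
    eLpNorm (fun t => h (-t)) p (volume.restrict (Neg.neg ⁻¹' J)) =
      eLpNorm h p (volume.restrict J) := by
  have he : MeasurableEmbedding (Neg.neg : ℝ → ℝ) := (MeasurableEquiv.neg ℝ).measurableEmbedding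
  rw [← ((Measure.measurePreserving_neg (volume : Measure ℝ)).restrict_preimage_emb he J).map_eq,
    he.eLpNorm_map_measure]
  rfl

lemma halfWave3_neg (σ t : ℝ) (f : E3 → ℂ) : halfWave3 (-σ) t f = halfWave3 σ (-t) f := by
  unfold halfWave3
  congr 1; ext ξ
  congr 2
  push_cast
  ring

lemma retarded_integral_neg (σ : ℝ) (F : ℝ → E3 → ℂ) (t : ℝ) (x : E3) :
    ∫ s in (0:ℝ)..t, halfWave3 (-σ) (t - s) (F (-s)) x =
      -∫ s in (0:ℝ)..-t, halfWave3 σ (-t - s) (F s) x := by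
  have := intervalIntegral.integral_comp_neg (a := 0) (b := t)
    (fun s => halfWave3 σ (-t - s) (F s) x)
  rw [neg_zero] at this
  rw [intervalIntegral.integral_symm (-t) 0, neg_neg, ← this]
  congr 1; ext s
  rw [halfWave3_neg]
  congr 1; ring

lemma retarded_estimate {p q pd qd : ℝ≥0∞} (hp : p ≠ 0) (hq0 : q ≠ 0) (hq : q ≠ ∞) {a : ℝ}
    {K : ℝ≥0} (hR : ∀ σ : ℝ, |σ| = 1 → ∀ H, UDec 12 H → ∀ T : ℝ, 0 ≤ T →
      eLpNorm (fun τ => eLpNorm (retarded σ H 0 τ) q volume) p (volume.restrict (Ioc 0 T)) ≤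
        K * eLpNorm (fun τ => eLpNorm (𝓕⁻ (gradForcing a H τ)) qd volume) pd volume)
    {σ : ℝ} (hσ : |σ| = 1) {F : ℝ → E3 → ℂ} (hF : Measurable (Function.uncurry F))
    (hS : ∀ t, ∃ g : 𝓢(E3, ℂ), F t = g) {J : Set ℝ} (hJ : J.OrdConnected) (h0 : 0 ∈ J) :
    eLpNorm (fun t => eLpNorm (fun x => ∫ s in (0:ℝ)..t, halfWave3 σ (t - s) (F s) x) q volume) p
        (volume.restrict J) ≤ 2 ^ (1 / p.toReal) *
      (K * eLpNorm (fun t => eLpNorm (absGrad3 a (F t)) qd volume) pd (volume.restrict J)) := by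
  have hset : J =ᵐ[volume] ((J ∩ Ioi 0) ∪ (J ∩ Iio 0) : Set ℝ) := by
    have : ∀ᵐ t : ℝ, t ≠ 0 := by simp [ae_iff]
    filter_upwards [this] with t ht
    refine propext ⟨fun h => ?_, fun h => h.elim And.left And.left⟩
    exact (lt_or_gt_of_ne ht).elim (fun hl => Or.inr ⟨h, hl⟩) fun hl => Or.inl ⟨h, hl⟩
  rw [Measure.restrict_congr_set hset]
  refine eLpNorm_restrict_union_le hp ?_ ?_
  · rw [← Measure.restrict_congr_set hset]
    exact retarded_estimate_half hp hq0 hq (hR σ hσ) hF hS hJ h0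
  · rw [← Measure.restrict_congr_set hset]
    have h1 := retarded_estimate_half hp hq0 hq (hR (-σ) (by rwa [abs_neg])) (F := fun s => F (-s))
      (hF.comp (measurable_fst.neg.prodMk measurable_snd)) (fun t => hS (-t))
      (J := Neg.neg ⁻¹' J) (hJ.preimage_anti fun _ _ h => neg_le_neg h) (by simpa using h0)
    rw [eLpNorm_restrict_comp_neg (fun t => eLpNorm (absGrad3 a (F t)) qd volume)] at h1
    refine le_trans (le_of_eq ?_) h1
    rw [← eLpNorm_restrict_comp_neg]
    have e : (Neg.neg ⁻¹' (J ∩ Iio 0) : Set ℝ) = Neg.neg ⁻¹' J ∩ Ioi 0 := by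
      ext t; simp
    rw [e]
    congr 1; ext t
    simp only [retarded_integral_neg]
    exact (eLpNorm_neg (fun x => ∫ s in (0:ℝ)..-t, halfWave3 σ (-t - s) (F s) x) q volume).symm

lemma admissible_toReal {p q : ℝ≥0∞} (hp : 2 ≤ p) (hq2 : 2 ≤ q) (hq : q ≠ ∞)
    (hadm : 1 / p + 1 / q ≤ 1 / 2) : 0 ≤ 1 / p.toReal ∧ 0 < 1 / q.toReal ∧ 1 / q.toReal ≤ 1 / 2 ∧
      1 / p.toReal + 1 / q.toReal ≤ 1 / 2 := by
  have hq' : 2 ≤ q.toReal := by simpa using ENNReal.toReal_mono hq hq2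
  refine ⟨by positivity, by positivity, one_div_le_one_div_of_le two_pos hq', ?_⟩
  have hp1 : 1 / p ≠ ∞ := by simpa using (two_pos.trans_le hp).ne'
  have hq1 : 1 / q ≠ ∞ := by simpa using (two_pos.trans_le hq2).ne'
  have := ENNReal.toReal_mono (by simp) hadm
  rw [ENNReal.toReal_add hp1 hq1] at this
  simpa using this

/-- **Inhomogeneous (retarded) Strichartz estimate for the half-wave propagator in `d = 3`.** -/
theorem strichartz_halfWave_retarded (p q pt qt : ℝ≥0∞)
    (hp : 2 ≤ p) (hq2 : 2 ≤ q) (hq : q ≠ ∞) (hadm : 1 / p + 1 / q ≤ 1 / 2)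
    (hpt : 2 ≤ pt) (hqt2 : 2 ≤ qt) (hqt : qt ≠ ∞) (hadmt : 1 / pt + 1 / qt ≤ 1 / 2) :
    ∃ C : ℝ≥0, ∀ (σ : ℝ), (σ = 1 ∨ σ = -1) →
      ∀ F : ℝ → E3 → ℂ,
        ContDiff ℝ (⊤ : ℕ∞) (fun p : ℝ × E3 => F p.1 p.2) →
        (∀ (k : ℕ) (t : ℝ), ∃ g : 𝓢(E3, ℂ), ∀ x, iteratedDeriv k (fun s => F s x) t = g x) →
        (∃ R : ℝ, ∀ t : ℝ, R < |t| → ∀ x, F t x = 0) →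
      ∀ J : Set ℝ, J.OrdConnected → (0:ℝ) ∈ J →
        mixedNorm3 p q J
            (fun t x => ∫ s in (0:ℝ)..t, halfWave3 σ (t - s) (F s) x) ≤
          (C : ℝ≥0∞) *
            mixedNorm3 (1 - 1/pt)⁻¹ (1 - 1/qt)⁻¹ J
              (fun t => absGrad3
                (2 - (1 / p.toReal + 3 / q.toReal - 1 / 2)
                   - (1 / pt.toReal + 3 / qt.toReal - 1 / 2)) (F t)) := by
  obtain ⟨C, hC⟩ := homStrichartz hp hq2 hq hadm
  obtain ⟨C', hC'⟩ := homStrichartz hpt hqt2 hqt hadmt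
  obtain ⟨hp1, hq1, hq3, hpq⟩ := admissible_toReal hp hq2 hq hadm
  obtain ⟨hpt1, hqt1, hqt3, hpqt⟩ := admissible_toReal hpt hqt2 hqt hadmt
  have e1 : 3 / q.toReal = 3 * (1 / q.toReal) := by ring
  have e2 : 3 / qt.toReal = 3 * (1 / qt.toReal) := by ring
  obtain ⟨K, hK⟩ : ∃ K : ℝ≥0, K =
    (C * C' + 1) / (1 - (2 : ℝ≥0) ^ (1 / p.toReal - (1 - 1 / pt.toReal))) := ⟨_, rfl⟩
  refine ⟨2 ^ (1 / p.toReal) * K, fun σ hσ F hF hFS _ J hJ h0 => ?_⟩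
  have hσ' : |σ| = 1 := by rcases hσ with rfl | rfl <;> simp
  have hS : ∀ t, ∃ g : 𝓢(E3, ℂ), F t = g := fun t => by
    obtain ⟨g, hg⟩ := hFS 0 t
    exact ⟨g, funext fun x => by simpa using hg x⟩
  have hpd : (1 - 1 / pt)⁻¹ ≠ 0 := ENNReal.inv_ne_zero.2 (by simp)
  have hp0 : p ≠ 0 := (two_pos.trans_le hp).ne'
  rw [mixedNorm3_eq_eLpNorm hp0, mixedNorm3_eq_eLpNorm hpd]
  refine (retarded_estimate (K := K)
    (a := 2 - (1 / p.toReal + 3 / q.toReal - 1 / 2) - (1 / pt.toReal + 3 / qt.toReal - 1 / 2))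
    (pd := (1 - 1 / pt)⁻¹) (qd := (1 - 1 / qt)⁻¹) hp0 (two_pos.trans_le hq2).ne' hq (fun σ hσ H hH T hT => ?_) hσ'
    hF.continuous.measurable hS hJ h0).trans_eq ?_
  · rw [show 2 - (1 / p.toReal + 3 / q.toReal - 1 / 2) - (1 / pt.toReal + 3 / qt.toReal - 1 / 2) =
      (3 / 2 - 1 / p.toReal - 3 / q.toReal) + (3 / 2 - 1 / pt.toReal - 3 / qt.toReal) by ring, hK]
    exact strichartz_retarded_Ioc (one_le_two.trans hp) hq2 hq (by linarith) hC hpt hqt2 hqt hC'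
      (by rw [e1, e2]; linarith) (by rw [e1, e2]; linarith) (by rw [e1, e2]; linarith) hσ hH hT
  · rw [ENNReal.coe_mul, ENNReal.coe_rpow_of_ne_zero two_ne_zero, ENNReal.coe_ofNat, mul_assoc]

end
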